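/- arXiv:1803.01031 — 3 statements merged into one kernel-verified Lean document; each statement's English description precedes it below -/
import Mathlib

section
/- As n → ∞, pa(n) is asymptotically equal to (√A/(2πn))·e^{2√(An)}, where A = π²/12 + 2(log((1+√5)/2))². That is, the ratio pa(n) / ((√A/(2πn))·e^{2√(An)}) tends to 1 as n → ∞. -/
open Filter Topology

/-- A partition is (unlimited) parity alternating if any two consecutive distinct part
sizes have opposite parity. -/
def ParityAlternating {n : ℕ} (p : n.Partition) : Prop :=
  ∀ a ∈ p.parts, ∀ b ∈ p.parts, a < b →
    (∀ c ∈ p.parts, ¬(a < c ∧ c < b)) → (Odd a ↔ Even b)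

/-- The number of unlimited parity alternating partitions of `n`. -/
noncomputable def pa (n : ℕ) : ℕ := Nat.card {p : n.Partition // ParityAlternating p}


/-- `d` is an admissible multiplicity: zero or odd. -/
def Adm (d : ℕ) : Prop := d = 0 ∨ Odd d

instance : DecidablePred Adm := fun d => by unfold Adm; infer_instance

/-- number of partitions of `n` with parts at most `M`, every multiplicity zero or odd -/
def po : ℕ → ℕ → ℕ
  | 0, n => if n = 0 then 1 else 0
  | M + 1, n => ∑ d ∈ (Finset.range (n + 1)).filter (fun d => Adm d ∧ (M + 1) * d ≤ n),
      po M (n - (M + 1) * d)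

lemma po_succ (M n : ℕ) : po (M + 1) n =
    ∑ d ∈ (Finset.range (n + 1)).filter (fun d => Adm d ∧ (M + 1) * d ≤ n),
      po M (n - (M + 1) * d) := rfl

/-- step relation of alternating chains -/
def RR (a b : ℕ) : Prop := ∃ d, Adm d ∧ b = a + d

/-- finset of chains of length `l` starting after `x` with sum `m + l * x` -/
def chains : ℕ → ℕ → ℕ → Finset (List ℕ)
  | 0, _, m => if m = 0 then {[]} else ∅
  | l + 1, x, m => ((Finset.range (m + 1)).filter (fun d => Adm d ∧ (l + 1) * d ≤ m)).biUnion
      (fun d => (chains l (x + d) (m - (l + 1) * d)).image (List.cons (x + d)))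

lemma card_chains (l : ℕ) : ∀ x m, (chains l x m).card = po l m := by
  induction l with
  | zero => intro x m; simp only [chains, po]; split_ifs <;> simp
  | succ l ih =>
    intro x m
    rw [chains, po_succ, Finset.card_biUnion]
    · apply Finset.sum_congr rfl
      intro d _
      rw [Finset.card_image_of_injective _ (List.cons_injective), ih]
    · intro d1 _ d2 _ h
      simp only [Function.onFun]
      rw [Finset.disjoint_left]
      intro s hs ht
      simp only [Finset.mem_image] at hs ht
      obtain ⟨u, _, rfl⟩ := hs
      obtain ⟨v, _, hv⟩ := ht
      simp at hv
      omega

lemma mem_chains (l : ℕ) : ∀ x m s, s ∈ chains l x m ↔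
    s.length = l ∧ (x :: s).IsChain RR ∧ s.sum = m + l * x := by
  induction l with
  | zero =>
    intro x m s
    simp only [chains]
    constructor
    · intro h
      split_ifs at h with hm
      · simp at h; subst h; subst hm; simp
      · simp at h
    · rintro ⟨h1, _, h3⟩
      simp at h1; subst h1; simp at h3
      simp [← h3]
  | succ l ih =>
    intro x m s
    simp only [chains, Finset.mem_biUnion, Finset.mem_filter, Finset.mem_range, Finset.mem_image]
    constructor
    · rintro ⟨d, ⟨h1, h2, h3⟩, u, hu, rfl⟩
      rw [ih] at hu
      obtain ⟨hu1, hu2, hu3⟩ := hu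
      refine ⟨by simp [hu1], ?_, ?_⟩
      · rw [List.isChain_cons_cons]
        exact ⟨⟨d, h2, rfl⟩, hu2⟩
      · rw [List.sum_cons, hu3]
        zify [h3]; ring
    · rintro ⟨h1, h2, h3⟩
      cases s with
      | nil => simp at h1
      | cons y u =>
        rw [List.isChain_cons_cons] at h2
        obtain ⟨⟨d, hd, rfl⟩, h2⟩ := h2
        have hu : l * (x + d) ≤ u.sum := by
          have hge : ∀ z ∈ u, x + d ≤ z := by
            have htr : ((x + d) :: u).IsChain (· ≤ ·) := by
              apply h2.imp
              rintro a b ⟨e, _, rfl⟩; omega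
            rw [List.isChain_iff_pairwise] at htr
            exact (List.pairwise_cons.mp htr).1
          have := List.card_nsmul_le_sum u (x + d) hge
          simp at h1
          simpa [h1] using this
        rw [List.sum_cons] at h3
        have h3' : (l + 1) * d ≤ m := by nlinarith
        have : d ≤ (l + 1) * d := by nlinarith
        refine ⟨d, ⟨by omega, hd, h3'⟩, u, ?_, rfl⟩
        rw [ih]
        refine ⟨by simpa using h1, h2, ?_⟩
        zify [h3'] at h3 ⊢
        linarith


lemma RR_le {a b : ℕ} (h : RR a b) : a ≤ b := by
  obtain ⟨d, _, rfl⟩ := h; omega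

lemma RR_pairwise {l : List ℕ} (h : l.IsChain RR) : l.Pairwise (· ≤ ·) := by
  rw [← List.isChain_iff_pairwise]
  exact h.imp (fun a b => RR_le)

lemma RR_iff {a b : ℕ} (h : a ≤ b) : RR a b ↔ (a < b → (Odd a ↔ Even b)) := by
  constructor
  · rintro ⟨d, hd, rfl⟩ h2
    rcases hd with rfl | hd
    · omega
    · grind
  · intro h1
    refine ⟨b - a, ?_, by omega⟩
    rcases h.eq_or_lt with h2 | h2
    · left; omega
    · right
      have := h1 h2
      grind

lemma alt_iff_chain (l : List ℕ) (hl : l.Pairwise (· ≤ ·)) :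
    (∀ a ∈ l, ∀ b ∈ l, a < b → (∀ c ∈ l, ¬(a < c ∧ c < b)) → (Odd a ↔ Even b)) ↔
      l.IsChain RR := by
  induction l with
  | nil => simp
  | cons x l ih =>
    cases l with
    | nil => simp
    | cons y u =>
      have hl' := List.pairwise_cons.mp hl
      have ih := ih hl'.2
      have hxy : x ≤ y := hl'.1 y (by simp)
      have hyu : ∀ b ∈ (y :: u), y ≤ b := by
        intro b hb
        rcases List.mem_cons.mp hb with rfl | hb
        · exact le_rfl
        · exact (List.pairwise_cons.mp hl'.2).1 b hb
      rw [List.isChain_cons_cons, ← ih, RR_iff hxy]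
      constructor
      · intro h
        refine ⟨fun hlt => h x (by simp) y (by simp) hlt ?_, ?_⟩
        · intro c hc hh
          rcases List.mem_cons.mp hc with rfl | hc
          · omega
          · have := hyu c hc; omega
        · intro a ha b hb hab hc
          refine h a (List.mem_cons_of_mem _ ha) b (List.mem_cons_of_mem _ hb) hab ?_
          intro c hc' hh
          rcases List.mem_cons.mp hc' with rfl | hc'
          · have := hl'.1 a ha; omega
          · exact hc c hc' hh
      · rintro ⟨h1, h2⟩ a ha b hb hab hc
        have hb' : b ∈ y :: u := by
          rcases List.mem_cons.mp hb with rfl | hb'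
          · exfalso
            rcases List.mem_cons.mp ha with rfl | ha
            · omega
            · have := hl'.1 a ha; omega
          · exact hb'
        by_cases ha' : a ∈ y :: u
        · exact h2 a ha' b hb' hab (fun c hc' => hc c (List.mem_cons_of_mem _ hc'))
        · have hax : a = x := by
            rcases List.mem_cons.mp ha with h | h
            · exact h
            · exact absurd h ha'
          subst hax
          have hyb := hyu b hb'
          have := hc y (by simp)
          have hay : a ≠ y := by rintro rfl; simp at ha'
          have : y = b := by omega
          subst this
          exact h1 hab

/-- all alternating ascending lists of positive integers with sum `n` -/
def altLists (n : ℕ) : Finset (List ℕ) :=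
  (((Finset.range n) ×ˢ (Finset.Icc 1 n)).filter (fun p => (p.1 + 1) * p.2 ≤ n)).biUnion
    (fun p => (chains p.1 p.2 (n - (p.1 + 1) * p.2)).image (List.cons p.2))

lemma card_altLists (n : ℕ) : (altLists n).card =
    ∑ p ∈ ((Finset.range n) ×ˢ (Finset.Icc 1 n)).filter (fun p => (p.1 + 1) * p.2 ≤ n),
      po p.1 (n - (p.1 + 1) * p.2) := by
  rw [altLists, Finset.card_biUnion]
  · apply Finset.sum_congr rfl
    intro d _
    rw [Finset.card_image_of_injective _ (List.cons_injective), card_chains]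
  · intro d1 _ d2 _ h
    simp only [Function.onFun]
    rw [Finset.disjoint_left]
    intro s hs ht
    simp only [Finset.mem_image] at hs ht
    obtain ⟨u, hu, rfl⟩ := hs
    obtain ⟨v, hv', hv⟩ := ht
    rw [mem_chains] at hu hv'
    simp only [List.cons.injEq] at hv
    apply h
    ext
    · rw [← hu.1, ← hv'.1, hv.2]
    · exact hv.1.symm

lemma mem_altLists {n : ℕ} (hn : 0 < n) (s : List ℕ) : s ∈ altLists n ↔
    s.IsChain RR ∧ s.sum = n ∧ ∀ a ∈ s, 0 < a := by
  simp only [altLists, Finset.mem_biUnion, Finset.mem_filter, Finset.mem_product, Finset.mem_range,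
    Finset.mem_Icc, Finset.mem_image, Prod.exists]
  constructor
  · rintro ⟨l, x, ⟨⟨h1, h2⟩, h3⟩, u, hu, rfl⟩
    rw [mem_chains] at hu
    obtain ⟨hu1, hu2, hu3⟩ := hu
    refine ⟨hu2, ?_, ?_⟩
    · rw [List.sum_cons, hu3]
      zify [h3]; ring
    · intro a ha
      rcases List.mem_cons.mp ha with rfl | ha
      · omega
      · have := (List.pairwise_cons.mp (RR_pairwise hu2)).1 a ha
        omega
  · rintro ⟨h1, h2, h3⟩
    cases s with
    | nil => simp at h2; omega
    | cons x u =>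
      have hx : 0 < x := h3 x (by simp)
      have hge := (List.pairwise_cons.mp (RR_pairwise h1)).1
      have hs := List.card_nsmul_le_sum u x hge
      simp only [smul_eq_mul] at hs
      rw [List.sum_cons] at h2
      have hle : (u.length + 1) * x ≤ n := by nlinarith
      have hlen : u.length + 1 ≤ (u.length + 1) * x := Nat.le_mul_of_pos_right _ hx
      refine ⟨u.length, x, ⟨⟨by omega, by omega, by omega⟩, hle⟩, u, ?_, rfl⟩
      rw [mem_chains]
      refine ⟨rfl, h1, ?_⟩
      zify [hle] at h2 ⊢
      linarith

lemma pa_eq_card {n : ℕ} (hn : 0 < n) : pa n = (altLists n).card := by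
  rw [pa, ← Nat.card_eq_finsetCard]
  have key : ∀ p : n.Partition, ParityAlternating p ↔ (p.parts.sort (· ≤ ·)) ∈ altLists n := by
    intro p
    rw [mem_altLists hn]
    have h1 : (p.parts.sort (· ≤ ·)).sum = n := by
      rw [← Multiset.sum_coe, Multiset.sort_eq, p.parts_sum]
    have h2 : ∀ a ∈ p.parts.sort (· ≤ ·), 0 < a := by
      intro a ha
      rw [Multiset.mem_sort] at ha
      exact p.parts_pos ha
    rw [← alt_iff_chain _ (Multiset.pairwise_sort _ _)]
    simp only [Multiset.mem_sort]
    unfold ParityAlternating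
    exact ⟨fun h => ⟨h, h1, fun a ha => p.parts_pos ha⟩, fun h => h.1⟩
  refine Nat.card_eq_of_bijective
    (fun p : {p : n.Partition // ParityAlternating p} =>
      (⟨p.1.parts.sort (· ≤ ·), (key p.1).mp p.2⟩ : {l // l ∈ altLists n})) ⟨?_, ?_⟩
  · rintro ⟨p, hp⟩ ⟨q, hq⟩ h
    simp only [Subtype.mk.injEq] at h ⊢
    ext1
    rw [← Multiset.sort_eq p.parts (· ≤ ·), h, Multiset.sort_eq]
  · rintro ⟨l, hl⟩
    have hl' := (mem_altLists hn l).mp hl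
    have hs : Multiset.sort (l : Multiset ℕ) (· ≤ ·) = l := by
      have := RR_pairwise hl'.1
      rw [Multiset.coe_sort]
      exact List.mergeSort_eq_self _ this
    let p : n.Partition := ⟨(l : Multiset ℕ), fun {i} hi => hl'.2.2 i (by simpa using hi),
      by simpa using hl'.2.1⟩
    have hp : p.parts.sort (· ≤ ·) = l := hs
    exact ⟨⟨p, (key p).mpr (by rw [hp]; exact hl)⟩, by simp [hp]⟩


lemma po_succ' (M n : ℕ) : po (M + 1) n = po M n +
    ∑ d ∈ (Finset.Icc 1 n).filter (fun d => Odd d ∧ (M + 1) * d ≤ n),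
      po M (n - (M + 1) * d) := by
  rw [po_succ]
  have : (Finset.range (n + 1)).filter (fun d => Adm d ∧ (M + 1) * d ≤ n) =
      insert 0 ((Finset.Icc 1 n).filter (fun d => Odd d ∧ (M + 1) * d ≤ n)) := by
    ext d
    simp only [Finset.mem_filter, Finset.mem_range, Finset.mem_insert, Finset.mem_Icc]
    rcases Nat.eq_zero_or_pos d with rfl | h
    · simp [Adm]
    · constructor
      · rintro ⟨h1, h2 | h2, h3⟩
        · omega
        · exact Or.inr ⟨⟨h, by omega⟩, h2, h3⟩
      · rintro (h1 | ⟨h1, h2, h3⟩)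
        · omega
        · exact ⟨by omega, Or.inr h2, h3⟩
  rw [this, Finset.sum_insert (by simp)]
  simp

lemma po_le_succ (M n : ℕ) : po M n ≤ po (M + 1) n := by
  rw [po_succ']; exact Nat.le_add_right _ _

lemma po_mono (n : ℕ) : Monotone (fun M => po M n) :=
  monotone_nat_of_le_succ (fun M => po_le_succ M n)

lemma po_stab (n : ℕ) : ∀ M, n ≤ M → po M n = po n n := by
  intro M h
  induction M, h using Nat.le_induction with
  | base => rfl
  | succ M hM ih =>
    rw [po_succ', ih, Finset.filter_eq_empty_iff.mpr]
    · simp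
    · intro d hd
      simp only [Finset.mem_Icc] at hd
      rintro ⟨_, h⟩
      nlinarith

/-- number of partitions with all multiplicities zero or odd -/
def PO (n : ℕ) : ℕ := po n n

lemma po_le_PO (M n : ℕ) : po M n ≤ PO n := by
  rcases le_total M n with h | h
  · exact po_mono n h
  · exact (po_stab n M h).le

lemma po_tele (n : ℕ) (hn : 0 < n) (K : ℕ) : po K n = ∑ l ∈ Finset.range K,
    ∑ d ∈ (Finset.Icc 1 n).filter (fun d => Odd d ∧ (l + 1) * d ≤ n), po l (n - (l + 1) * d) := by
  induction K with
  | zero => simp [po, hn.ne']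
  | succ K ih => rw [Finset.sum_range_succ, ← ih, po_succ']

lemma pa_eq {n : ℕ} (hn : 0 < n) : pa n = PO n + ∑ l ∈ Finset.range n,
    ∑ d ∈ (Finset.Icc 1 n).filter (fun d => Even d ∧ (l + 1) * d ≤ n), po l (n - (l + 1) * d) := by
  rw [pa_eq_card hn, card_altLists, PO, po_tele n hn n, ← Finset.sum_add_distrib,
    Finset.sum_filter, Finset.sum_product]
  apply Finset.sum_congr rfl
  intro l _
  rw [← Finset.sum_filter, ← Finset.sum_union]
  · apply Finset.sum_congr _ (fun _ _ => rfl)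
    ext d
    simp only [Finset.mem_filter, Finset.mem_union]
    have := Nat.even_or_odd d
    tauto
  · rw [Finset.disjoint_left]
    intro d h1 h2
    simp only [Finset.mem_filter] at h1 h2
    exact (Nat.not_even_iff_odd.mpr h1.2.1) h2.2.1


/-- The `j`-th factor of the generating function. -/
noncomputable def Fac (j : ℕ) (x : ℂ) : ℂ := 1 + x ^ (j + 1) / (1 - (x ^ (j + 1)) ^ 2)

lemma hs_congr {f g : ℕ → ℂ} {a : ℂ} (h : ∀ n, f n = g n) (hg : HasSum g a) : HasSum f a := by
  rw [funext h]; exact hg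

lemma hasSum_adm {y : ℂ} (hy : ‖y‖ < 1) :
    HasSum (fun d : ℕ => if Adm d then y ^ d else 0) (1 + y / (1 - y ^ 2)) := by
  have hy2 : ‖y ^ 2‖ < 1 := by
    rw [norm_pow]; exact pow_lt_one₀ (norm_nonneg _) hy (by norm_num)
  have h1 : HasSum (fun k : ℕ => if Adm (2 * k) then y ^ (2 * k) else 0) 1 := by
    convert hasSum_ite_eq (0 : ℕ) (1 : ℂ) using 2 with k
    by_cases hk : k = 0
    · simp [hk, Adm]
    · have : ¬ Adm (2 * k) := by
        rintro (h | h)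
        · omega
        · exact (Nat.not_odd_iff_even.mpr (even_two_mul k)) h
      simp [hk, this]
  have h2 : HasSum (fun k : ℕ => if Adm (2 * k + 1) then y ^ (2 * k + 1) else 0)
      (y / (1 - y ^ 2)) := by
    have := (hasSum_geometric_of_norm_lt_one hy2).mul_left y
    refine hs_congr (fun k => ?_) this
    have : Adm (2 * k + 1) := Or.inr ⟨k, rfl⟩
    rw [if_pos this, pow_succ, pow_mul]; ring
  exact HasSum.even_add_odd h1 h2

lemma hasSum_po {x : ℂ} (hx : ‖x‖ < 1) (M : ℕ) :
    HasSum (fun n : ℕ => (po M n : ℂ) * x ^ n) (∏ j ∈ Finset.range M, Fac j x) := by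
  induction M with
  | zero =>
    simp only [Finset.range_zero, Finset.prod_empty]
    convert hasSum_ite_eq (0 : ℕ) (1 : ℂ) using 2 with k
    by_cases hk : k = 0 <;> simp [hk, po]
  | succ M ih =>
    rw [Finset.prod_range_succ]
    have hy : ‖x ^ (M + 1)‖ < 1 := by
      rw [norm_pow]; exact pow_lt_one₀ (norm_nonneg _) hx (by omega)
    have h2 := hasSum_adm hy
    have hs := summable_mul_of_summable_norm ih.summable.norm h2.summable.norm
    have h3 := ih.mul h2 hs
    have h4 := h3.tsum_fiberwise (fun p : ℕ × ℕ => p.1 + (M + 1) * p.2)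
    refine hs_congr (fun n => ?_) h4
    rw [po_succ]
    set s : Finset (ℕ × ℕ) := ((Finset.range (n + 1)).filter (fun d => (M + 1) * d ≤ n)).image
      (fun d => (n - (M + 1) * d, d)) with hsdef
    have hset : (fun p : ℕ × ℕ => p.1 + (M + 1) * p.2) ⁻¹' {n} = (s : Set (ℕ × ℕ)) := by
      ext ⟨a, b⟩
      simp only [Set.mem_preimage, Set.mem_singleton_iff, hsdef, Finset.coe_image, Set.mem_image,
        Finset.mem_coe, Finset.mem_filter, Finset.mem_range, Prod.mk.injEq]
      constructor
      · intro h
        have : b ≤ (M + 1) * b := by nlinarith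
        exact ⟨b, ⟨by omega, by omega⟩, by omega, rfl⟩
      · rintro ⟨d, ⟨h1, h2⟩, h3, rfl⟩
        omega
    rw [hset]
    rw [Finset.tsum_subtype' s (fun b : ℕ × ℕ => (po M b.1 : ℂ) * x ^ b.1 *
      if Adm b.2 then (x ^ (M + 1)) ^ b.2 else 0)]
    rw [hsdef, Finset.sum_image (by intro a _ b _ h; simp at h; exact h.2)]
    simp only [mul_ite, mul_zero]
    rw [← Finset.sum_filter, Finset.filter_filter, Nat.cast_sum, Finset.sum_mul]
    apply Finset.sum_congr
    · ext d; simp only [Finset.mem_filter]; tauto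
    · intro d hd
      simp only [Finset.mem_filter] at hd
      rw [mul_assoc, ← pow_mul, ← pow_add]
      congr 2
      omega

/-- logarithm of the real factor -/
noncomputable def ff (x : ℝ) : ℝ := Real.log (1 + Real.exp (-x) / (1 - Real.exp (-x) ^ 2))

lemma exp_neg_lt_one {x : ℝ} (hx : 0 < x) : Real.exp (-x) < 1 := by
  rw [Real.exp_lt_one_iff]; linarith

lemma one_sub_exp_sq_pos {x : ℝ} (hx : 0 < x) : 0 < 1 - Real.exp (-x) ^ 2 := by
  have := exp_neg_lt_one hx
  have := Real.exp_pos (-x)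
  nlinarith

lemma ff_arg_pos {x : ℝ} (hx : 0 < x) : 0 < Real.exp (-x) / (1 - Real.exp (-x) ^ 2) :=
  div_pos (Real.exp_pos _) (one_sub_exp_sq_pos hx)

lemma exp_ff {x : ℝ} (hx : 0 < x) :
    Real.exp (ff x) = 1 + Real.exp (-x) / (1 - Real.exp (-x) ^ 2) := by
  rw [ff, Real.exp_log]
  have := ff_arg_pos hx; linarith

lemma ff_nonneg {x : ℝ} (hx : 0 < x) : 0 ≤ ff x :=
  Real.log_nonneg (by have := ff_arg_pos hx; linarith)

lemma ff_le {x : ℝ} (hx : 0 < x) : ff x ≤ Real.exp (-x) / (1 - Real.exp (-x) ^ 2) := by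
  have := Real.log_le_sub_one_of_pos (x := 1 + Real.exp (-x) / (1 - Real.exp (-x) ^ 2))
    (by have := ff_arg_pos hx; linarith)
  rw [ff]; linarith

lemma ff_le' {t x : ℝ} (ht : 0 < t) (hx : t ≤ x) :
    ff x ≤ Real.exp (-x) / (1 - Real.exp (-t) ^ 2) := by
  refine (ff_le (ht.trans_le hx)).trans ?_
  have h1 := one_sub_exp_sq_pos ht
  have h2 : Real.exp (-x) ≤ Real.exp (-t) := Real.exp_le_exp.mpr (by linarith)
  gcongr

lemma summable_exp_mul {t : ℝ} (ht : 0 < t) :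
    Summable (fun j : ℕ => Real.exp (-((j + 1 : ℝ) * t))) := by
  have := (summable_geometric_of_lt_one (Real.exp_pos (-t)).le (exp_neg_lt_one ht)).mul_left
    (Real.exp (-t))
  refine this.congr fun j => ?_
  rw [← Real.exp_nat_mul, ← Real.exp_add]; ring_nf

lemma summable_ff {t : ℝ} (ht : 0 < t) : Summable (fun j : ℕ => ff ((j + 1 : ℝ) * t)) := by
  refine Summable.of_nonneg_of_le (fun j => ff_nonneg (by positivity)) (fun j => ?_)
    ((summable_exp_mul ht).div_const (1 - Real.exp (-t) ^ 2))
  exact ff_le' ht (by nlinarith [(Nat.cast_nonneg j : (0:ℝ) ≤ j)])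

/-- log of the generating function -/
noncomputable def LP (t : ℝ) : ℝ := ∑' j : ℕ, ff ((j + 1 : ℝ) * t)

/-- The finite log generating function -/
noncomputable def LPM (M : ℕ) (t : ℝ) : ℝ := ∑ j ∈ Finset.range M, ff ((j + 1 : ℝ) * t)

lemma Fac_real {t : ℝ} (ht : 0 < t) (j : ℕ) :
    Fac j (Real.exp (-t) : ℝ) = ((Real.exp (ff ((j + 1 : ℝ) * t)) : ℝ) : ℂ) := by
  rw [exp_ff (by positivity), Fac]
  push_cast
  rw [← Complex.exp_nat_mul]
  congr 3
  · push_cast; ring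
  · congr 2; push_cast; ring_nf

lemma hasSum_po_real {t : ℝ} (ht : 0 < t) (M : ℕ) :
    HasSum (fun n : ℕ => (po M n : ℝ) * Real.exp (-t) ^ n) (Real.exp (LPM M t)) := by
  rw [← Complex.hasSum_ofReal]
  have := hasSum_po (x := (Real.exp (-t) : ℝ))
    (by rw [Complex.norm_real, Real.norm_of_nonneg (Real.exp_pos _).le]; exact exp_neg_lt_one ht) M
  convert this using 1
  · funext n; push_cast; rfl
  · rw [LPM, Real.exp_sum, Complex.ofReal_prod]
    exact Finset.prod_congr rfl (fun j _ => (Fac_real ht j).symm)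

lemma LPM_le_LP {t : ℝ} (ht : 0 < t) (M : ℕ) : LPM M t ≤ LP t :=
  (summable_ff ht).sum_le_tsum _ (fun j _ => ff_nonneg (by positivity))

lemma LPM_tendsto {t : ℝ} (ht : 0 < t) : Tendsto (fun M => LPM M t) atTop (𝓝 (LP t)) :=
  (summable_ff ht).hasSum.tendsto_sum_nat

lemma hasSum_PO {t : ℝ} (ht : 0 < t) :
    HasSum (fun n : ℕ => (PO n : ℝ) * Real.exp (-t) ^ n) (Real.exp (LP t)) := by
  have hnn : ∀ n : ℕ, 0 ≤ (PO n : ℝ) * Real.exp (-t) ^ n := fun n => by positivity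
  have hb : ∀ K : ℕ, ∑ n ∈ Finset.range K, (PO n : ℝ) * Real.exp (-t) ^ n ≤ Real.exp (LP t) := by
    intro K
    calc ∑ n ∈ Finset.range K, (PO n : ℝ) * Real.exp (-t) ^ n
        = ∑ n ∈ Finset.range K, (po K n : ℝ) * Real.exp (-t) ^ n := by
          apply Finset.sum_congr rfl
          intro n hn
          rw [PO, po_stab n K (Finset.mem_range.mp hn).le]
      _ ≤ Real.exp (LPM K t) := sum_le_hasSum _ (fun n _ => by positivity) (hasSum_po_real ht K)
      _ ≤ _ := Real.exp_le_exp.mpr (LPM_le_LP ht K)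
  have hs : Summable (fun n : ℕ => (PO n : ℝ) * Real.exp (-t) ^ n) :=
    summable_of_sum_range_le hnn hb
  have h1 : ∑' n : ℕ, (PO n : ℝ) * Real.exp (-t) ^ n ≤ Real.exp (LP t) :=
    hs.tsum_le_of_sum_range_le hb
  have h2 : Real.exp (LP t) ≤ ∑' n : ℕ, (PO n : ℝ) * Real.exp (-t) ^ n := by
    refine le_of_tendsto ((Real.continuous_exp.tendsto _).comp (LPM_tendsto ht))
      (Eventually.of_forall fun M => ?_)
    refine hasSum_le (fun n => ?_) (hasSum_po_real ht M) hs.hasSum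
    have : (po M n : ℝ) ≤ PO n := by exact_mod_cast po_le_PO M n
    gcongr
  rw [← le_antisymm h1 h2]
  exact hs.hasSum


/-- dilogarithm on `[-1,1]` -/
noncomputable def li (x : ℝ) : ℝ := ∑' n : ℕ, x ^ (n + 1) / ((n : ℝ) + 1) ^ 2

lemma summable_inv_sq : Summable (fun n : ℕ => 1 / ((n : ℝ) + 1) ^ 2) := by
  have := (summable_nat_add_iff 1).mpr (hasSum_zeta_two.summable)
  refine this.congr fun n => ?_
  push_cast; rfl

lemma li_term_bound {x : ℝ} (hx : |x| ≤ 1) (n : ℕ) :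
    ‖x ^ (n + 1) / ((n : ℝ) + 1) ^ 2‖ ≤ 1 / ((n : ℝ) + 1) ^ 2 := by
  rw [norm_div, norm_pow, Real.norm_eq_abs, Real.norm_of_nonneg (by positivity)]
  have := pow_le_one₀ (n := n + 1) (abs_nonneg x) hx
  gcongr

lemma summable_li {x : ℝ} (hx : |x| ≤ 1) :
    Summable (fun n : ℕ => x ^ (n + 1) / ((n : ℝ) + 1) ^ 2) :=
  Summable.of_norm_bounded summable_inv_sq (li_term_bound hx)

lemma li_continuousOn : ContinuousOn li (Set.Icc (-1) 1) := by
  apply continuousOn_tsum (u := fun n : ℕ => 1 / ((n : ℝ) + 1) ^ 2)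
  · intro n; fun_prop
  · exact summable_inv_sq
  · intro n x hx; exact li_term_bound (abs_le.mpr hx) n

lemma li_zero : li 0 = 0 := by simp [li]

lemma li_one : li 1 = Real.pi ^ 2 / 6 := by
  have h := hasSum_zeta_two
  have h2 := h.tsum_eq
  rw [h.summable.tsum_eq_zero_add] at h2
  rw [li, ← h2]
  simp

lemma li_dup {x : ℝ} (hx : |x| ≤ 1) : li x + li (-x) = li (x ^ 2) / 2 := by
  have h0 : HasSum (fun n : ℕ => x ^ (n + 1) / ((n : ℝ) + 1) ^ 2 +
      (-x) ^ (n + 1) / ((n : ℝ) + 1) ^ 2) (li x + li (-x)) :=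
    (summable_li hx).hasSum.add (summable_li (x := -x) (by rwa [abs_neg])).hasSum
  have hx2 : |x ^ 2| ≤ 1 := by rw [abs_pow]; exact pow_le_one₀ (abs_nonneg _) hx
  have h1 : HasSum (fun n : ℕ => (x ^ 2) ^ (n + 1) / ((n : ℝ) + 1) ^ 2 / 2) (li (x ^ 2) / 2) :=
    (summable_li hx2).hasSum.div_const 2
  have h2 : HasSum (fun n : ℕ => x ^ (n + 1) / ((n : ℝ) + 1) ^ 2 +
      (-x) ^ (n + 1) / ((n : ℝ) + 1) ^ 2) (0 + li (x ^ 2) / 2) := by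
    apply HasSum.even_add_odd
    · convert (hasSum_zero : HasSum (fun _ : ℕ => (0 : ℝ)) 0) using 2 with k
      have : (-x) ^ (2 * k + 1) = - x ^ (2 * k + 1) := Odd.neg_pow ⟨k, rfl⟩ x
      rw [this]; ring
    · refine (Eq.subst (motive := fun f => HasSum f (li (x ^ 2) / 2)) (funext fun k => ?_) h1)
      have : (-x) ^ (2 * k + 1 + 1) = x ^ (2 * k + 1 + 1) := Even.neg_pow ⟨k + 1, by ring⟩ x
      rw [this, ← pow_mul]
      push_cast
      have h3 : ((k : ℝ) + 1) ≠ 0 := by positivity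
      have h4 : (2 * (k : ℝ) + 1 + 1) ≠ 0 := by positivity
      field_simp
      ring_nf
  rw [h0.unique h2]; ring

lemma li_neg_one : li (-1) = -(Real.pi ^ 2 / 12) := by
  have := li_dup (x := 1) (by simp)
  rw [one_pow, li_one] at this
  linarith

lemma li_hasDerivAt {x : ℝ} (hx : |x| < 1) (hx0 : x ≠ 0) :
    HasDerivAt li (-Real.log (1 - x) / x) x := by
  obtain ⟨r, hr1, hr2⟩ := exists_between hx
  have hr0 : 0 < r := (abs_nonneg x).trans_lt hr1
  have key : HasDerivAt li (∑' n : ℕ, x ^ n / ((n : ℝ) + 1)) x := by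
    apply hasDerivAt_tsum_of_isPreconnected (u := fun n : ℕ => r ^ n)
      (g := fun (n : ℕ) (y : ℝ) => y ^ (n + 1) / ((n : ℝ) + 1) ^ 2)
      (g' := fun (n : ℕ) (y : ℝ) => y ^ n / ((n : ℝ) + 1))
      (t := Set.Ioo (-r) r) (y₀ := 0)
    · exact summable_geometric_of_lt_one hr0.le hr2
    · exact isOpen_Ioo
    · exact isPreconnected_Ioo
    · intro n y _
      have h := (hasDerivAt_pow (n + 1) y).div_const (((n : ℝ) + 1) ^ 2)
      refine h.congr_deriv ?_
      have h3 : ((n : ℝ) + 1) ≠ 0 := by positivity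
      push_cast
      field_simp
    · intro n y hy
      rw [norm_div, norm_pow, Real.norm_eq_abs, Real.norm_of_nonneg (by positivity)]
      have h1 : |y| ≤ r := (abs_lt.mpr hy).le
      have h2 : |y| ^ n ≤ r ^ n := by gcongr
      refine (div_le_self (by positivity) ?_).trans h2
      have : (0:ℝ) ≤ n := Nat.cast_nonneg n
      linarith
    · exact ⟨by linarith, hr0⟩
    · simp
    · exact abs_lt.mp hr1
  refine key.congr_deriv (Eq.symm ?_)
  have h := (Real.hasSum_pow_div_log_of_abs_lt_one hx).tsum_eq
  rw [← h, ← tsum_div_const]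
  apply tsum_congr
  intro n
  have h3 : ((n : ℝ) + 1) ≠ 0 := by positivity
  field_simp
  ring

lemma eq_of_hasDerivAt_zero {f : ℝ → ℝ} {a b : ℝ} (hab : a < b)
    (hc : ContinuousOn f (Set.Icc a b)) (hd : ∀ x ∈ Set.Ioo a b, HasDerivAt f 0 x) : f b = f a := by
  obtain ⟨c, hc1, hc2⟩ := exists_hasDerivAt_eq_slope f (fun _ => 0) hab hc hd
  have : b - a ≠ 0 := by linarith
  field_simp at hc2
  linarith

lemma li_reflection {x : ℝ} (hx0 : 0 < x) (hx1 : x < 1) :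
    li x + li (1 - x) = Real.pi ^ 2 / 6 - Real.log x * Real.log (1 - x) := by
  set R : ℝ → ℝ := fun y => li y + li (1 - y) + Real.log y * Real.log (1 - y) with hR
  have hd : ∀ y ∈ Set.Ioo (0:ℝ) 1, HasDerivAt R 0 y := by
    rintro y ⟨h0, h1⟩
    have e1 := li_hasDerivAt (x := y) (by rw [abs_lt]; constructor <;> linarith) h0.ne'
    have hs : HasDerivAt (fun z : ℝ => 1 - z) (-1) y := by
      simpa using (hasDerivAt_id y).const_sub 1
    have e2 := (li_hasDerivAt (x := 1 - y) (by rw [abs_lt]; constructor <;> linarith)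
      (by linarith)).comp y hs
    have e3 := (Real.hasDerivAt_log h0.ne').mul (hs.log (by linarith))
    have := (e1.add e2).add e3
    refine HasDerivAt.congr_deriv (f := R) this ?_
    have h2 : 1 - y ≠ 0 := by linarith
    have h3 : y ≠ 0 := h0.ne'
    rw [sub_sub_cancel]
    field_simp
    ring
  have hlim : Tendsto R (𝓝[>] 0) (𝓝 (Real.pi ^ 2 / 6)) := by
    have l1 : Tendsto li (𝓝[>] 0) (𝓝 0) := by
      have : ContinuousAt li 0 := li_continuousOn.continuousAt (Icc_mem_nhds (by norm_num) (by norm_num))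
      have := this.tendsto
      rw [li_zero] at this
      exact this.mono_left nhdsWithin_le_nhds
    have l2 : Tendsto (fun y => li (1 - y)) (𝓝[>] 0) (𝓝 (Real.pi ^ 2 / 6)) := by
      have h := li_continuousOn 1 (by simp)
      rw [ContinuousWithinAt, li_one] at h
      apply h.comp
      apply tendsto_nhdsWithin_iff.mpr ⟨?_, ?_⟩
      · have : Tendsto (fun y : ℝ => 1 - y) (𝓝 0) (𝓝 (1 - 0)) := by
          exact tendsto_const_nhds.sub tendsto_id
        rw [sub_zero] at this
        exact this.mono_left nhdsWithin_le_nhds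
      · filter_upwards [Ioo_mem_nhdsGT (show (0:ℝ) < 1 by norm_num)] with y hy
        exact ⟨by linarith [hy.2], by linarith [hy.1]⟩
    have l3 : Tendsto (fun y => Real.log y * Real.log (1 - y)) (𝓝[>] 0) (𝓝 0) := by
      have h1 : Tendsto (fun y : ℝ => Real.log y * y) (𝓝[>] 0) (𝓝 0) := by
        have := tendsto_log_mul_rpow_nhdsGT_zero (r := 1) one_pos
        simpa using this
      have h2 : Tendsto (fun y : ℝ => 2 * |Real.log y * y|) (𝓝[>] 0) (𝓝 0) := by
        simpa using (h1.abs).const_mul 2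
      apply squeeze_zero_norm' _ h2
      filter_upwards [Ioo_mem_nhdsGT (show (0:ℝ) < 1 / 2 by norm_num)] with y hy
      have hy1 : 0 < 1 - y := by linarith [hy.2]
      rw [Real.norm_eq_abs, abs_mul, abs_mul, abs_of_pos hy.1]
      have h3 : |Real.log (1 - y)| ≤ 2 * y := by
        rw [abs_le]
        constructor
        · have := Real.one_sub_inv_le_log_of_pos hy1
          have h4 : (1 - y)⁻¹ ≤ 1 + 2 * y := by
            rw [inv_le_comm₀ hy1 (by linarith [hy.1]), inv_le_iff_one_le_mul₀ (by linarith [hy.1])]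
            nlinarith [hy.1, hy.2]
          linarith
        · have := Real.log_le_sub_one_of_pos hy1
          linarith [hy.1]
      nlinarith [abs_nonneg (Real.log y)]
    have := (l1.add l2).add l3
    simpa using this
  have hconst : ∀ y ∈ Set.Ioo (0:ℝ) x, R y = R x := by
    rintro y ⟨h0, h1⟩
    refine (eq_of_hasDerivAt_zero h1 ?_ ?_).symm
    · intro z hz
      exact (hd z ⟨by linarith [hz.1], by linarith [hz.2]⟩).continuousAt.continuousWithinAt
    · intro z hz
      exact hd z ⟨by linarith [hz.1], by linarith [hz.2]⟩
  have h2 : Tendsto R (𝓝[>] 0) (𝓝 (R x)) := by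
    apply tendsto_const_nhds.congr'
    filter_upwards [Ioo_mem_nhdsGT hx0] with y hy
    exact (hconst y hy).symm
  have := tendsto_nhds_unique h2 hlim
  simp only [hR] at this
  linarith

lemma li_landen {x : ℝ} (hx0 : 0 < x) (hx1 : x < 1) :
    li (-x) + li (x / (1 + x)) = -(Real.log (1 + x)) ^ 2 / 2 := by
  set S : ℝ → ℝ := fun y => li (-y) + li (y / (1 + y)) + (Real.log (1 + y)) ^ 2 / 2 with hS
  have h : S x = S 0 := by
    apply eq_of_hasDerivAt_zero hx0
    · refine ContinuousOn.add (ContinuousOn.add ?_ ?_) ?_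
      · refine li_continuousOn.comp (by fun_prop) ?_
        intro y hy; exact ⟨by linarith [hy.2], by linarith [hy.1]⟩
      · refine li_continuousOn.comp ?_ ?_
        · refine ContinuousOn.div (by fun_prop) (by fun_prop) ?_
          intro y hy; linarith [hy.1]
        · intro y hy
          have : 0 < 1 + y := by linarith [hy.1]
          constructor
          · have : 0 ≤ y / (1 + y) := div_nonneg hy.1 this.le
            linarith
          · rw [div_le_one this]; linarith
      · refine ContinuousOn.div_const (ContinuousOn.pow (ContinuousOn.log (by fun_prop) ?_) 2) 2
        intro y hy; linarith [hy.1]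
    · rintro y ⟨h0, h1⟩
      have hy : 0 < 1 + y := by linarith
      have e1 := (li_hasDerivAt (x := -y) (by rw [abs_neg, abs_of_pos h0]; linarith)
        (by linarith)).comp y (hasDerivAt_neg y)
      have hq : y / (1 + y) < 1 := by rw [div_lt_one hy]; linarith
      have hq0 : 0 < y / (1 + y) := div_pos h0 hy
      have hs : HasDerivAt (fun z : ℝ => 1 + z) 1 y := (hasDerivAt_id y).const_add 1
      have e2 := (li_hasDerivAt (x := y / (1 + y)) (by rw [abs_of_pos hq0]; exact hq)
        hq0.ne').comp y ((hasDerivAt_id y).div hs hy.ne')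
      have e3 := ((hs.log hy.ne').pow 2).div_const 2
      have := (e1.add e2).add e3
      refine HasDerivAt.congr_deriv (f := S) this ?_
      have hl : Real.log (1 - y / (1 + y)) = - Real.log (1 + y) := by
        rw [← Real.log_inv]; congr 1; field_simp; ring
      rw [hl, sub_neg_eq_add]
      simp only [id]
      field_simp
      ring
  simp only [hS] at h
  simp [li_zero] at h
  linarith

/-- golden ratio value -/
lemma li_golden : li (1 / ((1 + Real.sqrt 5) / 2)) - li (-(1 / ((1 + Real.sqrt 5) / 2))) =
    Real.pi ^ 2 / 6 - 3 / 2 * (Real.log ((1 + Real.sqrt 5) / 2)) ^ 2 := by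
  set p := (1 + Real.sqrt 5) / 2 with hp
  have h5 : Real.sqrt 5 ^ 2 = 5 := Real.sq_sqrt (by norm_num)
  have h5' : 1 < Real.sqrt 5 := by rw [Real.lt_sqrt (by norm_num)]; norm_num
  have hp2 : p ^ 2 = p + 1 := by rw [hp]; nlinarith
  have hp1 : 1 < p := by rw [hp]; linarith
  have hp0 : 0 < p := by linarith
  have hg0 : 0 < 1 / p := by positivity
  have hg1 : 1 / p < 1 := by rw [div_lt_one hp0]; exact hp1
  have e1 := li_reflection hg0 hg1
  have e2 := li_landen hg0 hg1
  have h1 : 1 - 1 / p = (1 / p) ^ 2 := by field_simp; linarith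
  have h2 : 1 + 1 / p = p := by field_simp; linarith
  have h3 : 1 / p / (1 + 1 / p) = (1 / p) ^ 2 := by rw [h2]; field_simp
  rw [h3, h2] at e2
  rw [h1, Real.log_pow, one_div, Real.log_inv] at e1
  rw [one_div] at e2 ⊢
  push_cast at e1
  linarith


lemma le_of_hasDerivAt_nonneg {f f' : ℝ → ℝ} {a b : ℝ} (hab : a ≤ b)
    (h : ∀ x ∈ Set.Icc a b, HasDerivAt f (f' x) x) (h0 : ∀ x ∈ Set.Icc a b, 0 ≤ f' x) :
    f a ≤ f b := by
  have hm : MonotoneOn f (Set.Icc a b) := by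
    apply monotoneOn_of_deriv_nonneg (convex_Icc a b)
    · exact fun x hx => (h x hx).continuousAt.continuousWithinAt
    · exact fun x hx => (h x (interior_subset hx)).differentiableAt.differentiableWithinAt
    · intro x hx
      rw [(h x (interior_subset hx)).deriv]
      exact h0 x (interior_subset hx)
  exact hm ⟨le_refl _, hab⟩ ⟨hab, le_refl _⟩ hab

lemma em_step {G g g' : ℝ → ℝ} (hG : ∀ x, 0 ≤ x → HasDerivAt G (g x) x)
    (hg : ∀ x, 0 ≤ x → HasDerivAt g (g' x) x) (hm : MonotoneOn g' (Set.Ici 0))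
    {a t : ℝ} (ha : 0 ≤ a) (ht : 0 ≤ t) :
    |G (a + t) - G a - t * (g a + g (a + t)) / 2| ≤ (g' (a + t) - g' a) * t ^ 2 / 2 := by
  have hlow : ∀ x, a ≤ x → g a + g' a * (x - a) ≤ g x := by
    intro x hx
    have := le_of_hasDerivAt_nonneg (f := fun y => g y - g' a * (y - a)) (f' := fun y => g' y - g' a)
      hx ?_ ?_
    · simp at this; linarith
    · intro y hy
      have h1 := (hg y (ha.trans hy.1)).sub (((hasDerivAt_id y).sub_const a).const_mul (g' a))
      exact h1.congr_deriv (by simp)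
    · intro y hy
      have := hm ha (ha.trans hy.1) hy.1
      simpa using this
  have hup : ∀ x, a ≤ x → x ≤ a + t → g x ≤ g a + g' (a + t) * (x - a) := by
    intro x hx hxt
    have := le_of_hasDerivAt_nonneg (f := fun y => g' (a + t) * (y - a) - g y)
      (f' := fun y => g' (a + t) - g' y) hx ?_ ?_
    · simp at this; linarith
    · intro y hy
      have h1 := (((hasDerivAt_id y).sub_const a).const_mul (g' (a + t))).sub (hg y (ha.trans hy.1))
      exact h1.congr_deriv (by simp)
    · intro y hy
      have := hm (ha.trans hy.1 : (0:ℝ) ≤ y) (by show 0 ≤ a + t; linarith : a + t ∈ Set.Ici (0:ℝ)) (hy.2.trans hxt)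
      simpa using this
  have dq : ∀ c y, HasDerivAt (fun y => c * (y - a) ^ 2 / 2) (c * (y - a)) y := by
    intro c y
    have := ((((hasDerivAt_id y).sub_const a).pow 2).const_mul c).div_const 2
    refine HasDerivAt.congr_deriv (f := fun y => c * (y - a) ^ 2 / 2) this ?_
    simp; ring
  have hG1 : g a * t + g' a * t ^ 2 / 2 ≤ G (a + t) - G a := by
    have := le_of_hasDerivAt_nonneg (f := fun y => G y - g a * (y - a) - g' a * (y - a) ^ 2 / 2)
      (f' := fun y => g y - g a - g' a * (y - a)) (by linarith : a ≤ a + t) ?_ ?_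
    · simp at this; linarith
    · intro y hy
      have h1 := ((hG y (ha.trans hy.1)).sub (((hasDerivAt_id y).sub_const a).const_mul (g a))).sub
        (dq (g' a) y)
      exact h1.congr_deriv (by simp)
    · intro y hy
      have := hlow y hy.1
      show 0 ≤ g y - g a - g' a * (y - a)
      linarith
  have hG2 : G (a + t) - G a ≤ g a * t + g' (a + t) * t ^ 2 / 2 := by
    have := le_of_hasDerivAt_nonneg
      (f := fun y => g a * (y - a) + g' (a + t) * (y - a) ^ 2 / 2 - G y)
      (f' := fun y => g a + g' (a + t) * (y - a) - g y) (by linarith : a ≤ a + t) ?_ ?_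
    · simp at this; linarith
    · intro y hy
      have h1 := ((((hasDerivAt_id y).sub_const a).const_mul (g a)).add
        (dq (g' (a + t)) y)).sub (hG y (ha.trans hy.1))
      exact h1.congr_deriv (by simp)
    · intro y hy
      have := hup y hy.1 hy.2
      show 0 ≤ g a + g' (a + t) * (y - a) - g y
      linarith
  have h3 := hlow (a + t) (by linarith)
  have h4 := hup (a + t) (by linarith) le_rfl
  rw [abs_le]
  constructor <;> nlinarith

lemma em_sum {G g g' : ℝ → ℝ} (hG : ∀ x, 0 ≤ x → HasDerivAt G (g x) x)
    (hg : ∀ x, 0 ≤ x → HasDerivAt g (g' x) x) (hm : MonotoneOn g' (Set.Ici 0))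
    {t : ℝ} (ht : 0 ≤ t) (N : ℕ) :
    |G (N * t) - G 0 - t * (g 0 / 2 + ∑ j ∈ Finset.range N, g ((j + 1 : ℝ) * t) - g (N * t) / 2)|
      ≤ (g' (N * t) - g' 0) * t ^ 2 / 2 := by
  induction N with
  | zero => simp
  | succ N ih =>
    have h := em_step hG hg hm (a := N * t) (by positivity) ht
    rw [Finset.sum_range_succ]
    have e : ((N + 1 : ℕ) : ℝ) * t = N * t + t := by push_cast; ring
    have e' : ((N : ℝ) + 1) * t = N * t + t := by ring
    rw [e, e']
    rw [abs_le] at *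
    constructor <;> linarith [h.1, h.2, ih.1, ih.2]

lemma em_tsum {G g g' : ℝ → ℝ} (hG : ∀ x, 0 ≤ x → HasDerivAt G (g x) x)
    (hg : ∀ x, 0 ≤ x → HasDerivAt g (g' x) x) (hm : MonotoneOn g' (Set.Ici 0))
    (hneg : ∀ x, 0 ≤ x → g' x ≤ 0) {L : ℝ} (hL : Tendsto G atTop (𝓝 L))
    {t : ℝ} (ht : 0 < t) (hs : Summable (fun j : ℕ => g ((j + 1 : ℝ) * t))) :
    |∑' j : ℕ, g ((j + 1 : ℝ) * t) + g 0 / 2 - (L - G 0) / t| ≤ -g' 0 * t / 2 := by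
  have hNt : Tendsto (fun N : ℕ => (N : ℝ) * t) atTop atTop :=
    tendsto_natCast_atTop_atTop.atTop_mul_const ht
  have h1 : Tendsto (fun N : ℕ => G (N * t)) atTop (𝓝 L) := hL.comp hNt
  have h2 : Tendsto (fun N : ℕ => g (N * t)) atTop (𝓝 0) := by
    have := hs.tendsto_atTop_zero
    rw [← tendsto_add_atTop_iff_nat 1]
    simpa using this
  have h3 := hs.hasSum.tendsto_sum_nat
  have h4 := (((h1.sub_const (G 0)).sub (((h3.const_add (g 0 / 2)).sub (h2.div_const 2)).const_mul t))).abs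
  have h5 : |L - G 0 - t * (g 0 / 2 + ∑' j : ℕ, g ((j + 1 : ℝ) * t) - 0 / 2)| ≤ -g' 0 * t ^ 2 / 2 := by
    refine le_of_tendsto h4 (Eventually.of_forall fun N => ?_)
    refine (em_sum hG hg hm ht.le N).trans ?_
    have := hneg (N * t) (by positivity)
    have : g' (N * t) * t ^ 2 ≤ 0 := mul_nonpos_of_nonpos_of_nonneg this (by positivity)
    linarith
  have e : ∑' j : ℕ, g ((j + 1 : ℝ) * t) + g 0 / 2 - (L - G 0) / t =
      -(L - G 0 - t * (g 0 / 2 + ∑' j : ℕ, g ((j + 1 : ℝ) * t) - 0 / 2)) / t := by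
    field_simp; ring
  rw [e, abs_div, abs_neg, abs_of_pos ht, div_le_iff₀ ht]
  linarith


noncomputable def gp : ℝ := (1 + Real.sqrt 5) / 2
lemma gp_sq : gp ^ 2 = gp + 1 := by
  have := Real.sq_sqrt (show (0:ℝ) ≤ 5 by norm_num)
  unfold gp; nlinarith
lemma gp_gt : 1 < gp := by
  have : (1:ℝ) < Real.sqrt 5 := by
    rw [Real.lt_sqrt (by norm_num)]; norm_num
  unfold gp; linarith
lemma gp_pos : 0 < gp := by linarith [gp_gt]
noncomputable def gl : ℝ := Real.log gp
lemma gl_pos : 0 < gl := Real.log_pos gp_gt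
lemma exp_gl : Real.exp gl = gp := Real.exp_log gp_pos

noncomputable def uu (x : ℝ) : ℝ := Real.log (1 + gp * Real.exp (-x))
noncomputable def vv (x : ℝ) : ℝ := -Real.log (1 - (1 / gp) * Real.exp (-x))

lemma uu_arg (x : ℝ) : 0 < 1 + gp * Real.exp (-x) := by have := gp_pos; positivity
lemma uu_cont : Continuous uu := by
  unfold uu
  exact Continuous.log (by fun_prop) (fun x => (uu_arg x).ne')

lemma li_comp_deriv {f : ℝ → ℝ} {f' x : ℝ} (hf : HasDerivAt f f' x) (h1 : |f x| < 1) (h0 : f x ≠ 0) :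
    HasDerivAt (fun y => li (f y)) (-Real.log (1 - f x) / f x * f') x :=
  HasDerivAt.comp x (li_hasDerivAt h1 h0) hf

lemma uu_int1 : ∫ y in (0:ℝ)..gl, uu y = Real.pi ^ 2 / 12 + gl ^ 2 / 2 + li (-(1 / gp)) := by
  have key := intervalIntegral.integral_eq_sub_of_hasDerivAt_of_le (a := 0) (b := gl)
    (f := fun x => -(gl - x) ^ 2 / 2 - li (-Real.exp (x - gl))) (f' := uu) gl_pos.le ?_ ?_
    (uu_cont.intervalIntegrable _ _)
  · rw [key]
    have : Real.exp (0 - gl) = 1 / gp := by rw [zero_sub, Real.exp_neg, exp_gl, one_div]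
    simp only [this, sub_self, Real.exp_zero, li_neg_one]
    ring
  · refine ContinuousOn.sub (by fun_prop) ?_
    refine li_continuousOn.comp (by fun_prop) ?_
    intro x hx
    have h1 : Real.exp (x - gl) ≤ 1 := Real.exp_le_one_iff.2 (by linarith [hx.2])
    have h2 := Real.exp_pos (x - gl)
    constructor <;> linarith
  · intro x hx
    have h1 : Real.exp (x - gl) < 1 := Real.exp_lt_one_iff.2 (by linarith [hx.2])
    have h2 := Real.exp_pos (x - gl)
    have hf : HasDerivAt (fun y => -Real.exp (y - gl)) (-Real.exp (x - gl)) x := by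
      have := (((hasDerivAt_id x).sub_const gl).exp).neg
      exact this.congr_deriv (by simp)
    have h3 := li_comp_deriv hf (by rw [abs_neg, abs_of_pos h2]; exact h1) (by linarith)
    have h4 : HasDerivAt (fun y => -(gl - y) ^ 2 / 2) (gl - x) x := by
      have := ((((hasDerivAt_id x).const_sub gl).pow 2).neg).div_const 2
      exact this.congr_deriv (by simp)
    refine (h4.sub h3).congr_deriv ?_
    unfold uu
    have e : 1 + gp * Real.exp (-x) = Real.exp (gl - x) * (1 - -Real.exp (x - gl)) := by
      rw [sub_neg_eq_add, mul_add, ← Real.exp_add, mul_one, sub_eq_add_neg gl x, Real.exp_add, exp_gl]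
      rw [show gl + -x + (x - gl) = 0 by ring, Real.exp_zero]; ring
    rw [e, Real.log_mul (Real.exp_pos _).ne' (by linarith), Real.log_exp]
    field_simp; ring

lemma uu_int2 {x : ℝ} (hx : gl ≤ x) :
    ∫ y in gl..x, uu y = li (-Real.exp (gl - x)) + Real.pi ^ 2 / 12 := by
  have key := intervalIntegral.integral_eq_sub_of_hasDerivAt_of_le (a := gl) (b := x)
    (f := fun x => li (-Real.exp (gl - x))) (f' := uu) hx ?_ ?_
    (uu_cont.intervalIntegrable _ _)
  · rw [key]
    simp only [sub_self, Real.exp_zero, li_neg_one]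
    ring
  · refine li_continuousOn.comp (by fun_prop) ?_
    intro x hx
    have h1 : Real.exp (gl - x) ≤ 1 := Real.exp_le_one_iff.2 (by linarith [hx.1])
    have h2 := Real.exp_pos (gl - x)
    constructor <;> linarith
  · intro x hx
    have h1 : Real.exp (gl - x) < 1 := Real.exp_lt_one_iff.2 (by linarith [hx.1])
    have h2 := Real.exp_pos (gl - x)
    have hf : HasDerivAt (fun y => -Real.exp (gl - y)) (Real.exp (gl - x)) x := by
      have := (((hasDerivAt_id x).const_sub gl).exp).neg
      exact this.congr_deriv (by simp)
    have h3 := li_comp_deriv hf (by rw [abs_neg, abs_of_pos h2]; exact h1) (by linarith)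
    refine h3.congr_deriv ?_
    unfold uu
    have e : 1 + gp * Real.exp (-x) = (1 - -Real.exp (gl - x)) := by
      rw [sub_neg_eq_add, sub_eq_add_neg gl x, Real.exp_add, exp_gl]
    rw [e]
    field_simp

lemma li_tendsto_zero {f : ℝ → ℝ} (hf : Tendsto f atTop (𝓝 0)) :
    Tendsto (fun x => li (f x)) atTop (𝓝 0) := by
  have : ContinuousAt li 0 := li_continuousOn.continuousAt (Icc_mem_nhds (by norm_num) (by norm_num))
  have h := this.tendsto.comp hf
  rwa [li_zero] at h

lemma uu_lim : Tendsto (fun x => ∫ y in (0:ℝ)..x, uu y) atTop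
    (𝓝 (Real.pi ^ 2 / 6 + gl ^ 2 / 2 + li (-(1 / gp)))) := by
  have h1 : Tendsto (fun x => li (-Real.exp (gl - x)) + (Real.pi ^ 2 / 12 +
      (Real.pi ^ 2 / 12 + gl ^ 2 / 2 + li (-(1 / gp))))) atTop
    (𝓝 (0 + (Real.pi ^ 2 / 12 +
      (Real.pi ^ 2 / 12 + gl ^ 2 / 2 + li (-(1 / gp)))))) := by
    refine (li_tendsto_zero ?_).add_const _
    have : Tendsto (fun x => gl - x) atTop atBot := tendsto_atBot_add_const_left _ gl tendsto_neg_atTop_atBot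
    have := (Real.tendsto_exp_atBot.comp this).neg
    simpa using this
  have e : (0 + (Real.pi ^ 2 / 12 +
      (Real.pi ^ 2 / 12 + gl ^ 2 / 2 + li (-(1 / gp))))) = Real.pi ^ 2 / 6 + gl ^ 2 / 2 + li (-(1 / gp)) := by ring
  rw [e] at h1
  refine h1.congr' ?_
  filter_upwards [eventually_ge_atTop gl] with x hx
  rw [← intervalIntegral.integral_add_adjacent_intervals (uu_cont.intervalIntegrable 0 gl)
    (uu_cont.intervalIntegrable gl x), uu_int1, uu_int2 hx]
  ring

lemma summable_log_c (c : ℝ) {t : ℝ} (ht : 0 < t) :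
    Summable (fun j : ℕ => Real.log (1 + c * Real.exp (-((j + 1 : ℝ) * t)))) := by
  have h : Summable (fun j : ℕ => c * Real.exp (-((j + 1 : ℝ) * t))) :=
    (summable_exp_mul ht).mul_left c
  exact Real.summable_log_one_add_of_summable h

lemma gp_inv : 1 / gp = gp - 1 := by
  have := gp_sq; have := gp_pos
  field_simp; linarith

lemma part_uv : ∃ C : ℝ, ∀ t : ℝ, 0 < t →
    |∑' j : ℕ, uu ((j + 1 : ℝ) * t) - ∑' j : ℕ, vv ((j + 1 : ℝ) * t) - 2 * gl ^ 2 / t| ≤ C * t := by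
  have hp := gp_pos
  have hp1 := gp_gt
  have hi1 : 1 / gp < 1 := by rw [div_lt_one hp]; exact hp1
  have hi0 : 0 < 1 / gp := by positivity
  set du : ℝ → ℝ := fun x => -gp / (Real.exp x + gp) with hdu
  set dv : ℝ → ℝ := fun x => -(1 / gp) / (Real.exp x - 1 / gp) with hdv
  refine ⟨(-du 0 + -dv 0) / 2, fun t ht => ?_⟩
  have gold := li_golden
  change li (1 / gp) - li (-(1 / gp)) = Real.pi ^ 2 / 6 - 3 / 2 * gl ^ 2 at gold
  have U := em_tsum (G := fun x => ∫ y in (0:ℝ)..x, uu y) (g := uu) (g' := du)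
    (fun x _ => intervalIntegral.integral_hasDerivAt_right (uu_cont.intervalIntegrable _ _)
      uu_cont.stronglyMeasurable.stronglyMeasurableAtFilter uu_cont.continuousAt) ?_ ?_ ?_ uu_lim ht
      (summable_log_c gp ht)
  · have V := em_tsum (G := fun x => -li (1 / gp * Real.exp (-x))) (g := vv) (g' := dv) (L := 0)
      ?_ ?_ ?_ ?_ ?_ ht ?_
    · have e0 : uu 0 = vv 0 := by
        simp only [uu, vv, neg_zero, Real.exp_zero, mul_one]
        rw [← Real.log_inv, gp_inv]
        congr 1
        apply eq_inv_of_mul_eq_one_left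
        · nlinarith [gp_sq]
      simp only [neg_zero, Real.exp_zero, mul_one, intervalIntegral.integral_same, sub_neg_eq_add, zero_add, sub_zero] at U V
      have e : 2 * gl ^ 2 / t = (Real.pi ^ 2 / 6 + gl ^ 2 / 2 + li (-(1 / gp))) / t - li (1 / gp) / t := by
        rw [← sub_div]; congr 1; linarith
      rw [e]
      rw [abs_le] at *
      constructor <;> linarith [U.1, U.2, V.1, V.2]
    · intro x hx
      have h1 : Real.exp (-x) ≤ 1 := Real.exp_le_one_iff.2 (by linarith)
      have h2 := Real.exp_pos (-x)
      have hf : HasDerivAt (fun y => 1 / gp * Real.exp (-y)) (1 / gp * (-Real.exp (-x))) x := by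
        have := ((hasDerivAt_id x).neg.exp).const_mul (1 / gp)
        exact this.congr_deriv (by simp)
      have h4 : 0 < 1 / gp * Real.exp (-x) := by positivity
      have h3 := (li_comp_deriv hf (by rw [abs_of_pos h4]; nlinarith) h4.ne').neg
      refine h3.congr_deriv ?_
      unfold vv; field_simp
    · intro x hx
      have h1 : Real.exp (-x) ≤ 1 := Real.exp_le_one_iff.2 (by linarith)
      have h2 := Real.exp_pos (-x)
      have hf : HasDerivAt (fun y => 1 - 1 / gp * Real.exp (-y)) (1 / gp * (Real.exp (-x))) x := by
        have := (((hasDerivAt_id x).neg.exp).const_mul (1 / gp)).const_sub 1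
        exact this.congr_deriv (by simp)
      have h4 : 0 < 1 - 1 / gp * Real.exp (-x) := by nlinarith
      refine (hf.log h4.ne').neg.congr_deriv ?_
      have h5 : 0 < Real.exp x - 1 / gp := by linarith [Real.one_le_exp hx]
      have h6 : Real.exp (-x) * Real.exp x = 1 := by rw [← Real.exp_add]; simp
      simp only [hdv]
      rw [neg_div]
      congr 1
      rw [div_eq_div_iff h4.ne' h5.ne']
      linear_combination (1/gp) * h6
    · intro x hx y hy hxy
      have h1 := Real.one_le_exp (show 0 ≤ x from hx)
      have h2 := Real.exp_le_exp.2 hxy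
      simp only [hdv, neg_div]
      apply neg_le_neg
      apply div_le_div_of_nonneg_left hi0.le (by linarith) (by linarith)
    · intro x hx
      have h1 := Real.one_le_exp hx
      simp only [hdv, neg_div]
      have : 0 ≤ 1 / gp / (Real.exp x - 1 / gp) := div_nonneg hi0.le (by linarith)
      linarith
    · have : Tendsto (fun x => 1 / gp * Real.exp (-x)) atTop (𝓝 0) := by
        have := (Real.tendsto_exp_atBot.comp tendsto_neg_atTop_atBot).const_mul (1 / gp)
        simpa using this
      simpa using (li_tendsto_zero this).neg
    · have := (summable_log_c (-(1 / gp)) ht).neg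
      refine this.congr fun j => ?_
      simp only [vv]; ring_nf
  · intro x hx
    have h2 := Real.exp_pos (-x)
    have hf : HasDerivAt (fun y => 1 + gp * Real.exp (-y)) (gp * (-Real.exp (-x))) x := by
      have := (((hasDerivAt_id x).neg.exp).const_mul (gp)).const_add 1
      exact this.congr_deriv (by simp)
    refine (hf.log (uu_arg x).ne').congr_deriv ?_
    have h5 : 0 < Real.exp x + gp := by positivity
    have h6 : Real.exp (-x) * Real.exp x = 1 := by rw [← Real.exp_add]; simp
    simp only [hdu]
    rw [div_eq_div_iff (uu_arg x).ne' h5.ne']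
    linear_combination (-gp) * h6
  · intro x hx y hy hxy
    have h1 := Real.exp_pos x
    have h2 := Real.exp_le_exp.2 hxy
    simp only [hdu, neg_div]
    apply neg_le_neg
    apply div_le_div_of_nonneg_left hp.le (by linarith) (by linarith)
  · intro x hx
    simp only [hdu, neg_div]
    have : 0 ≤ gp / (Real.exp x + gp) := by positivity
    linarith


noncomputable def EE (s : ℝ) : ℝ := ∑' j : ℕ, Real.log (1 - Real.exp (-((j + 1 : ℝ) * s)))

lemma one_sub_exp_pos {s : ℝ} (hs : 0 < s) (j : ℕ) : 0 < 1 - Real.exp (-((j + 1 : ℝ) * s)) := by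
  have := exp_neg_lt_one (x := (j + 1 : ℝ) * s) (by positivity)
  linarith

lemma summable_EE {s : ℝ} (hs : 0 < s) :
    Summable (fun j : ℕ => Real.log (1 - Real.exp (-((j + 1 : ℝ) * s)))) :=
  (summable_log_c (-1) hs).congr fun j => by ring_nf

lemma tprod_EE {s : ℝ} (hs : 0 < s) :
    ∏' n : ℕ, (1 - ((Real.exp (-s) : ℝ) : ℂ) ^ (n + 1)) = ((Real.exp (EE s) : ℝ) : ℂ) := by
  have h1 := (summable_EE hs).hasSum.rexp
  have h2 := h1.map (Complex.ofRealHom) Complex.continuous_ofReal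
  refine Eq.trans (tprod_congr fun n => ?_) h2.tprod_eq
  simp only [Function.comp]
  rw [Real.exp_log (one_sub_exp_pos hs n)]
  simp only [Complex.ofRealHom_eq_coe]
  push_cast
  rw [← Complex.exp_nat_mul]
  push_cast
  ring_nf

lemma norm_eta {y : ℝ} (hy : 0 < y) :
    ‖ModularForm.eta (Complex.I * y)‖ = Real.exp (-(Real.pi * y / 12) + EE (2 * Real.pi * y)) := by
  unfold ModularForm.eta
  have h1 : ∀ n : ℕ, ModularForm.eta_q n (Complex.I * y) =
      ((Real.exp (-(2 * Real.pi * y)) : ℝ) : ℂ) ^ (n + 1) := by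
    intro n
    rw [ModularForm.eta_q_eq_pow]
    congr 1
    push_cast
    congr 1
    linear_combination (2 * (Real.pi : ℂ) * y) * Complex.I_mul_I
  simp_rw [h1]
  rw [tprod_EE (by positivity), norm_mul, Function.Periodic.qParam, Complex.norm_exp,
    Complex.norm_real, Real.norm_of_nonneg (Real.exp_pos _).le, ← Real.exp_add]
  congr 2
  have : 2 * (Real.pi : ℂ) * Complex.I * (Complex.I * y) / (24 : ℝ) = ((-(Real.pi * y / 12) : ℝ) : ℂ) := by
    push_cast
    linear_combination (2 * (Real.pi : ℂ) * y / 24) * Complex.I_mul_I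
  rw [this, Complex.ofReal_re]

lemma norm_csqrt (z : ℂ) : ‖Complex.sqrt z‖ ^ 2 = ‖z‖ := by
  rcases eq_or_ne z 0 with rfl | hz
  · simp
  · rw [← norm_pow, sqrt_eq_exp hz, ← Complex.exp_nat_mul]
    have : ((2 : ℕ) : ℂ) * (Complex.log z / 2) = Complex.log z := by push_cast; ring
    rw [this, Complex.exp_log hz]

lemma eta_trans {y : ℝ} (hy : 0 < y) :
    -(Real.pi / y / 12) + EE (2 * Real.pi / y) =
      Real.log y / 2 + -(Real.pi * y / 12) + EE (2 * Real.pi * y) := by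
  have h := ModularForm.eta_comp_eq_csqrt_I_inv (x := Complex.I * y)
    (by simp [UpperHalfPlane.upperHalfPlaneSet, hy])
  simp only [Function.comp, Pi.smul_apply, Pi.mul_apply, smul_eq_mul] at h
  have e : -1 / (Complex.I * y) = Complex.I * ((1 / y : ℝ) : ℂ) := by
    have : (y : ℂ) ≠ 0 := by exact_mod_cast hy.ne'
    push_cast
    field_simp
    rw [Complex.I_sq]
  rw [e] at h
  have h2 := congrArg (fun w => ‖w‖ ^ 2) h
  simp only [norm_mul, norm_inv, mul_pow, inv_pow, norm_csqrt, norm_eta hy, norm_eta (one_div_pos.2 hy)] at h2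
  simp only [Complex.norm_I, Complex.norm_real, Real.norm_of_nonneg hy.le, ← Real.exp_nat_mul] at h2
  have h3 := congrArg Real.log h2
  rw [Real.log_exp, inv_one, one_mul, one_mul, Real.log_mul hy.ne' (Real.exp_pos _).ne', Real.log_exp] at h3
  push_cast at h3
  have e1 : 2 * Real.pi * (1 / y) = 2 * Real.pi / y := by ring
  rw [e1] at h3
  have e2 : Real.pi * (1 / y) = Real.pi / y := by ring
  rw [e2] at h3
  linarith

lemma EE_trans {s : ℝ} (hs : 0 < s) :
    EE s = s / 24 - Real.log (s / (2 * Real.pi)) / 2 - Real.pi ^ 2 / (6 * s) + EE (4 * Real.pi ^ 2 / s) := by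
  have hpi := Real.pi_pos
  have h := eta_trans (y := 2 * Real.pi / s) (by positivity)
  have e1 : 2 * Real.pi / (2 * Real.pi / s) = s := by field_simp
  have e2 : 2 * Real.pi * (2 * Real.pi / s) = 4 * Real.pi ^ 2 / s := by ring
  have e3 : Real.pi / (2 * Real.pi / s) = s / 2 := by field_simp
  have e4 : Real.log (2 * Real.pi / s) = - Real.log (s / (2 * Real.pi)) := by
    rw [← Real.log_inv, inv_div]
  rw [e1, e2, e3, e4] at h
  have e5 : Real.pi * (2 * Real.pi / s) / 12 = Real.pi ^ 2 / (6 * s) := by field_simp; norm_num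
  rw [e5] at h
  linarith

lemma EE_tendsto : Tendsto EE atTop (𝓝 0) := by
  have h0 : (0:ℝ) = ∑' j : ℕ, (0:ℝ) := by simp
  rw [h0]
  unfold EE
  refine tendsto_tsum_of_dominated_convergence (bound := fun j : ℕ => 2 * Real.exp (-((j + 1 : ℝ) * 1)))
    ((summable_exp_mul one_pos).mul_left 2) ?_ ?_
  · intro j
    have h1 : Tendsto (fun s : ℝ => (j + 1 : ℝ) * s) atTop atTop :=
      tendsto_id.const_mul_atTop (by positivity)
    have h2 := (Real.tendsto_exp_atBot.comp (tendsto_neg_atTop_atBot.comp h1)).const_sub 1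
    have h3 := h2.log (by norm_num)
    simpa using h3
  · filter_upwards [eventually_ge_atTop 1] with s hs j
    have hp := one_sub_exp_pos (show 0 < s by linarith) j
    have hj : (1:ℝ) ≤ j + 1 := by linarith [(Nat.cast_nonneg j : (0:ℝ) ≤ j)]
    have he : Real.exp (-((j + 1 : ℝ) * s)) ≤ Real.exp (-((j + 1 : ℝ) * 1)) :=
      Real.exp_le_exp.2 (by nlinarith)
    have he2 : Real.exp (-((j + 1 : ℝ) * 1)) ≤ Real.exp (-1) := Real.exp_le_exp.2 (by linarith)
    have he3 : Real.exp (-1) < 1 / 2 := by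
      have := Real.exp_one_gt_d9
      rw [Real.exp_neg, ← one_div]
      apply one_div_lt_one_div_of_lt <;> linarith
    set y := Real.exp (-((j + 1 : ℝ) * s)) with hy
    have hy0 : 0 < y := Real.exp_pos _
    rw [Real.norm_eq_abs, abs_of_nonpos (Real.log_nonpos hp.le (by linarith))]
    have h1 := Real.one_sub_inv_le_log_of_pos hp
    have h2 : (1 - y)⁻¹ ≤ 1 + 2 * y := by
      rw [inv_le_iff_one_le_mul₀ hp]; nlinarith
    linarith

lemma ff_eq {x : ℝ} (hx : 0 < x) : ff x = uu x - vv x - Real.log (1 - Real.exp (-(2 * x))) := by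
  unfold ff uu vv
  have hp := gp_pos
  have hy0 := Real.exp_pos (-x)
  have hy1 := exp_neg_lt_one hx
  have e2 : Real.exp (-(2 * x)) = Real.exp (-x) ^ 2 := by
    rw [← Real.exp_nat_mul]; congr 1; push_cast; ring
  rw [e2, gp_inv]
  set y := Real.exp (-x)
  have h1 : 0 < 1 - y ^ 2 := by nlinarith
  have h2 : 0 < 1 - (gp - 1) * y := by
    have h3 : gp < 2 := by nlinarith [gp_sq, gp_gt]
    nlinarith
  have h3 : 0 < 1 + gp * y := by positivity
  rw [sub_neg_eq_add, ← Real.log_mul h3.ne' h2.ne', ← Real.log_div (by positivity) h1.ne']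
  congr 1
  rw [eq_div_iff h1.ne', add_mul, div_mul_cancel₀ _ h1.ne']
  linear_combination (y ^ 2) * gp_sq

lemma LP_eq {t : ℝ} (ht : 0 < t) : LP t =
    ∑' j : ℕ, uu ((j + 1 : ℝ) * t) - ∑' j : ℕ, vv ((j + 1 : ℝ) * t) - EE (2 * t) := by
  have hu : Summable (fun j : ℕ => uu ((j + 1 : ℝ) * t)) := summable_log_c gp ht
  have hv : Summable (fun j : ℕ => vv ((j + 1 : ℝ) * t)) := by
    have := (summable_log_c (-(1 / gp)) ht).neg
    refine this.congr fun j => ?_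
    simp only [vv]; ring_nf
  have hE := summable_EE (s := 2 * t) (by positivity)
  unfold LP EE
  rw [← hu.tsum_sub hv, ← (hu.sub hv).tsum_sub hE]
  refine tsum_congr fun j => ?_
  rw [ff_eq (by positivity)]
  ring_nf

noncomputable def AA : ℝ := Real.pi ^ 2 / 12 + 2 * Real.log ((1 + Real.sqrt 5) / 2) ^ 2

lemma AA_eq : AA = Real.pi ^ 2 / 12 + 2 * gl ^ 2 := rfl
lemma AA_pos : 0 < AA := by
  have := Real.pi_pos
  unfold AA; positivity

theorem LP_asymp : Tendsto (fun t => LP t - AA / t - Real.log (t / Real.pi) / 2) (𝓝[>] 0) (𝓝 0) := by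
  obtain ⟨C, hC⟩ := part_uv
  have hpi := Real.pi_pos
  have h1 : Tendsto (fun t : ℝ => ∑' j : ℕ, uu ((j + 1 : ℝ) * t) - ∑' j : ℕ, vv ((j + 1 : ℝ) * t) - 2 * gl ^ 2 / t)
      (𝓝[>] 0) (𝓝 0) := by
    refine squeeze_zero_norm' (a := fun t => C * t) ?_ ?_
    · filter_upwards [self_mem_nhdsWithin] with t ht
      exact hC t ht
    · have : Tendsto (fun t : ℝ => C * t) (𝓝 0) (𝓝 (C * 0)) := (continuous_const.mul continuous_id).tendsto 0
      rw [mul_zero] at this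
      exact this.mono_left nhdsWithin_le_nhds
  have h2 : Tendsto (fun t : ℝ => EE (2 * Real.pi ^ 2 * t⁻¹)) (𝓝[>] 0) (𝓝 0) :=
    EE_tendsto.comp (tendsto_inv_nhdsGT_zero.const_mul_atTop (by positivity))
  have h3 : Tendsto (fun t : ℝ => t / 12) (𝓝[>] 0) (𝓝 0) := by
    have : Tendsto (fun t : ℝ => t / 12) (𝓝 0) (𝓝 (0 / 12)) := (continuous_id.div_const 12).tendsto 0
    rw [zero_div] at this
    exact this.mono_left nhdsWithin_le_nhds
  have h4 := (h1.sub h3).sub h2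
  simp only [sub_zero] at h4
  refine h4.congr' ?_
  filter_upwards [self_mem_nhdsWithin] with t ht
  have ht : 0 < t := ht
  rw [LP_eq ht, EE_trans (s := 2 * t) (by positivity), AA_eq]
  have e1 : 2 * t / (2 * Real.pi) = t / Real.pi := by field_simp
  have e2 : 4 * Real.pi ^ 2 / (2 * t) = 2 * Real.pi ^ 2 * t⁻¹ := by field_simp; ring
  rw [e1, e2, add_div]
  have e3 : Real.pi ^ 2 / 12 / t = Real.pi ^ 2 / (6 * (2 * t)) := by field_simp; ring
  rw [e3]
  ring


noncomputable def xx (t θ : ℝ) : ℂ := Complex.exp (-t + θ * Complex.I)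

lemma norm_xx (t θ : ℝ) : ‖xx t θ‖ = Real.exp (-t) := by
  simp [xx, Complex.norm_exp]

/-- exponent weight -/
noncomputable def ww (j : ℕ) (t θ : ℝ) : ℝ :=
  Real.exp (-((j + 1 : ℝ) * t)) * (1 - Real.exp (-((j + 1 : ℝ) * t))) * (1 - Real.cos ((j + 1 : ℝ) * |θ|)) / 2

lemma ww_nonneg (j : ℕ) {t : ℝ} (ht : 0 < t) (θ : ℝ) : 0 ≤ ww j t θ := by
  have := one_sub_exp_pos ht j
  have := Real.cos_le_one ((j + 1 : ℝ) * |θ|)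
  have := Real.exp_pos (-((j + 1 : ℝ) * t))
  unfold ww
  have h : 0 ≤ 1 - Real.cos ((j + 1 : ℝ) * |θ|) := by linarith
  positivity

lemma Fac_bound {t : ℝ} (ht : 0 < t) (θ : ℝ) (j : ℕ) :
    ‖Fac j (xx t θ)‖ ≤ Real.exp (ff ((j + 1 : ℝ) * t)) * Real.exp (-ww j t θ) := by
  have hjt : 0 < (j + 1 : ℝ) * t := by positivity
  rw [exp_ff hjt]
  unfold Fac ww
  have hcos : Real.cos ((j + 1 : ℝ) * |θ|) = Real.cos ((j + 1 : ℝ) * θ) := by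
    rw [← Real.cos_abs ((j + 1 : ℝ) * θ), abs_mul, abs_of_pos (by positivity : (0:ℝ) < j + 1)]
  rw [hcos]
  have hy : xx t θ ^ (j + 1) = (Real.exp (-((j + 1 : ℝ) * t)) : ℂ) * Complex.exp (((j + 1 : ℝ) * θ : ℝ) * Complex.I) := by
    rw [xx, ← Complex.exp_nat_mul]
    push_cast
    rw [← Complex.exp_add]
    congr 1; push_cast; ring
  have hr0 := Real.exp_pos (-((j + 1 : ℝ) * t))
  have hr1 := exp_neg_lt_one hjt
  set r := Real.exp (-((j + 1 : ℝ) * t)) with hr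
  set ψ := (j + 1 : ℝ) * θ
  set y := xx t θ ^ (j + 1) with hyy
  have hny : ‖y‖ = r := by
    rw [hy, norm_mul, Complex.norm_exp_ofReal_mul_I, Complex.norm_real, Real.norm_of_nonneg hr0.le, mul_one]
  have hr2 : 0 < 1 - r ^ 2 := by nlinarith
  have hy2 : 1 - r ^ 2 ≤ ‖1 - y ^ 2‖ := by
    have := norm_sub_norm_le (1:ℂ) (y ^ 2)
    rw [norm_pow, hny, norm_one] at this
    exact this
  have hne : (1 - y ^ 2) ≠ 0 := by
    intro h; rw [h, norm_zero] at hy2; linarith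
  have e1 : 1 + y / (1 - y ^ 2) = (1 + y) + y ^ 3 / (1 - y ^ 2) := by field_simp; ring
  have h3 : ‖y ^ 3 / (1 - y ^ 2)‖ ≤ r ^ 3 / (1 - r ^ 2) := by
    rw [norm_div, norm_pow, hny]
    exact div_le_div_of_nonneg_left (by positivity) hr2 hy2
  have hc := Real.cos_le_one ψ
  have hc' := Real.neg_one_le_cos ψ
  have h4 : ‖1 + y‖ ^ 2 = (1 + r) ^ 2 - 2 * r * (1 - Real.cos ψ) := by
    rw [← Complex.normSq_eq_norm_sq, hy, Complex.exp_mul_I, Complex.normSq_apply]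
    simp [← Complex.ofReal_cos, ← Complex.ofReal_sin, -Complex.ofReal_exp]
    nlinarith [Real.sin_sq_add_cos_sq ψ]
  have hd0 : 0 ≤ r * (1 - Real.cos ψ) / (1 + r) := by
    have : 0 ≤ 1 - Real.cos ψ := by linarith
    positivity
  have hd1 : r * (1 - Real.cos ψ) / (1 + r) ≤ 1 + r := by
    rw [div_le_iff₀ (by linarith)]; nlinarith
  have h5 : ‖1 + y‖ ≤ (1 + r) - r * (1 - Real.cos ψ) / (1 + r) := by
    refine le_of_sq_le_sq ?_ ?_
    · rw [h4]
      have : ((1 + r) - r * (1 - Real.cos ψ) / (1 + r)) ^ 2 =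
        (1 + r) ^ 2 - 2 * (r * (1 - Real.cos ψ)) + (r * (1 - Real.cos ψ) / (1 + r)) ^ 2 := by
        field_simp; ring
      rw [this]; nlinarith [sq_nonneg (r * (1 - Real.cos ψ) / (1 + r))]
    · linarith
  have e2 : 1 + r / (1 - r ^ 2) = (1 + r) + r ^ 3 / (1 - r ^ 2) := by field_simp; ring
  have hS : 0 < 1 + r / (1 - r ^ 2) := by positivity
  have h6 : ‖1 + y / (1 - y ^ 2)‖ ≤ (1 + r / (1 - r ^ 2)) - r * (1 - Real.cos ψ) / (1 + r) := by
    rw [e1, e2]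
    refine (norm_add_le _ _).trans ?_
    linarith
  refine h6.trans ?_
  have h7 : (1 + r / (1 - r ^ 2)) * (r * (1 - r) * (1 - Real.cos ψ) / 2) ≤ r * (1 - Real.cos ψ) / (1 + r) := by
    have e3 : r * (1 - Real.cos ψ) / (1 + r) - (1 + r / (1 - r ^ 2)) * (r * (1 - r) * (1 - Real.cos ψ) / 2)
       = r * (1 - Real.cos ψ) * (1 - r + r ^ 2) / (2 * (1 + r)) := by
      have : 1 - r ^ 2 = (1 - r) * (1 + r) := by ring
      rw [this]
      have : 1 - r ≠ 0 := by linarith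
      field_simp; ring
    have : 0 ≤ r * (1 - Real.cos ψ) * (1 - r + r ^ 2) / (2 * (1 + r)) := by
      have : 0 ≤ 1 - Real.cos ψ := by linarith
      have : 0 ≤ 1 - r + r ^ 2 := by nlinarith
      positivity
    linarith
  have h8 := Real.add_one_le_exp (-(r * (1 - r) * (1 - Real.cos ψ) / 2))
  nlinarith


noncomputable def PH (t θ : ℝ) : ℂ := ∑' n : ℕ, (PO n : ℂ) * xx t θ ^ n

lemma norm_PO_term (t θ : ℝ) (n : ℕ) : ‖(PO n : ℂ) * xx t θ ^ n‖ = (PO n : ℝ) * Real.exp (-t) ^ n := by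
  rw [norm_mul, norm_pow, norm_xx, Complex.norm_natCast]

lemma summable_PH {t : ℝ} (ht : 0 < t) (θ : ℝ) : Summable (fun n : ℕ => (PO n : ℂ) * xx t θ ^ n) := by
  apply Summable.of_norm
  refine (hasSum_PO ht).summable.congr fun n => ?_
  rw [norm_PO_term]

lemma PH_bound {t : ℝ} (ht : 0 < t) (θ : ℝ) (K : ℕ) :
    ‖PH t θ‖ ≤ Real.exp (LP t) * Real.exp (-∑ j ∈ Finset.Ico K (2 * K), ww j t θ) := by
  have hx : ‖xx t θ‖ < 1 := by rw [norm_xx]; exact exp_neg_lt_one ht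
  have h1 : Tendsto (fun M => ∑' n : ℕ, (po M n : ℂ) * xx t θ ^ n) atTop (𝓝 (PH t θ)) := by
    refine tendsto_tsum_of_dominated_convergence (bound := fun n => (PO n : ℝ) * Real.exp (-t) ^ n)
      (hasSum_PO ht).summable ?_ ?_
    · intro n
      refine tendsto_const_nhds.congr' ?_
      filter_upwards [eventually_ge_atTop n] with M hM
      rw [po_stab n M hM]; rfl
    · refine Eventually.of_forall fun M n => ?_
      rw [norm_mul, norm_pow, norm_xx, Complex.norm_natCast]
      have : (po M n : ℝ) ≤ PO n := by exact_mod_cast po_le_PO M n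
      gcongr
  refine le_of_tendsto h1.norm ?_
  filter_upwards [eventually_ge_atTop (2 * K)] with M hM
  rw [(hasSum_po hx M).tsum_eq, norm_prod]
  calc ∏ j ∈ Finset.range M, ‖Fac j (xx t θ)‖
      ≤ ∏ j ∈ Finset.range M, Real.exp (ff ((j + 1 : ℝ) * t)) * Real.exp (-ww j t θ) :=
        Finset.prod_le_prod (fun _ _ => norm_nonneg _) (fun j _ => Fac_bound ht θ j)
    _ = Real.exp (LPM M t) * Real.exp (-∑ j ∈ Finset.range M, ww j t θ) := by
        rw [Finset.prod_mul_distrib, ← Real.exp_sum, ← Real.exp_sum, Finset.sum_neg_distrib, LPM]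
    _ ≤ _ := by
        gcongr
        · exact LPM_le_LP ht M
        · exact fun j _ _ => ww_nonneg j ht θ
        · intro j hj
          simp only [Finset.mem_Ico, Finset.mem_range] at *
          omega

lemma one_sub_cos_ge {x : ℝ} (h0 : 0 ≤ x) (h1 : x ≤ Real.pi) : 2 * x ^ 2 / Real.pi ^ 2 ≤ 1 - Real.cos x := by
  have hpi := Real.pi_pos
  have h := Real.mul_le_sin (x := x / 2) (by linarith) (by linarith)
  have e : Real.cos x = 1 - 2 * Real.sin (x / 2) ^ 2 := by
    have := Real.cos_two_mul (x / 2)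
    have h2 := Real.sin_sq_add_cos_sq (x / 2)
    rw [mul_div_cancel₀ x (by norm_num : (2:ℝ) ≠ 0)] at this
    linarith
  rw [e]
  have h3 : (2 / Real.pi * (x / 2)) ^ 2 ≤ Real.sin (x / 2) ^ 2 := by gcongr
  have e2 : 2 * x ^ 2 / Real.pi ^ 2 = 2 * (2 / Real.pi * (x / 2)) ^ 2 := by field_simp
  rw [e2]; linarith

lemma sum_cos_le {a : ℝ} (h0 : 0 < a) (h1 : a ≤ Real.pi) (K : ℕ) :
    ∑ j ∈ Finset.Ico K (2 * K), Real.cos ((j + 1 : ℝ) * a) ≤ Real.pi / a := by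
  have hpi := Real.pi_pos
  have h := Real.mul_le_sin (x := a / 2) (by linarith) (by linarith)
  have hs : a / Real.pi ≤ Real.sin (a / 2) := by
    have : 2 / Real.pi * (a / 2) = a / Real.pi := by field_simp
    linarith
  have hs0 : 0 < Real.sin (a / 2) := lt_of_lt_of_le (by positivity) hs
  have tel : ∀ N, K ≤ N → (∑ j ∈ Finset.Ico K N, Real.cos ((j + 1 : ℝ) * a)) * (2 * Real.sin (a / 2)) =
      Real.sin ((N + 1 / 2 : ℝ) * a) - Real.sin ((K + 1 / 2 : ℝ) * a) := by
    intro N hN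
    induction N, hN using Nat.le_induction with
    | base => simp
    | succ N hN ih =>
      rw [Finset.sum_Ico_succ_top hN, add_mul, ih]
      have e1 : ((N + 1 : ℕ) + 1 / 2 : ℝ) * a = (N + 1 : ℝ) * a + a / 2 := by push_cast; ring
      have e2 : (N + 1 / 2 : ℝ) * a = (N + 1 : ℝ) * a - a / 2 := by ring
      rw [e1, e2, Real.sin_add, Real.sin_sub]; ring
  have h2 := tel (2 * K) (by omega)
  have h3 : (∑ j ∈ Finset.Ico K (2 * K), Real.cos ((j + 1 : ℝ) * a)) * (2 * Real.sin (a / 2)) ≤ 2 := by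
    rw [h2]
    linarith [Real.sin_le_one (((2 * K : ℕ) + 1 / 2 : ℝ) * a), Real.neg_one_le_sin ((K + 1 / 2 : ℝ) * a)]
  have h4 : ∑ j ∈ Finset.Ico K (2 * K), Real.cos ((j + 1 : ℝ) * a) ≤ 1 / Real.sin (a / 2) := by
    rw [le_div_iff₀ hs0]; linarith
  refine h4.trans ?_
  rw [div_le_div_iff₀ hs0 h0]
  rw [div_le_iff₀ hpi] at hs
  linarith

lemma near_bound {t : ℝ} (ht : 0 < t) (ht1 : t ≤ 1) {θ : ℝ} (hθ : |θ| ≤ Real.pi * t / 2) :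
    ‖PH t θ‖ ≤ Real.exp (LP t) * Real.exp (-(θ ^ 2 / t ^ 3 / (128 * Real.pi ^ 2))) := by
  have hpi := Real.pi_pos
  set K := ⌊1 / t⌋₊ with hK
  have hK1 : (K : ℝ) ≤ 1 / t := Nat.floor_le (by positivity)
  have hK2 : 1 / t < K + 1 := Nat.lt_floor_add_one _
  have hKt : K * t ≤ 1 := by rwa [le_div_iff₀ ht] at hK1
  have hKt2 : 1 < (K + 1) * t := by rwa [div_lt_iff₀ ht] at hK2
  have hK3 : 1 ≤ K := by
    rw [hK, Nat.one_le_floor_iff, le_div_iff₀ ht]; linarith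
  have hK3' : (1 : ℝ) ≤ K := by exact_mod_cast hK3
  refine (PH_bound ht θ K).trans ?_
  gcongr
  have hterm : ∀ j ∈ Finset.Ico K (2 * K), (1 / 16) * (2 * ((K : ℝ) * |θ|) ^ 2 / Real.pi ^ 2) / 2 ≤ ww j t θ := by
    intro j hj
    rw [Finset.mem_Ico] at hj
    have hj1 : (K : ℝ) ≤ j := by exact_mod_cast hj.1
    have hj2 : (j + 1 : ℝ) ≤ 2 * K := by exact_mod_cast hj.2
    unfold ww
    have e1 : Real.exp (-((j + 1 : ℝ) * t)) ≤ 1 / 2 := by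
      have h1 : Real.exp (-((j + 1 : ℝ) * t)) ≤ Real.exp (-1) := Real.exp_le_exp.2 (by nlinarith)
      have he3 : Real.exp (-1) < 1 / 2 := by
        have := Real.exp_one_gt_d9
        rw [Real.exp_neg, ← one_div]
        apply one_div_lt_one_div_of_lt <;> linarith
      linarith
    have e2 : 1 / 8 ≤ Real.exp (-((j + 1 : ℝ) * t)) := by
      have h1 : Real.exp (-2) ≤ Real.exp (-((j + 1 : ℝ) * t)) := Real.exp_le_exp.2 (by nlinarith)
      have he3 : 1 / 8 ≤ Real.exp (-2) := by
        have := Real.exp_one_lt_d9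
        have h0 := Real.exp_pos 1
        rw [Real.exp_neg, ← one_div, show (2:ℝ) = 1 + 1 by norm_num, Real.exp_add]
        apply one_div_le_one_div_of_le (by positivity); nlinarith
      linarith
    have hr : 1 / 16 ≤ Real.exp (-((j + 1 : ℝ) * t)) * (1 - Real.exp (-((j + 1 : ℝ) * t))) := by nlinarith
    have hb : (j + 1 : ℝ) * |θ| ≤ Real.pi := by
      calc (j + 1 : ℝ) * |θ| ≤ (2 * K) * (Real.pi * t / 2) := by gcongr
        _ = Real.pi * (K * t) := by ring
        _ ≤ Real.pi * 1 := by gcongr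
        _ = Real.pi := mul_one _
    have hc := one_sub_cos_ge (x := (j + 1 : ℝ) * |θ|) (by positivity) hb
    have hc2 : 2 * ((K : ℝ) * |θ|) ^ 2 / Real.pi ^ 2 ≤ 2 * ((j + 1 : ℝ) * |θ|) ^ 2 / Real.pi ^ 2 := by
      gcongr; linarith
    have hc3 := hc2.trans hc
    gcongr
  have hsum := Finset.card_nsmul_le_sum _ _ _ hterm
  rw [Nat.card_Ico, nsmul_eq_mul] at hsum
  refine le_trans ?_ hsum
  have hcard : ((2 * K - K : ℕ) : ℝ) = K := by congr 1; omega
  rw [hcard, mul_pow, sq_abs]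
  have e : (K : ℝ) * (1 / 16 * (2 * ((K : ℝ) ^ 2 * θ ^ 2) / Real.pi ^ 2) / 2) =
    K ^ 3 * (θ ^ 2 / (16 * Real.pi ^ 2)) := by ring
  have e' : θ ^ 2 / t ^ 3 / (128 * Real.pi ^ 2) = (1 / (2 * t)) ^ 3 * (θ ^ 2 / (16 * Real.pi ^ 2)) := by
    field_simp; ring
  rw [e, e']
  have : 1 / (2 * t) ≤ K := by
    rw [div_le_iff₀ (by positivity)]; nlinarith
  gcongr

lemma far_bound : ∃ c : ℝ, 0 < c ∧ ∀ t : ℝ, 0 < t → t ≤ 1 → ∀ θ : ℝ, Real.pi * t / 2 ≤ |θ| → |θ| ≤ Real.pi →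
    ‖PH t θ‖ ≤ Real.exp (LP t) * Real.exp (-(c / t)) := by
  have hpi := Real.pi_pos
  refine ⟨Real.exp (-18) / 2 / 2 * 6, by positivity, fun t ht ht1 θ h1 h2 => ?_⟩
  set K := ⌈8 / t⌉₊ with hK
  have hK1 : 8 / t ≤ K := Nat.le_ceil _
  have hK2 : (K : ℝ) < 8 / t + 1 := Nat.ceil_lt_add_one (by positivity)
  have hKt : 8 ≤ K * t := by rwa [div_le_iff₀ ht] at hK1
  have hKt2 : K * t ≤ 9 := by
    have : K * t < (8 / t + 1) * t := by gcongr
    have e : (8 / t + 1) * t = 8 + t := by field_simp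
    linarith
  refine (PH_bound ht θ K).trans ?_
  gcongr
  have hterm : ∀ j ∈ Finset.Ico K (2 * K), Real.exp (-18) / 2 / 2 * (1 - Real.cos ((j + 1 : ℝ) * |θ|)) ≤ ww j t θ := by
    intro j hj
    rw [Finset.mem_Ico] at hj
    have hj1 : (K : ℝ) ≤ j := by exact_mod_cast hj.1
    have hj2 : (j + 1 : ℝ) ≤ 2 * K := by exact_mod_cast hj.2
    unfold ww
    have e1 : Real.exp (-((j + 1 : ℝ) * t)) ≤ 1 / 2 := by
      have h1 : Real.exp (-((j + 1 : ℝ) * t)) ≤ Real.exp (-1) := Real.exp_le_exp.2 (by nlinarith)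
      have he3 : Real.exp (-1) < 1 / 2 := by
        have := Real.exp_one_gt_d9
        rw [Real.exp_neg, ← one_div]
        apply one_div_lt_one_div_of_lt <;> linarith
      linarith
    have e2 : Real.exp (-18) ≤ Real.exp (-((j + 1 : ℝ) * t)) := Real.exp_le_exp.2 (by nlinarith)
    have hr : Real.exp (-18) / 2 ≤ Real.exp (-((j + 1 : ℝ) * t)) * (1 - Real.exp (-((j + 1 : ℝ) * t))) := by
      have := Real.exp_pos (-18)
      nlinarith
    have hc : 0 ≤ 1 - Real.cos ((j + 1 : ℝ) * |θ|) := by linarith [Real.cos_le_one ((j + 1 : ℝ) * |θ|)]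
    have := mul_le_mul_of_nonneg_right hr hc
    linarith
  have hsum := Finset.sum_le_sum hterm
  refine le_trans ?_ hsum
  rw [← Finset.mul_sum, Finset.sum_sub_distrib, mul_div_assoc]
  have hθ0 : 0 < |θ| := lt_of_lt_of_le (by positivity) h1
  have hcos := sum_cos_le hθ0 h2 K
  have h3 : Real.pi / |θ| ≤ 2 / t := by
    rw [div_le_div_iff₀ hθ0 ht]; linarith
  have h4 : ∑ x ∈ Finset.Ico K (2 * K), (1:ℝ) = K := by
    simp; omega
  have h5 : 6 / t ≤ ∑ x ∈ Finset.Ico K (2 * K), (1:ℝ) - ∑ x ∈ Finset.Ico K (2 * K), Real.cos ((x + 1 : ℝ) * |θ|) := by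
    rw [h4]
    have : 6 / t = 8 / t - 2 / t := by ring
    linarith
  gcongr

theorem PH_dom : ∃ C : ℝ, 0 < C ∧ ∀ t : ℝ, 0 < t → t ≤ 1 → ∀ θ : ℝ, |θ| ≤ Real.pi →
    ‖PH t θ‖ ≤ Real.exp (LP t) * (C * (1 + θ ^ 2 / t ^ 3)⁻¹) := by
  obtain ⟨c, hc, hfar⟩ := far_bound
  have hpi := Real.pi_pos
  have hpi3 := Real.pi_gt_three
  refine ⟨128 * Real.pi ^ 2 + 6 * (1 + Real.pi ^ 2) / c ^ 3, by positivity, fun t ht ht1 θ hθ => ?_⟩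
  have ht3 : 0 < t ^ 3 := by positivity
  have hX : 0 ≤ θ ^ 2 / t ^ 3 := by positivity
  rcases le_total |θ| (Real.pi * t / 2) with h | h
  · refine (near_bound ht ht1 h).trans ?_
    gcongr
    set X := θ ^ 2 / t ^ 3
    have hD : 0 < 128 * Real.pi ^ 2 := by positivity
    have hD1 : 1 ≤ 128 * Real.pi ^ 2 := by nlinarith
    have h1 := Real.add_one_le_exp (X / (128 * Real.pi ^ 2))
    have h2 : Real.exp (-(X / (128 * Real.pi ^ 2))) ≤ (128 * Real.pi ^ 2) * (1 + X)⁻¹ := by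
      rw [Real.exp_neg, ← one_div, ← div_eq_mul_inv, div_le_div_iff₀ (Real.exp_pos _) (by linarith)]
      have h3 : (128 * Real.pi ^ 2) * (X / (128 * Real.pi ^ 2) + 1) = X + 128 * Real.pi ^ 2 := by field_simp
      have h4 := mul_le_mul_of_nonneg_left h1 hD.le
      linarith
    refine h2.trans ?_
    gcongr
    have : 0 ≤ 6 * (1 + Real.pi ^ 2) / c ^ 3 := by positivity
    linarith
  · refine (hfar t ht ht1 θ h hθ).trans ?_
    gcongr
    have h0 : 0 < c / t := by positivity
    have h1 : (c / t) ^ 3 / 6 ≤ Real.exp (c / t) := by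
      have := Real.pow_div_factorial_le_exp (c / t) h0.le 3
      simpa [Nat.factorial] using this
    have h2 : 1 + θ ^ 2 / t ^ 3 ≤ (1 + Real.pi ^ 2) / t ^ 3 := by
      have : θ ^ 2 ≤ Real.pi ^ 2 := by rw [← sq_abs]; gcongr
      rw [add_div]
      have h3 : 1 ≤ 1 / t ^ 3 := by
        rw [le_div_iff₀ ht3, one_mul]; exact pow_le_one₀ ht.le ht1
      gcongr
    have h3 : Real.exp (-(c / t)) ≤ 6 * (1 + Real.pi ^ 2) / c ^ 3 * (1 + θ ^ 2 / t ^ 3)⁻¹ := by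
      rw [Real.exp_neg, ← div_eq_mul_inv, ← one_div, div_le_div_iff₀ (Real.exp_pos _) (by linarith), one_mul]
      calc 1 + θ ^ 2 / t ^ 3 ≤ (1 + Real.pi ^ 2) / t ^ 3 := h2
        _ = 6 * (1 + Real.pi ^ 2) / c ^ 3 * ((c / t) ^ 3 / 6) := by field_simp
        _ ≤ _ := by gcongr
    refine h3.trans ?_
    gcongr
    have : 0 ≤ 128 * Real.pi ^ 2 := by positivity
    linarith


section vit
variable {p X : ℕ → ℝ} {R : ℝ}

lemma vit_abs (hR : 0 ≤ R) (x : ℝ) : Real.exp (R * |x|) ≤ Real.exp (R * x) + Real.exp (-R * x) := by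
  rcases abs_cases x with ⟨h, _⟩ | ⟨h, _⟩ <;> rw [h]
  · linarith [Real.exp_pos (-R * x)]
  · rw [show R * -x = -R * x by ring]; linarith [Real.exp_pos (R * x)]

lemma vit_summ_abs (hp : ∀ k, 0 ≤ p k) (hR : 0 ≤ R)
    (h1 : Summable (fun k => p k * Real.exp (R * X k))) (h2 : Summable (fun k => p k * Real.exp (-R * X k))) :
    Summable (fun k => p k * Real.exp (R * |X k|)) ∧
    ∑' k, p k * Real.exp (R * |X k|) ≤ ∑' k, p k * Real.exp (R * X k) + ∑' k, p k * Real.exp (-R * X k) := by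
  have hle : ∀ k, p k * Real.exp (R * |X k|) ≤ p k * Real.exp (R * X k) + p k * Real.exp (-R * X k) := by
    intro k
    rw [← mul_add]
    exact mul_le_mul_of_nonneg_left (vit_abs hR _) (hp k)
  have hs : Summable (fun k => p k * Real.exp (R * |X k|)) :=
    Summable.of_nonneg_of_le (fun k => mul_nonneg (hp k) (Real.exp_pos _).le) hle (h1.add h2)
  refine ⟨hs, ?_⟩
  rw [← h1.tsum_add h2]
  exact hs.tsum_le_tsum hle (h1.add h2)

lemma vit_coef (hp : ∀ k, 0 ≤ p k) (hR : 0 ≤ R)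
    (hs : Summable (fun k => p k * Real.exp (R * |X k|))) (j : ℕ) :
    |∑' k, p k * X k ^ j / (j.factorial : ℝ)| * R ^ j ≤ ∑' k, p k * Real.exp (R * |X k|) := by
  have hle : ∀ k, ‖p k * X k ^ j / (j.factorial : ℝ) * R ^ j‖ ≤ p k * Real.exp (R * |X k|) := by
    intro k
    have h := Real.pow_div_factorial_le_exp (R * |X k|) (by positivity) j
    rw [norm_mul, norm_div, norm_mul, norm_pow, norm_pow, Real.norm_of_nonneg (hp k), Real.norm_of_nonneg hR,
      Real.norm_eq_abs, Real.norm_natCast]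
    calc p k * |X k| ^ j / (j.factorial : ℝ) * R ^ j = p k * ((R * |X k|) ^ j / (j.factorial : ℝ)) := by
          rw [mul_pow]; ring
      _ ≤ _ := mul_le_mul_of_nonneg_left h (hp k)
  have e : |∑' k, p k * X k ^ j / (j.factorial : ℝ)| * R ^ j =
      ‖∑' k, p k * X k ^ j / (j.factorial : ℝ) * R ^ j‖ := by
    rw [tsum_mul_right, norm_mul, norm_pow, Real.norm_of_nonneg hR, Real.norm_eq_abs]
  rw [e]
  exact tsum_of_norm_bounded hs.hasSum hle

lemma vit_expand (hp : ∀ k, 0 ≤ p k)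
    (hs : Summable (fun k => p k * Real.exp (R * |X k|))) {z : ℂ} (hz : ‖z‖ ≤ R) :
    ∑' k, (p k : ℂ) * Complex.exp (z * X k) =
      ∑' j : ℕ, ((∑' k, p k * X k ^ j / (j.factorial : ℝ) : ℝ) : ℂ) * z ^ j := by
  have hR : 0 ≤ R := (norm_nonneg z).trans hz
  set F : ℕ × ℕ → ℂ := fun q => (p q.1 : ℂ) * ((z * X q.1) ^ q.2 / (q.2.factorial : ℂ)) with hF
  have hin : ∀ k, HasSum (fun j => F (k, j)) ((p k : ℂ) * Complex.exp (z * X k)) := by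
    intro k
    have h := (NormedSpace.expSeries_div_hasSum_exp (z * X k)).mul_left (p k : ℂ)
    rw [← Complex.exp_eq_exp_ℂ] at h
    exact h
  have hnorm : ∀ k, HasSum (fun j => ‖F (k, j)‖) (p k * Real.exp (‖z‖ * |X k|)) := by
    intro k
    have h := (NormedSpace.expSeries_div_hasSum_exp (‖z‖ * |X k|)).mul_left (p k)
    rw [← Real.exp_eq_exp_ℝ] at h
    refine h.congr_fun ?_
    intro j
    simp only [hF, norm_mul, norm_div, norm_pow, Complex.norm_real, Complex.norm_natCast, Real.norm_eq_abs,
      abs_of_nonneg (hp k)]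
  have hsum : Summable F := by
    apply Summable.of_norm
    rw [summable_prod_of_nonneg (fun _ => norm_nonneg _)]
    refine ⟨fun k => (hnorm k).summable, ?_⟩
    refine Summable.of_nonneg_of_le (fun k => tsum_nonneg fun _ => norm_nonneg _) (fun k => ?_) hs
    rw [(hnorm k).tsum_eq]
    have := hp k
    gcongr
  have h1 : ∑' k, (p k : ℂ) * Complex.exp (z * X k) = ∑' k, ∑' j, F (k, j) :=
    tsum_congr fun k => (hin k).tsum_eq.symm
  rw [h1]
  have h2 : ∑' k, ∑' j, F (k, j) = ∑' j, ∑' k, F (k, j) := by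
    have := hsum.tsum_comm' (f := fun k j => F (k, j)) (fun k => (hin k).summable) (fun j => ?_)
    · exact this.symm
    · exact hsum.comp_injective (i := fun k => (k, j)) (fun a b h => (Prod.mk.inj h).1)
  rw [h2]
  refine tsum_congr fun j => ?_
  rw [Complex.ofReal_tsum, ← tsum_mul_right]
  refine tsum_congr fun k => ?_
  simp only [hF]
  push_cast
  rw [mul_pow]; ring
end vit

theorem vitali {ι : Type*} (l : Filter ι) (p X : ι → ℕ → ℝ) (A : ℝ) (hp : ∀ i k, 0 ≤ p i k)
    (hsm : ∀ s : ℝ, ∀ᶠ i in l, Summable (fun k => p i k * Real.exp (s * X i k)))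
    (hlim : ∀ s : ℝ, Tendsto (fun i => ∑' k, p i k * Real.exp (s * X i k)) l (𝓝 (Real.exp (A * s ^ 2))))
    (z : ℂ) :
    Tendsto (fun i => ∑' k, (p i k : ℂ) * Complex.exp (z * X i k)) l (𝓝 (Complex.exp (A * z ^ 2))) := by
  set m : ℕ → ι → ℝ := fun j i => ∑' k, p i k * X i k ^ j / (j.factorial : ℝ) with hm
  set B : ℝ → ℝ := fun R => 2 * Real.exp (A * R ^ 2) + 2 with hB
  have good : ∀ R : ℝ, 0 ≤ R → ∀ᶠ i in l, Summable (fun k => p i k * Real.exp (R * |X i k|)) ∧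
      ∑' k, p i k * Real.exp (R * |X i k|) ≤ B R := by
    intro R hR
    have e1 := (hlim R).eventually (gt_mem_nhds (show Real.exp (A * R ^ 2) < Real.exp (A * R ^ 2) + 1 by linarith))
    have e2 := (hlim (-R)).eventually (gt_mem_nhds (show Real.exp (A * (-R) ^ 2) < Real.exp (A * R ^ 2) + 1 by
      rw [neg_sq]; linarith))
    filter_upwards [hsm R, hsm (-R), e1, e2] with i h1 h2 h3 h4
    obtain ⟨h5, h6⟩ := vit_summ_abs (hp i) hR h1 h2
    exact ⟨h5, by simp only [hB]; linarith⟩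
  rw [tendsto_iff_ultrafilter]
  intro g hg
  have hex : ∀ j, ∃ a : ℝ, Tendsto (m j) g (𝓝 a) := by
    intro j
    have hb : ∀ᶠ i in l, m j i ∈ Metric.closedBall (0:ℝ) (B 1) := by
      filter_upwards [good 1 zero_le_one] with i hi
      have := vit_coef (hp i) zero_le_one hi.1 j
      rw [one_pow, mul_one] at this
      rw [mem_closedBall_zero_iff, Real.norm_eq_abs]
      exact this.trans hi.2
    obtain ⟨a, _, ha⟩ := (isCompact_closedBall (0:ℝ) (B 1)).ultrafilter_le_nhds' (g.map (m j)) (hg hb)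
    exact ⟨a, ha⟩
  choose a ha using hex
  have hbd : ∀ R : ℝ, 0 ≤ R → ∀ j, |a j| * R ^ j ≤ B R := by
    intro R hR j
    refine le_of_tendsto (((ha j).abs).mul_const (R ^ j)) (hg ?_)
    filter_upwards [good R hR] with i hi
    exact (vit_coef (hp i) hR hi.1 j).trans hi.2
  set H : ℂ → ℂ := fun z => ∑' j : ℕ, (a j : ℂ) * z ^ j with hH
  have conv : ∀ z : ℂ, Tendsto (fun i => ∑' k, (p i k : ℂ) * Complex.exp (z * X i k)) g (𝓝 (H z)) := by
    intro z
    set R : ℝ := 2 * ‖z‖ + 1 with hRd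
    have hz0 := norm_nonneg z
    have hR : 0 < R := by positivity
    have h1 : Tendsto (fun i => ∑' j : ℕ, ((m j i : ℝ) : ℂ) * z ^ j) g (𝓝 (H z)) := by
      refine tendsto_tsum_of_dominated_convergence (bound := fun j : ℕ => B R * (1 / 2 : ℝ) ^ j)
        (summable_geometric_two.mul_left _) ?_ ?_
      · intro j
        exact ((Complex.continuous_ofReal.tendsto _).comp (ha j)).mul_const _
      · refine hg ?_
        filter_upwards [good R hR.le] with i hi j
        have h := (vit_coef (hp i) hR.le hi.1 j).trans hi.2
        rw [norm_mul, norm_pow, Complex.norm_real, Real.norm_eq_abs]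
        calc |m j i| * ‖z‖ ^ j ≤ |m j i| * (R * (1 / 2)) ^ j := by gcongr; linarith
          _ = (|m j i| * R ^ j) * (1 / 2) ^ j := by rw [mul_pow]; ring
          _ ≤ _ := by gcongr
    refine h1.congr' (hg ?_)
    filter_upwards [good R hR.le] with i hi
    exact (vit_expand (hp i) hi.1 (by linarith)).symm
  have hreal : ∀ s : ℝ, H s = Complex.exp (A * (s : ℂ) ^ 2) := by
    intro s
    have h1 : Tendsto (fun i => ((∑' k, p i k * Real.exp (s * X i k) : ℝ) : ℂ)) g
        (𝓝 ((Real.exp (A * s ^ 2) : ℝ) : ℂ)) :=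
      (Complex.continuous_ofReal.tendsto _).comp ((hlim s).mono_left hg)
    have h2 : (fun i => ((∑' k, p i k * Real.exp (s * X i k) : ℝ) : ℂ)) =
        fun i => ∑' k, (p i k : ℂ) * Complex.exp (s * X i k) := by
      funext i
      rw [Complex.ofReal_tsum]
      refine tsum_congr fun k => ?_
      push_cast; rfl
    rw [h2] at h1
    have := tendsto_nhds_unique (conv s) h1
    rw [this]; push_cast; rfl
  have hdiff : Differentiable ℂ H := by
    intro z
    set R : ℝ := ‖z‖ + 1 with hRd
    have hz0 := norm_nonneg z
    have hR : 0 < R := by positivity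
    have hd : DifferentiableOn ℂ H (Metric.ball 0 R) := by
      refine Complex.differentiableOn_tsum_of_summable_norm (u := fun j : ℕ => B (2 * R) * (1 / 2 : ℝ) ^ j)
        (summable_geometric_two.mul_left _) (fun j => by fun_prop) Metric.isOpen_ball ?_
      intro j w hw
      rw [mem_ball_zero_iff] at hw
      rw [norm_mul, norm_pow, Complex.norm_real, Real.norm_eq_abs]
      calc |a j| * ‖w‖ ^ j ≤ |a j| * ((2 * R) * (1 / 2)) ^ j := by gcongr; linarith
        _ = (|a j| * (2 * R) ^ j) * (1 / 2) ^ j := by rw [mul_pow]; ring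
        _ ≤ _ := by gcongr; exact hbd _ (by positivity) j
    exact hd.differentiableAt (Metric.isOpen_ball.mem_nhds (by rw [mem_ball_zero_iff]; linarith))
  have hfin : H = fun z => Complex.exp (A * z ^ 2) := by
    have hA1 : AnalyticOnNhd ℂ H Set.univ := fun z _ => hdiff.analyticAt z
    have hd2 : Differentiable ℂ (fun z : ℂ => Complex.exp (A * z ^ 2)) := by fun_prop
    have hA2 : AnalyticOnNhd ℂ (fun z : ℂ => Complex.exp (A * z ^ 2)) Set.univ := fun z _ => hd2.analyticAt z
    refine hA1.eq_of_frequently_eq (z₀ := 0) hA2 ?_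
    have ht : Tendsto (fun n : ℕ => (((1 / ((n : ℝ) + 1) : ℝ)) : ℂ)) atTop (𝓝[≠] 0) := by
      refine tendsto_nhdsWithin_iff.2 ⟨?_, Eventually.of_forall fun n => ?_⟩
      · have := (Complex.continuous_ofReal.tendsto 0).comp tendsto_one_div_add_atTop_nhds_zero_nat
        rw [Complex.ofReal_zero] at this; exact this
      · simp only [Set.mem_compl_iff, Set.mem_singleton_iff]
        have : (0:ℝ) < 1 / ((n : ℝ) + 1) := by positivity
        exact_mod_cast this.ne'
    exact ht.frequently (Frequently.of_forall fun n => hreal _)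
  have := conv z
  rwa [hfin] at this


lemma int_exp_ortho (m : ℤ) : ∫ θ in (-Real.pi)..Real.pi, Complex.exp ((m * θ : ℝ) * Complex.I) =
    if m = 0 then 2 * (Real.pi : ℂ) else 0 := by
  split_ifs with h
  · subst h; simp; ring
  · have hc : (m : ℂ) * Complex.I ≠ 0 := mul_ne_zero (by exact_mod_cast h) Complex.I_ne_zero
    have := integral_exp_mul_complex (a := -Real.pi) (b := Real.pi) hc
    have e : ∀ θ : ℝ, Complex.exp ((m * θ : ℝ) * Complex.I) = Complex.exp ((m : ℂ) * Complex.I * θ) := by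
      intro θ; congr 1; push_cast; ring
    simp_rw [e]
    rw [this, div_eq_zero_iff]
    left
    rw [sub_eq_zero, Complex.exp_eq_exp_iff_exists_int]
    refine ⟨m, ?_⟩
    push_cast; ring

lemma cauchy_PO {t : ℝ} (ht : 0 < t) (n : ℕ) :
    ∫ θ in (-Real.pi)..Real.pi, PH t θ * Complex.exp ((-(n * θ) : ℝ) * Complex.I) =
      2 * Real.pi * ((PO n * Real.exp (-t) ^ n : ℝ) : ℂ) := by
  have key := intervalIntegral.hasSum_integral_of_dominated_convergence (μ := MeasureTheory.volume)
    (a := -Real.pi) (b := Real.pi)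
    (F := fun (k : ℕ) (θ : ℝ) => (PO k : ℂ) * xx t θ ^ k * Complex.exp ((-(n * θ) : ℝ) * Complex.I))
    (f := fun θ => PH t θ * Complex.exp ((-(n * θ) : ℝ) * Complex.I))
    (bound := fun k _ => (PO k : ℝ) * Real.exp (-t) ^ k) ?_ ?_ ?_ ?_ ?_
  · have h2 : HasSum (fun k : ℕ => ∫ θ in (-Real.pi)..Real.pi,
        (PO k : ℂ) * xx t θ ^ k * Complex.exp ((-(n * θ) : ℝ) * Complex.I))
        (2 * Real.pi * ((PO n * Real.exp (-t) ^ n : ℝ) : ℂ)) := by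
      have e : ∀ k : ℕ, ∫ θ in (-Real.pi)..Real.pi,
          (PO k : ℂ) * xx t θ ^ k * Complex.exp ((-(n * θ) : ℝ) * Complex.I) =
          if k = n then (2 * Real.pi * ((PO n * Real.exp (-t) ^ n : ℝ) : ℂ)) else 0 := by
        intro k
        have e1 : ∀ θ : ℝ, (PO k : ℂ) * xx t θ ^ k * Complex.exp ((-(n * θ) : ℝ) * Complex.I) =
            ((PO k * Real.exp (-t) ^ k : ℝ) : ℂ) * Complex.exp (((((k : ℤ) - n : ℤ) : ℝ) * θ : ℝ) * Complex.I) := by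
          intro θ
          rw [xx]
          push_cast
          rw [← Complex.exp_nat_mul, ← Complex.exp_nat_mul, mul_assoc, mul_assoc, ← Complex.exp_add, ← Complex.exp_add]
          congr 2; ring
        simp_rw [e1]
        rw [intervalIntegral.integral_const_mul, int_exp_ortho]
        by_cases h : k = n
        · subst h; simp; ring
        · have : ¬ ((k : ℤ) - n = 0) := by omega
          simp [this, h]
      rw [funext e]
      exact hasSum_ite_eq n _
    exact key.unique h2
  · intro k
    refine Continuous.aestronglyMeasurable ?_
    unfold xx; fun_prop
  · intro k
    refine Eventually.of_forall fun θ _ => ?_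
    rw [norm_mul, norm_PO_term, Complex.norm_exp_ofReal_mul_I, mul_one]
  · exact Eventually.of_forall fun θ _ => (hasSum_PO ht).summable
  · exact intervalIntegrable_const
  · refine Eventually.of_forall fun θ _ => ?_
    exact (summable_PH ht θ).hasSum.mul_right _

lemma PH_cont {t : ℝ} (ht : 0 < t) : Continuous (PH t) := by
  unfold PH
  refine continuous_tsum (u := fun k => (PO k : ℝ) * Real.exp (-t) ^ k) (fun n => ?_) (hasSum_PO ht).summable ?_
  · unfold xx; fun_prop
  · intro n θ; rw [norm_PO_term]

noncomputable def dl (t : ℝ) : ℝ := t * Real.sqrt t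
lemma dl_pos {t : ℝ} (ht : 0 < t) : 0 < dl t := by unfold dl; positivity
lemma dl_sq {t : ℝ} (ht : 0 < t) : dl t ^ 2 = t ^ 3 := by
  unfold dl; rw [mul_pow, Real.sq_sqrt ht.le]; ring

lemma cauchy_PO_dl {t : ℝ} (ht : 0 < t) (n : ℕ) :
    dl t * ∫ u in (-(Real.pi / dl t))..(Real.pi / dl t),
      PH t (u * dl t) * Complex.exp ((-(n * (u * dl t)) : ℝ) * Complex.I) =
      2 * Real.pi * ((PO n * Real.exp (-t) ^ n : ℝ) : ℂ) := by
  have hd := dl_pos ht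
  rw [← cauchy_PO ht n]
  have := intervalIntegral.smul_integral_comp_mul_right (a := -(Real.pi / dl t)) (b := Real.pi / dl t)
    (fun θ => PH t θ * Complex.exp ((-(n * θ) : ℝ) * Complex.I)) (dl t)
  rw [neg_mul, div_mul_cancel₀ _ hd.ne'] at this
  rw [← this, Complex.real_smul]

theorem PO_le : ∃ C : ℝ, 0 < C ∧ ∀ t : ℝ, 0 < t → t ≤ 1 → ∀ n : ℕ,
    (PO n : ℝ) ≤ C * dl t * Real.exp (LP t) * Real.exp (n * t) := by
  obtain ⟨C, hC, hdom⟩ := PH_dom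
  refine ⟨C, hC, fun t ht ht1 n => ?_⟩
  have hpi := Real.pi_pos
  have hd := dl_pos ht
  have h := congrArg norm (cauchy_PO_dl ht n)
  rw [norm_mul, norm_mul, norm_mul, Complex.norm_real, Complex.norm_real, Complex.norm_real,
    Real.norm_of_nonneg hd.le, Real.norm_of_nonneg hpi.le, Real.norm_of_nonneg (by positivity)] at h
  have hb : ‖∫ u in (-(Real.pi / dl t))..(Real.pi / dl t),
      PH t (u * dl t) * Complex.exp ((-(n * (u * dl t)) : ℝ) * Complex.I)‖ ≤
      Real.exp (LP t) * C * Real.pi := by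
    have hab : -(Real.pi / dl t) ≤ Real.pi / dl t := by
      have : 0 < Real.pi / dl t := by positivity
      linarith
    calc _ ≤ ∫ u in (-(Real.pi / dl t))..(Real.pi / dl t), Real.exp (LP t) * C * (1 + u ^ 2)⁻¹ := by
          refine intervalIntegral.norm_integral_le_of_norm_le hab ?_
            ((integrable_inv_one_add_sq.const_mul _).intervalIntegrable)
          refine Eventually.of_forall fun u hu => ?_
          rw [norm_mul, Complex.norm_exp_ofReal_mul_I, mul_one]
          have hu' : |u * dl t| ≤ Real.pi := by
            rw [abs_mul, abs_of_pos hd, ← le_div_iff₀ hd, abs_le]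
            exact ⟨hu.1.le, hu.2⟩
          have := hdom t ht ht1 (u * dl t) hu'
          rw [mul_pow, dl_sq ht, mul_div_cancel_right₀ _ (by positivity : t ^ 3 ≠ 0)] at this
          linarith
      _ ≤ ∫ u : ℝ, Real.exp (LP t) * C * (1 + u ^ 2)⁻¹ := by
          rw [intervalIntegral.integral_of_le hab]
          refine MeasureTheory.setIntegral_le_integral (integrable_inv_one_add_sq.const_mul _) ?_
          refine Eventually.of_forall fun u => ?_
          show (0:ℝ) ≤ _
          positivity
      _ = _ := by rw [MeasureTheory.integral_const_mul, integral_univ_inv_one_add_sq]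
  have h2 : 2 * Real.pi * (PO n * Real.exp (-t) ^ n) ≤ dl t * (Real.exp (LP t) * C * Real.pi) := by
    have : ‖(2:ℂ)‖ = 2 := by simp
    rw [this] at h
    rw [← h]; gcongr
  have h3 : PO n * Real.exp (-t) ^ n ≤ C * dl t * Real.exp (LP t) := by
    have h4 : Real.pi * (2 * (PO n * Real.exp (-t) ^ n)) ≤ Real.pi * (dl t * (Real.exp (LP t) * C)) := by linarith
    have h5 := le_of_mul_le_mul_left h4 hpi
    have h6 : 0 ≤ (PO n : ℝ) * Real.exp (-t) ^ n := by positivity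
    linarith
  have e : Real.exp (-t) ^ n * Real.exp (n * t) = 1 := by
    rw [← Real.exp_nat_mul, ← Real.exp_add]; simp
  calc (PO n : ℝ) = PO n * Real.exp (-t) ^ n * Real.exp (n * t) := by rw [mul_assoc, e, mul_one]
    _ ≤ _ := by gcongr


lemma tendsto_sqrt_zero : Tendsto (fun t : ℝ => Real.sqrt t) (𝓝[>] 0) (𝓝 0) := by
  have := Real.continuous_sqrt.tendsto 0
  rw [Real.sqrt_zero] at this
  exact this.mono_left nhdsWithin_le_nhds

lemma tendsto_one_sub_s (s : ℝ) : Tendsto (fun t : ℝ => 1 - s * Real.sqrt t) (𝓝[>] 0) (𝓝 1) := by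
  have := (tendsto_sqrt_zero.const_mul s).const_sub 1
  simpa using this

lemma ev_one_sub_s (s : ℝ) : ∀ᶠ t : ℝ in 𝓝[>] 0, 0 < 1 - s * Real.sqrt t :=
  (tendsto_one_sub_s s).eventually (lt_mem_nhds one_pos)

lemma tau_eq (s t : ℝ) : t - s * dl t = t * (1 - s * Real.sqrt t) := by unfold dl; ring

lemma LP_shift (s : ℝ) : Tendsto (fun t : ℝ => LP (t - s * dl t) - LP t - s * dl t * (AA / t ^ 2))
    (𝓝[>] 0) (𝓝 (AA * s ^ 2)) := by
  have hpi := Real.pi_pos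
  have h1 := tendsto_one_sub_s s
  have hid : Tendsto (fun t : ℝ => t) (𝓝[>] 0) (𝓝 0) := tendsto_id.mono_left nhdsWithin_le_nhds
  have hτ : Tendsto (fun t : ℝ => t - s * dl t) (𝓝[>] 0) (𝓝[>] 0) := by
    refine tendsto_nhdsWithin_iff.2 ⟨?_, ?_⟩
    · have := hid.mul h1
      rw [zero_mul] at this
      exact this.congr fun t => (tau_eq s t).symm
    · filter_upwards [ev_one_sub_s s, self_mem_nhdsWithin] with t ht ht0
      rw [tau_eq]; exact mul_pos ht0 ht
  have a1 := LP_asymp.comp hτ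
  have a2 := a1.sub LP_asymp
  have a3 : Tendsto (fun t : ℝ => AA * s ^ 2 / (1 - s * Real.sqrt t) + Real.log (1 - s * Real.sqrt t) / 2)
      (𝓝[>] 0) (𝓝 (AA * s ^ 2 / 1 + Real.log 1 / 2)) :=
    (tendsto_const_nhds.div h1 one_ne_zero).add ((h1.log one_ne_zero).div_const 2)
  have a4 := a2.add a3
  simp only [sub_zero, zero_add, Real.log_one, zero_div, add_zero, div_one] at a4
  refine a4.congr' ?_
  filter_upwards [ev_one_sub_s s, self_mem_nhdsWithin] with t ht ht0
  have ht0 : 0 < t := ht0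
  simp only [Function.comp]
  have hsq : Real.sqrt t ^ 2 = t := Real.sq_sqrt ht0.le
  have hr : 0 < Real.sqrt t := Real.sqrt_pos.2 ht0
  have e1 : Real.log ((t - s * dl t) / Real.pi) = Real.log (t / Real.pi) + Real.log (1 - s * Real.sqrt t) := by
    rw [← Real.log_mul (by positivity) ht.ne', tau_eq]; congr 1; ring
  rw [e1]
  have e2 : AA / (t - s * dl t) - AA / t - AA * s ^ 2 / (1 - s * Real.sqrt t) = s * dl t * (AA / t ^ 2) := by
    rw [tau_eq, dl]
    set r := Real.sqrt t
    rw [← hsq]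
    obtain ⟨q, hq⟩ : ∃ q, q = 1 - s * r := ⟨_, rfl⟩
    rw [← hq]
    have hq0 : q ≠ 0 := by rw [hq]; exact ht.ne'
    have hs : s = (1 - q) / r := by rw [hq]; field_simp; ring
    rw [hs]
    field_simp
    ring
  rw [← e2]; ring

noncomputable def pp (t : ℝ) (k : ℕ) : ℝ := if 0 < t then PO k * Real.exp (-t) ^ k / Real.exp (LP t) else 0
noncomputable def XX (t : ℝ) (k : ℕ) : ℝ := (k - AA / t ^ 2) * dl t

lemma pp_nonneg (t : ℝ) (k : ℕ) : 0 ≤ pp t k := by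
  unfold pp; split_ifs <;> positivity

lemma mgf_hasSum (s : ℝ) {t : ℝ} (ht : 0 < t) (hs : 0 < 1 - s * Real.sqrt t) :
    HasSum (fun k => pp t k * Real.exp (s * XX t k))
      (Real.exp (LP (t - s * dl t) - LP t - s * dl t * (AA / t ^ 2))) := by
  have hτ : 0 < t - s * dl t := by rw [tau_eq]; positivity
  have h := (hasSum_PO hτ).mul_left (Real.exp (- LP t - s * dl t * (AA / t ^ 2)))
  have e1 : Real.exp (- LP t - s * dl t * (AA / t ^ 2)) * Real.exp (LP (t - s * dl t)) =
      Real.exp (LP (t - s * dl t) - LP t - s * dl t * (AA / t ^ 2)) := by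
    rw [← Real.exp_add]; congr 1; ring
  rw [e1] at h
  have e2 : (fun k => pp t k * Real.exp (s * XX t k)) = fun k : ℕ =>
      Real.exp (- LP t - s * dl t * (AA / t ^ 2)) * ((PO k : ℝ) * Real.exp (-(t - s * dl t)) ^ k) := by
    funext k
    unfold pp XX
    rw [if_pos ht, div_eq_mul_inv, ← Real.exp_neg, ← Real.exp_nat_mul, ← Real.exp_nat_mul]
    have : ∀ a b c d : ℝ, a + b + c = d → (PO k : ℝ) * Real.exp a * Real.exp b * Real.exp c = PO k * Real.exp d := by
      intro a b c d h; rw [← h, Real.exp_add, Real.exp_add]; ring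
    rw [this _ _ _ _ rfl, mul_left_comm (Real.exp _) ((PO k : ℕ) : ℝ), ← Real.exp_add]
    congr 2; ring
  rw [e2]; exact h

theorem charfun_lim (u : ℝ) : Tendsto (fun t => ∑' k, (pp t k : ℂ) * Complex.exp (u * Complex.I * XX t k))
    (𝓝[>] 0) (𝓝 (Complex.exp (-(AA * u ^ 2) : ℝ))) := by
  have := vitali (𝓝[>] (0:ℝ)) pp XX AA pp_nonneg ?_ ?_ (u * Complex.I)
  · have e : (AA : ℂ) * (u * Complex.I) ^ 2 = ((-(AA * u ^ 2) : ℝ) : ℂ) := by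
      rw [mul_pow, Complex.I_sq]; push_cast; ring
    rw [e] at this; exact this
  · intro s
    filter_upwards [ev_one_sub_s s, self_mem_nhdsWithin] with t ht ht0
    exact (mgf_hasSum s ht0 ht).summable
  · intro s
    have := (Real.continuous_exp.tendsto _).comp (LP_shift s)
    refine this.congr' ?_
    filter_upwards [ev_one_sub_s s, self_mem_nhdsWithin] with t ht ht0
    exact (mgf_hasSum s ht0 ht).tsum_eq.symm

lemma charfun_eq {t : ℝ} (ht : 0 < t) (u : ℝ) :
    ∑' k, (pp t k : ℂ) * Complex.exp (u * Complex.I * XX t k) =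
      PH t (u * dl t) * Complex.exp ((-(AA / t ^ 2 * (u * dl t)) : ℝ) * Complex.I) * ((Real.exp (LP t) : ℝ) : ℂ)⁻¹ := by
  rw [PH, ← tsum_mul_right, ← tsum_mul_right]
  refine tsum_congr fun k => ?_
  unfold pp XX xx
  rw [if_pos ht]
  push_cast
  rw [← Complex.exp_nat_mul, ← Complex.exp_nat_mul, div_eq_mul_inv]
  have : ∀ a b c d i x : ℂ, a + b = c + d → x * Complex.exp a * i * Complex.exp b = x * Complex.exp c * Complex.exp d * i := by
    intro a b c d i x h
    have : Complex.exp a * Complex.exp b = Complex.exp c * Complex.exp d := by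
      rw [← Complex.exp_add, ← Complex.exp_add, h]
    linear_combination x * i * this
  apply this
  ring

noncomputable def JJ (t : ℝ) : ℂ := ∫ u : ℝ, Set.indicator (Set.Ioc (-(Real.pi / dl t)) (Real.pi / dl t))
  (fun u : ℝ => PH t (u * dl t) * Complex.exp ((-(AA / t ^ 2 * (u * dl t)) : ℝ) * Complex.I) * ((Real.exp (LP t) : ℝ) : ℂ)⁻¹) u

lemma dl_tendsto : Tendsto dl (𝓝[>] 0) (𝓝[>] 0) := by
  refine tendsto_nhdsWithin_iff.2 ⟨?_, ?_⟩
  · have hid : Tendsto (fun t : ℝ => t) (𝓝[>] 0) (𝓝 0) := tendsto_id.mono_left nhdsWithin_le_nhds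
    have := hid.mul tendsto_sqrt_zero
    rw [zero_mul] at this
    exact this
  · filter_upwards [self_mem_nhdsWithin] with t ht
    exact dl_pos ht

theorem JJ_tendsto : Tendsto JJ (𝓝[>] 0) (𝓝 ((Real.sqrt (Real.pi / AA) : ℝ) : ℂ)) := by
  obtain ⟨C, hC, hdom⟩ := PH_dom
  have hpi := Real.pi_pos
  have e : ((Real.sqrt (Real.pi / AA) : ℝ) : ℂ) = ∫ u : ℝ, Complex.exp (-(AA * u ^ 2) : ℝ) := by
    rw [← integral_gaussian, ← integral_complex_ofReal]
    refine MeasureTheory.integral_congr_ae (Eventually.of_forall fun u => ?_)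
    simp only
    push_cast; congr 1; ring
  rw [e]
  unfold JJ
  have ev1 : ∀ᶠ t : ℝ in 𝓝[>] 0, t ≤ 1 :=
    (tendsto_id.mono_left nhdsWithin_le_nhds : Tendsto (fun t : ℝ => t) (𝓝[>] 0) (𝓝 0)).eventually (ge_mem_nhds one_pos)
  refine MeasureTheory.tendsto_integral_filter_of_dominated_convergence (bound := fun u => C * (1 + u ^ 2)⁻¹) ?_ ?_
    (integrable_inv_one_add_sq.const_mul _) ?_
  · filter_upwards [self_mem_nhdsWithin] with t ht
    refine (Continuous.aestronglyMeasurable ?_).indicator measurableSet_Ioc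
    have := PH_cont ht
    fun_prop
  · filter_upwards [self_mem_nhdsWithin, ev1] with t ht ht1
    have ht : 0 < t := ht
    have hd := dl_pos ht
    refine Eventually.of_forall fun u => ?_
    by_cases hu : u ∈ Set.Ioc (-(Real.pi / dl t)) (Real.pi / dl t)
    · rw [Set.indicator_of_mem hu, norm_mul, norm_mul, Complex.norm_exp_ofReal_mul_I, mul_one, norm_inv,
        Complex.norm_real, Real.norm_of_nonneg (Real.exp_pos _).le, ← div_eq_mul_inv, div_le_iff₀ (Real.exp_pos _)]
      have hu' : |u * dl t| ≤ Real.pi := by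
        rw [abs_mul, abs_of_pos hd, ← le_div_iff₀ hd, abs_le]
        exact ⟨hu.1.le, hu.2⟩
      have := hdom t ht ht1 (u * dl t) hu'
      rw [mul_pow, dl_sq ht, mul_div_cancel_right₀ _ (by positivity : t ^ 3 ≠ 0)] at this
      linarith
    · rw [Set.indicator_of_notMem hu, norm_zero]; positivity
  · refine Eventually.of_forall fun u => ?_
    refine (charfun_lim u).congr' ?_
    have h1 : Tendsto (fun t => Real.pi * (dl t)⁻¹) (𝓝[>] 0) atTop :=
      (tendsto_inv_nhdsGT_zero.comp dl_tendsto).const_mul_atTop hpi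
    filter_upwards [self_mem_nhdsWithin, h1.eventually_ge_atTop (|u| + 1)] with t ht hu
    rw [charfun_eq ht, Set.indicator_of_mem]
    rw [← div_eq_mul_inv] at hu
    have := neg_abs_le u
    have := le_abs_self u
    constructor <;> linarith

noncomputable def tn (n : ℕ) : ℝ := Real.sqrt (AA / n)

lemma tn_tendsto : Tendsto tn atTop (𝓝[>] 0) := by
  refine tendsto_nhdsWithin_iff.2 ⟨?_, ?_⟩
  · have : Tendsto (fun n : ℕ => AA / (n : ℝ)) atTop (𝓝 0) := tendsto_const_div_atTop_nhds_zero_nat AA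
    have h := (Real.continuous_sqrt.tendsto 0).comp this
    rw [Real.sqrt_zero] at h; exact h
  · filter_upwards [eventually_gt_atTop 0] with n hn
    have := AA_pos
    have : (0:ℝ) < n := by exact_mod_cast hn
    exact Real.sqrt_pos.2 (by positivity)

lemma tn_pos {n : ℕ} (hn : 0 < n) : 0 < tn n := by
  have := AA_pos
  have : (0:ℝ) < n := by exact_mod_cast hn
  exact Real.sqrt_pos.2 (by positivity)

lemma tn_sq {n : ℕ} (hn : 0 < n) : AA / tn n ^ 2 = n := by
  have := AA_pos
  have : (0:ℝ) < n := by exact_mod_cast hn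
  unfold tn
  rw [Real.sq_sqrt (by positivity)]
  field_simp

theorem PO_lim : Tendsto (fun n : ℕ => (PO n : ℝ) / (dl (tn n) * Real.exp (LP (tn n) + n * tn n))) atTop
    (𝓝 (Real.sqrt (Real.pi / AA) / (2 * Real.pi))) := by
  have hpi := Real.pi_pos
  have h := (Complex.continuous_re.tendsto _).comp (JJ_tendsto.comp tn_tendsto)
  have h2 := h.div_const (2 * Real.pi)
  rw [Complex.ofReal_re] at h2
  refine h2.congr' ?_
  filter_upwards [eventually_gt_atTop 0] with n hn
  have ht := tn_pos hn
  have hd := dl_pos ht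
  simp only [Function.comp, JJ]
  rw [MeasureTheory.integral_indicator measurableSet_Ioc, tn_sq hn]
  have hc := cauchy_PO_dl ht n
  have hab : -(Real.pi / dl (tn n)) ≤ Real.pi / dl (tn n) := by
    have : 0 < Real.pi / dl (tn n) := by positivity
    linarith
  rw [intervalIntegral.integral_of_le hab] at hc
  rw [MeasureTheory.integral_mul_const]
  set I := ∫ (x : ℝ) in Set.Ioc (-(Real.pi / dl (tn n))) (Real.pi / dl (tn n)),
    PH (tn n) (x * dl (tn n)) * Complex.exp ((-(n * (x * dl (tn n))) : ℝ) * Complex.I)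
  have hI : I = ((2 * Real.pi * (PO n * Real.exp (-tn n) ^ n) / dl (tn n) : ℝ) : ℂ) := by
    have hne : (dl (tn n) : ℂ) ≠ 0 := by exact_mod_cast hd.ne'
    push_cast
    rw [eq_div_iff hne, mul_comm, hc]; push_cast; ring
  rw [hI, ← Complex.ofReal_inv, ← Complex.ofReal_mul, Complex.ofReal_re]
  rw [Real.exp_add]
  have e : Real.exp (-tn n) ^ n * Real.exp (tn n * n) = 1 := by
    rw [mul_comm (tn n), ← Real.exp_nat_mul, ← Real.exp_add]; simp
  have h1 := Real.exp_pos (LP (tn n))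
  have h2 := Real.exp_pos (n * tn n)
  field_simp
  linear_combination (PO n : ℝ) * e


lemma geo_bound {s : ℝ} (hs : 0 < s) (n : ℕ) :
    ∑ l ∈ Finset.range n, Real.exp (-((l + 1 : ℝ) * s)) ≤ 1 / s := by
  have h : ∀ n : ℕ, (Real.exp s - 1) * ∑ l ∈ Finset.range n, Real.exp (-((l + 1 : ℝ) * s)) =
      1 - Real.exp (-(n * s)) := by
    intro n
    induction n with
    | zero => simp
    | succ k ih =>
      rw [Finset.sum_range_succ, mul_add, ih, sub_mul (Real.exp s), ← Real.exp_add]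
      have : s + -((k + 1 : ℝ) * s) = -(k * s) := by ring
      rw [this]; push_cast; ring
  have h1 := Real.add_one_le_exp s
  have h2 := h n
  have h3 := Real.exp_pos (-(n * s))
  have h4 : 0 ≤ ∑ l ∈ Finset.range n, Real.exp (-((l + 1 : ℝ) * s)) :=
    Finset.sum_nonneg fun _ _ => (Real.exp_pos _).le
  rw [le_div_iff₀ hs]
  nlinarith

lemma po_le_exp {t : ℝ} (ht : 0 < t) (M k : ℕ) :
    (po M k : ℝ) ≤ Real.exp (LPM M t) * Real.exp (k * t) := by
  have h := (hasSum_po_real ht M)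
  have h1 := le_hasSum h k (fun j _ => by positivity)
  have e : Real.exp (-t) ^ k * Real.exp (k * t) = 1 := by
    rw [← Real.exp_nat_mul, ← Real.exp_add]; simp
  calc (po M k : ℝ) = (po M k * Real.exp (-t) ^ k) * Real.exp (k * t) := by rw [mul_assoc, e, mul_one]
    _ ≤ _ := by gcongr

lemma LP_gap {t : ℝ} (ht : 0 < t) (M K : ℕ) :
    LPM M t + K * (Real.exp (-((M + K : ℝ) * t)) / 2) ≤ LP t := by
  refine le_trans ?_ (LPM_le_LP ht (M + K))
  unfold LPM
  rw [Finset.sum_range_add]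
  gcongr
  rw [← nsmul_eq_mul]
  have := Finset.card_nsmul_le_sum (Finset.range K) (fun j : ℕ => ff (((M + j : ℕ) + 1 : ℝ) * t))
    (Real.exp (-((M + K : ℝ) * t)) / 2) ?_
  · rwa [Finset.card_range] at this
  intro j hj
  have hj' : (j : ℝ) + 1 ≤ K := by exact_mod_cast Finset.mem_range.1 hj
  set x := (((M + j : ℕ) + 1 : ℝ) * t) with hx
  have hx0 : 0 < x := by positivity
  have h1 : Real.exp (-((M + K : ℝ) * t)) ≤ Real.exp (-x) := by
    apply Real.exp_le_exp.2
    rw [hx]; push_cast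
    nlinarith
  refine le_trans (div_le_div_of_nonneg_right h1 (by norm_num)) ?_
  have h2 := exp_neg_lt_one hx0
  have h3 := Real.exp_pos (-x)
  have h4 := one_sub_exp_sq_pos hx0
  unfold ff
  rw [Real.le_log_iff_exp_le (by positivity)]
  have h5 : Real.exp (-x) ≤ Real.exp (-x) / (1 - Real.exp (-x) ^ 2) := by
    rw [le_div_iff₀ h4]; nlinarith [pow_pos h3 3]
  refine le_trans ?_ (add_le_add le_rfl h5)
  have h6 := Real.abs_exp_sub_one_sub_id_le (x := Real.exp (-x) / 2) (by rw [abs_of_pos (by positivity)]; linarith)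
  have h7 := (abs_le.1 h6).2
  nlinarith

lemma err_bound : ∃ C > (0:ℝ), ∀ t : ℝ, 0 < t → t ≤ 1 → ∀ M n : ℕ, 0 < n → 1 ≤ M * t →
    (pa n : ℝ) - PO n ≤ (n : ℝ) ^ 2 * (Real.exp (LPM M t) * Real.exp (n * t)) +
      C * dl t * Real.exp (LP t) * Real.exp (n * t) * Real.exp (-(3 / 2 * (M * t))) * (1 / t) := by
  obtain ⟨C, hC, h⟩ := PO_le
  refine ⟨C * (Real.exp 2) * 2, by positivity, ?_⟩
  intro t ht ht1 M n hn hM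
  have hd := dl_pos ht
  rw [pa_eq hn]
  push_cast
  rw [add_sub_cancel_left]
  set B1 := Real.exp (LPM M t) * Real.exp (n * t) with hB1
  set B2 := C * dl t * Real.exp (LP t) * Real.exp (n * t) with hB2
  set B3 := B2 * Real.exp 2 * Real.exp (-(3 / 2 * (M * t))) with hB3
  have hB10 : 0 < B1 := by positivity
  have hB20 : 0 < B2 := by positivity
  have hB30 : 0 < B3 := by positivity
  have key : ∀ l ∈ Finset.range n, ∀ d ∈ (Finset.Icc 1 n).filter (fun d => Even d ∧ (l + 1) * d ≤ n),
      ((po l (n - (l + 1) * d) : ℕ) : ℝ) ≤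
        B1 + B3 * Real.exp (-((l + 1 : ℝ) * (t / 2))) * Real.exp (-(((d - 1 : ℕ) + 1 : ℝ) * 1)) := by
    intro l hl d hd
    simp only [Finset.mem_filter, Finset.mem_Icc] at hd
    obtain ⟨⟨hd1, hdn⟩, hde, hle⟩ := hd
    have hd2 : 2 ≤ d := by obtain ⟨r, hr⟩ := hde; omega
    have hcast : ((n - (l + 1) * d : ℕ) : ℝ) = n - (l + 1) * d := by
      rw [Nat.cast_sub hle]; push_cast; ring
    by_cases hlM : l ≤ M
    · have h1 : ((po l (n - (l + 1) * d) : ℕ) : ℝ) ≤ po M (n - (l + 1) * d) := by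
        exact_mod_cast po_mono _ hlM
      have h2 := po_le_exp ht M (n - (l + 1) * d)
      have h3 : Real.exp ((n - (l + 1) * d : ℕ) * t) ≤ Real.exp (n * t) := by
        apply Real.exp_le_exp.2
        gcongr; exact Nat.sub_le _ _
      have h4 : Real.exp (LPM M t) * Real.exp ((n - (l + 1) * d : ℕ) * t) ≤ B1 := by
        rw [hB1]; gcongr
      have : 0 ≤ B3 * Real.exp (-((l + 1 : ℝ) * (t / 2))) * Real.exp (-(((d - 1 : ℕ) + 1 : ℝ) * 1)) := by
        positivity
      linarith
    · push Not at hlM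
      have h1 : ((po l (n - (l + 1) * d) : ℕ) : ℝ) ≤ PO (n - (l + 1) * d) := by
        exact_mod_cast po_le_PO _ _
      have h2 := h t ht ht1 (n - (l + 1) * d)
      have h3 : Real.exp ((n - (l + 1) * d : ℕ) * t) ≤ Real.exp (n * t) * Real.exp 2 * Real.exp (-(3 / 2 * (M * t))) *
          Real.exp (-((l + 1 : ℝ) * (t / 2))) * Real.exp (-(((d - 1 : ℕ) + 1 : ℝ) * 1)) := by
        rw [hcast, ← Real.exp_add, ← Real.exp_add, ← Real.exp_add, ← Real.exp_add]
        apply Real.exp_le_exp.2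
        rw [Nat.cast_sub hd1]; push_cast
        have hl' : (M : ℝ) ≤ l := by exact_mod_cast hlM.le
        have hd' : (2 : ℝ) ≤ d := by exact_mod_cast hd2
        have a1 : (M : ℝ) * t ≤ (l + 1) * t := by gcongr; linarith
        have a2 : ((d : ℝ) - 2) * 1 ≤ (d - 2) * ((l + 1) * t) := by
          apply mul_le_mul_of_nonneg_left <;> linarith
        nlinarith
      have h4 : C * dl t * Real.exp (LP t) * Real.exp ((n - (l + 1) * d : ℕ) * t) ≤
          C * dl t * Real.exp (LP t) * (Real.exp (n * t) * Real.exp 2 * Real.exp (-(3 / 2 * (M * t))) *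
          Real.exp (-((l + 1 : ℝ) * (t / 2))) * Real.exp (-(((d - 1 : ℕ) + 1 : ℝ) * 1))) := by
        gcongr
      calc _ ≤ _ := h1
        _ ≤ _ := h2
        _ ≤ _ := h4
        _ = 0 + B3 * Real.exp (-((l + 1 : ℝ) * (t / 2))) * Real.exp (-(((d - 1 : ℕ) + 1 : ℝ) * 1)) := by
          rw [hB3, hB2]; ring
        _ ≤ _ := by gcongr
  have inner : ∀ l ∈ Finset.range n,
      ∑ d ∈ (Finset.Icc 1 n).filter (fun d => Even d ∧ (l + 1) * d ≤ n), ((po l (n - (l + 1) * d) : ℕ) : ℝ)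
        ≤ n * B1 + B3 * Real.exp (-((l + 1 : ℝ) * (t / 2))) := by
    intro l hl
    refine (Finset.sum_le_sum (key l hl)).trans ?_
    refine (Finset.sum_le_sum_of_subset_of_nonneg (Finset.filter_subset _ _) (fun _ _ _ => by positivity)).trans ?_
    rw [Finset.sum_add_distrib]
    have e1 : ∑ i ∈ Finset.Icc 1 n, Real.exp (-(((i - 1 : ℕ) + 1 : ℝ) * 1)) ≤ 1 := by
      have := geo_bound one_pos n
      rw [div_one] at this
      refine le_trans (le_of_eq ?_) this
      have := Finset.sum_Ico_add' (fun i : ℕ => Real.exp (-(((i - 1 : ℕ) + 1 : ℝ) * 1))) 0 n 1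
      rw [← Finset.range_eq_Ico] at this
      simp only [Nat.add_sub_cancel] at this
      rw [this]; rfl
    have e2 : ∑ _i ∈ Finset.Icc 1 n, B1 = n * B1 := by simp
    rw [e2, ← Finset.mul_sum]
    have : 0 < B3 * Real.exp (-((l + 1 : ℝ) * (t / 2))) := by positivity
    nlinarith
  refine (Finset.sum_le_sum inner).trans ?_
  rw [Finset.sum_add_distrib]
  have g := geo_bound (half_pos ht) n
  have e2 : ∑ _i ∈ Finset.range n, n * B1 = n ^ 2 * B1 := by simp; ring
  rw [e2, ← Finset.mul_sum]
  have : B3 * ∑ i ∈ Finset.range n, Real.exp (-((i + 1 : ℝ) * (t / 2))) ≤ B3 * (1 / (t / 2)) := by gcongr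
  refine add_le_add le_rfl (this.trans (le_of_eq ?_))
  rw [hB3, hB2]; field_simp


noncomputable def uu8 (t : ℝ) : ℝ := Real.exp (-Real.log t / 8)

lemma uu8_pow {t : ℝ} (ht : 0 < t) : uu8 t ^ 8 = 1 / t := by
  unfold uu8
  rw [← Real.exp_nat_mul]
  have : ((8 : ℕ) : ℝ) * (-Real.log t / 8) = -Real.log t := by push_cast; ring
  rw [this, Real.exp_neg, Real.exp_log ht, one_div]

lemma uu8_tendsto : Tendsto uu8 (𝓝[>] 0) atTop := by
  refine Real.tendsto_exp_atTop.comp ?_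
  exact (tendsto_neg_atBot_atTop.comp Real.tendsto_log_nhdsGT_zero).atTop_div_const (by norm_num)

lemma dl_uu8 {t : ℝ} (ht : 0 < t) : dl t * uu8 t ^ 12 = 1 := by
  have h : 0 < dl t * uu8 t ^ 12 := mul_pos (dl_pos ht) (pow_pos (Real.exp_pos _) _)
  have h2 : (dl t * uu8 t ^ 12) ^ 2 = 1 := by
    have : (dl t * uu8 t ^ 12) ^ 2 = dl t ^ 2 * (uu8 t ^ 8) ^ 3 := by ring
    rw [this, uu8_pow ht, dl_sq ht]; field_simp
  nlinarith

lemma choose_M {t : ℝ} (ht : 0 < t) (ht2 : t ≤ 1 / 2) (hlog : 4 ≤ -Real.log t) :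
    ∃ M : ℕ, 1 ≤ M * t ∧ Real.exp (-(3 / 2 * (M * t))) ≤ 1 / uu8 t ^ 9 ∧
      LPM M t + Real.exp (-2) / 8 * uu8 t ^ 2 ≤ LP t := by
  set w := -Real.log t with hw
  have hu : uu8 t = Real.exp (w / 8) := rfl
  have hM1 : 3 / 4 * w / t ≤ (⌈3 / 4 * w / t⌉₊ : ℝ) := Nat.le_ceil _
  have hM2 : (⌈3 / 4 * w / t⌉₊ : ℝ) < 3 / 4 * w / t + 1 := Nat.ceil_lt_add_one (by positivity)
  set M := ⌈3 / 4 * w / t⌉₊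
  rw [div_le_iff₀ ht] at hM1
  have hM3 : (M : ℝ) * t ≤ 3 / 4 * w + 1 := by
    have : (M : ℝ) * t ≤ (3 / 4 * w / t + 1) * t := by gcongr
    rw [add_mul, div_mul_cancel₀ _ ht.ne'] at this
    linarith
  refine ⟨M, by linarith, ?_, ?_⟩
  · rw [hu, ← Real.exp_nat_mul, one_div, ← Real.exp_neg]
    apply Real.exp_le_exp.2
    push_cast; linarith
  · have hK1 : (⌊1 / t⌋₊ : ℝ) ≤ 1 / t := Nat.floor_le (by positivity)
    have hK2 : 1 / t < ⌊1 / t⌋₊ + 1 := Nat.lt_floor_add_one _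
    have g := LP_gap ht M ⌊1 / t⌋₊
    set K := ⌊1 / t⌋₊
    have hK3 : (K : ℝ) * t ≤ 1 := by rwa [le_div_iff₀ ht] at hK1
    have hK4 : 1 / t / 2 ≤ K := by
      have : 2 ≤ 1 / t := by rw [le_div_iff₀ ht]; linarith
      linarith
    refine le_trans ?_ g
    have e : Real.exp (-2) / 8 * uu8 t ^ 2 ≤ 1 / t / 2 * (Real.exp (-(3 / 4 * w + 2)) / 2) := by
      rw [← uu8_pow ht]
      have : Real.exp (-(3 / 4 * w + 2)) * uu8 t ^ 6 = Real.exp (-2) := by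
        rw [hu, ← Real.exp_nat_mul, ← Real.exp_add]; congr 1; push_cast; ring
      rw [← this]
      have h0 : 0 < Real.exp (-(3 / 4 * w + 2)) * uu8 t ^ 8 := by
        rw [hu]; positivity
      nlinarith
    have e2 : 1 / t / 2 * (Real.exp (-(3 / 4 * w + 2)) / 2) ≤ K * (Real.exp (-((M + K : ℝ) * t)) / 2) := by
      gcongr
      rw [add_mul]; linarith
    linarith

lemma err_lim : Tendsto (fun n : ℕ => ((pa n : ℝ) - PO n) / (dl (tn n) * Real.exp (LP (tn n) + n * tn n)))
    atTop (𝓝 0) := by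
  obtain ⟨C, hC, h⟩ := err_bound
  have hc : 0 < Real.exp (-2) / 8 := by positivity
  set c := Real.exp (-2) / 8 with hcdef
  have b1 := tendsto_rpow_mul_exp_neg_mul_atTop_nhds_zero 44 c hc
  have b2 : Tendsto (fun u : ℝ => AA ^ 2 * (u ^ (44 : ℝ) * Real.exp (-c * u)) + C * u⁻¹) atTop
      (𝓝 (AA ^ 2 * 0 + C * 0)) := (b1.const_mul _).add (tendsto_inv_atTop_zero.const_mul _)
  have b3 := b2.comp (uu8_tendsto.comp tn_tendsto)
  rw [mul_zero, mul_zero, add_zero] at b3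
  refine squeeze_zero' ?_ ?_ b3
  · filter_upwards [eventually_gt_atTop 0] with n hn
    have h1 : (PO n : ℝ) ≤ pa n := by
      exact_mod_cast (pa_eq hn) ▸ Nat.le_add_right _ _
    have := dl_pos (tn_pos hn)
    apply div_nonneg (by linarith); positivity
  · have ev1 : ∀ᶠ t : ℝ in 𝓝[>] 0, t ≤ 1 / 2 :=
      mem_nhdsWithin_of_mem_nhds (Iic_mem_nhds (by norm_num))
    have ev2 : ∀ᶠ t : ℝ in 𝓝[>] 0, 4 ≤ -Real.log t :=
      (tendsto_neg_atBot_atTop.comp Real.tendsto_log_nhdsGT_zero).eventually_ge_atTop 4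
    have ev3 := uu8_tendsto.eventually_ge_atTop 1
    filter_upwards [eventually_gt_atTop 0, tn_tendsto.eventually ev1, tn_tendsto.eventually ev2,
      tn_tendsto.eventually ev3] with n hn h1 h2 h3
    have ht := tn_pos hn
    have hsq := tn_sq hn
    simp only [Function.comp]
    set t := tn n
    obtain ⟨M, m1, m2, m3⟩ := choose_M ht h1 h2
    have hb := h t ht (by linarith) M n hn m1
    have hd := dl_pos ht
    have hdu := dl_uu8 ht
    have hu8 := uu8_pow ht
    set u := uu8 t
    have hu0 : 0 < u := by linarith
    have hE := Real.exp_pos (LP t)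
    have hn' : (n : ℝ) = AA * u ^ 16 := by
      rw [← hsq]
      have : u ^ 16 = (u ^ 8) ^ 2 := by ring
      rw [this, hu8]; field_simp
    rw [Real.exp_add, div_le_iff₀ (by positivity)]
    refine hb.trans ?_
    have r44 : u ^ (44 : ℝ) = u ^ 44 := by exact_mod_cast Real.rpow_natCast u 44
    rw [r44, add_mul]
    have i1 : Real.exp (LPM M t) ≤ Real.exp (LP t) * Real.exp (-c * u) := by
      rw [← Real.exp_add]; apply Real.exp_le_exp.2
      have : c * u ≤ c * u ^ 2 := by gcongr; nlinarith
      rw [← hcdef] at m3; linarith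
    apply add_le_add
    · calc (n : ℝ) ^ 2 * (Real.exp (LPM M t) * Real.exp (n * t))
          ≤ (n : ℝ) ^ 2 * ((Real.exp (LP t) * Real.exp (-c * u)) * Real.exp (n * t)) := by gcongr
        _ = (AA * u ^ 16) ^ 2 * ((Real.exp (LP t) * Real.exp (-c * u)) * Real.exp (n * t)) * (dl t * u ^ 12) := by
            rw [hdu, ← hn', mul_one]
        _ = _ := by ring
    · calc C * dl t * Real.exp (LP t) * Real.exp (n * t) * Real.exp (-(3 / 2 * (M * t))) * (1 / t)
          ≤ C * dl t * Real.exp (LP t) * Real.exp (n * t) * (1 / u ^ 9) * (1 / t) := by gcongr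
        _ = _ := by rw [← hu8]; field_simp

theorem pa_lim : Tendsto (fun n : ℕ => (pa n : ℝ) / (dl (tn n) * Real.exp (LP (tn n) + n * tn n))) atTop
    (𝓝 (Real.sqrt (Real.pi / AA) / (2 * Real.pi))) := by
  have := PO_lim.add err_lim
  rw [add_zero] at this
  refine this.congr fun n => ?_
  rw [← add_div]; congr 1; ring

theorem pa_asymptotic (A : ℝ)
    (hA : A = Real.pi ^ 2 / 12 + 2 * Real.log ((1 + Real.sqrt 5) / 2) ^ 2) :
    Tendsto (fun n : ℕ => (pa n : ℝ) /
        (Real.sqrt A / (2 * Real.pi * n) * Real.exp (2 * Real.sqrt (A * n))))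
      atTop (𝓝 1) := by
  have hAA : A = AA := hA
  subst hAA
  clear hA
  have hpi := Real.pi_pos
  have hA := AA_pos
  have h1 := (Real.continuous_exp.tendsto 0).comp (LP_asymp.comp tn_tendsto)
  rw [Real.exp_zero] at h1
  have h2 := (pa_lim.mul h1).mul_const (2 * Real.pi / Real.sqrt (Real.pi / AA))
  have e : Real.sqrt (Real.pi / AA) / (2 * Real.pi) * 1 * (2 * Real.pi / Real.sqrt (Real.pi / AA)) = 1 := by
    have : 0 < Real.sqrt (Real.pi / AA) := by positivity
    field_simp
  rw [e] at h2
  refine h2.congr' ?_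
  filter_upwards [eventually_gt_atTop 0] with n hn
  have ht := tn_pos hn
  have hsq := tn_sq hn
  have hn0 : (0 : ℝ) < n := by exact_mod_cast hn
  simp only [Function.comp]
  set t := tn n
  have hs : Real.sqrt (AA * n) = AA / t := by
    rw [← hsq]
    have : AA * (AA / t ^ 2) = (AA / t) ^ 2 := by ring
    rw [this, Real.sqrt_sq (by positivity)]
  have hnt : n * t = AA / t := by rw [← hsq]; field_simp
  have hl : Real.exp (Real.log (t / Real.pi) / 2) = Real.sqrt t / Real.sqrt Real.pi := by
    rw [← Real.sqrt_div ht.le, Real.sqrt_eq_rpow, Real.rpow_def_of_pos (by positivity)]; congr 1; ring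
  have hexp : Real.exp (LP t - AA / t - Real.log (t / Real.pi) / 2) =
      Real.exp (LP t + n * t) / (Real.exp (2 * (AA / t)) * (Real.sqrt t / Real.sqrt Real.pi)) := by
    rw [← hl, ← Real.exp_add, ← Real.exp_sub, hnt]; congr 1; ring
  rw [hs, hexp, Real.sqrt_div hpi.le, dl, ← hsq]
  have q1 := Real.exp_pos (LP t + AA / t ^ 2 * t)
  have q2 := Real.exp_pos (2 * (AA / t))
  have r1 : 0 < Real.sqrt t := by positivity
  have r2 : 0 < Real.sqrt Real.pi := by positivity
  have r3 : 0 < Real.sqrt AA := by positivity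
  have s1 : Real.sqrt t ^ 2 = t := Real.sq_sqrt ht.le
  have s3 : Real.sqrt AA ^ 2 = AA := Real.sq_sqrt hA.le
  set E1 := Real.exp (LP t + AA / t ^ 2 * t)
  set E2 := Real.exp (2 * (AA / t))
  have : pa n / (t * Real.sqrt t * E1) * (E1 / (E2 * (Real.sqrt t / Real.sqrt Real.pi))) * (2 * Real.pi / (Real.sqrt Real.pi / Real.sqrt AA))
     = pa n * (2 * Real.pi * Real.sqrt AA) / (t * Real.sqrt t ^ 2 * E2) := by
    field_simp
  rw [this, s1]
  have : pa n / (Real.sqrt AA / (2 * Real.pi * (AA / t ^ 2)) * E2) = pa n * (2 * Real.pi * (Real.sqrt AA ^ 2)) / (t ^ 2 * Real.sqrt AA * E2) := by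
    rw [s3]; field_simp
  rw [this]; field_simp
end

section
/- For |q| < 1 (q real or complex), the generating function identity ∑_{n≥1} pa(n) q^n = ∑_{n≥1} (q^n/(1−q^n)) ∏_{k=1}^{n−1} (1 + q^k/(1−q^{2k})) holds. -/
/-- Allowed steps: equal or an odd increase. -/
def PAStep (a b : ℕ) : Prop := ∃ m : ℕ, b = a + (2 * m - 1)

lemma paStep_shift (c a b : ℕ) : PAStep (a + c) (b + c) ↔ PAStep a b := by
  unfold PAStep
  constructor <;> rintro ⟨m, h⟩ <;> exact ⟨m, by omega⟩

lemma paStep_le {a b : ℕ} (h : PAStep a b) : a ≤ b := by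
  obtain ⟨m, h⟩ := h
  omega

lemma chain_shift (c : ℕ) (l : List ℕ) :
    List.IsChain PAStep (c :: l.map (· + c)) ↔ List.IsChain PAStep (0 :: l) := by
  have h : c :: l.map (· + c) = (0 :: l).map (· + c) := by simp
  rw [h, List.isChain_map]
  simp only [paStep_shift]

lemma chain_le {l : List ℕ} (h : List.IsChain PAStep l) : l.Pairwise (· ≤ ·) := by
  rw [← List.isChain_iff_pairwise]
  exact h.imp (fun _ _ => paStep_le)

lemma chain_unshift {c : ℕ} {l : List ℕ} (h : List.IsChain PAStep (c :: l)) :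
    (l.map (· - c)).map (· + c) = l := by
  have h1 := (List.pairwise_cons.1 (chain_le h)).1
  rw [List.map_map]
  conv_rhs => rw [← List.map_id l]
  apply List.map_congr_left
  intro a ha
  have := h1 a ha
  simp
  omega

lemma sum_shift (c : ℕ) (l : List ℕ) :
    (c :: l.map (· + c)).sum = (l.length + 1) * c + l.sum := by
  rw [List.sum_cons, List.sum_map_add]
  simp
  ring

/-- Lists of length `N` whose chain from `0` makes allowed steps. -/
abbrev BL (N : ℕ) := {l : List ℕ // l.length = N ∧ List.IsChain PAStep (0 :: l)}

/-- Nonempty increasing lists of positive numbers with allowed steps. -/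
abbrev SL := {l : List ℕ // l ≠ [] ∧ List.IsChain PAStep l ∧ ∀ x ∈ l, 0 < x}

/-- Adding one smallest element. -/
def extB (N : ℕ) (x : ℕ × BL N) : BL (N + 1) :=
  ⟨(2 * x.1 - 1) :: x.2.1.map (· + (2 * x.1 - 1)), by simp [x.2.2.1], by
    rw [List.isChain_cons_cons, chain_shift]
    exact ⟨⟨x.1, by simp⟩, x.2.2.2⟩⟩

lemma extB_bij (N : ℕ) : Function.Bijective (extB N) := by
  constructor
  · rintro ⟨m, b, hb⟩ ⟨m', b', hb'⟩ h
    simp only [extB, Subtype.mk.injEq, List.cons.injEq] at h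
    obtain ⟨h1, h2⟩ := h
    have hm : m = m' := by omega
    subst hm
    have := (List.map_injective_iff.2 (add_left_injective (2 * m - 1))) h2
    subst this
    rfl
  · rintro ⟨l, hl, hc⟩
    match l, hl, hc with
    | c :: t, hl, hc =>
      rw [List.isChain_cons_cons] at hc
      obtain ⟨⟨m, hm⟩, hc⟩ := hc
      have hu := chain_unshift hc
      refine ⟨(m, ⟨t.map (· - c), by simpa using hl, ?_⟩), ?_⟩
      · rw [← chain_shift c, hu]
        exact hc
      · have hm' : 2 * m - 1 = c := by omega
        simp only [extB, hm', hu]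

/-- Adding one smallest positive element. -/
def extA (N : ℕ) (x : ℕ × BL N) : {s : SL // s.1.length - 1 = N} :=
  ⟨⟨(x.1 + 1) :: x.2.1.map (· + (x.1 + 1)), by simp, (chain_shift _ _).2 x.2.2.2, by
    intro y hy
    simp only [List.mem_cons, List.mem_map] at hy
    rcases hy with h | ⟨a, _, h⟩ <;> omega⟩, by simp [x.2.2.1]⟩

lemma extA_bij (N : ℕ) : Function.Bijective (extA N) := by
  constructor
  · rintro ⟨m, b, hb⟩ ⟨m', b', hb'⟩ h
    simp only [extA, Subtype.mk.injEq, List.cons.injEq] at h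
    obtain ⟨h1, h2⟩ := h
    have hm : m = m' := by omega
    subst hm
    have := (List.map_injective_iff.2 (add_left_injective (m + 1))) h2
    subst this
    rfl
  · rintro ⟨⟨l, hne, hc, hp⟩, hl⟩
    match l, hne, hc, hp, hl with
    | c :: t, hne, hc, hp, hl =>
      have hu := chain_unshift hc
      have hc0 : 0 < c := hp c (by simp)
      refine ⟨(c - 1, ⟨t.map (· - c), by simpa using hl, ?_⟩), ?_⟩
      · rw [← chain_shift c, hu]
        exact hc
      · have hm' : c - 1 + 1 = c := by omega
        simp only [extA, hm', hu]

section GF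
variable {K : Type*} [RCLike K]

lemma norm_pow_lt (q : K) (hq : ‖q‖ < 1) (N : ℕ) : ‖q ^ (N + 1)‖ < 1 := by
  rw [norm_pow]
  exact pow_lt_one₀ (norm_nonneg _) hq (by omega)

lemma hasSum_odd (r : K) (hr : ‖r‖ < 1) :
    HasSum (fun m : ℕ => r ^ (2 * m - 1)) (1 + r / (1 - r ^ 2)) := by
  have h2 : ‖r ^ 2‖ < 1 := norm_pow_lt r hr 1
  have h := ((hasSum_geometric_of_norm_lt_one h2).mul_left r)
  have h3 : HasSum (fun m : ℕ => r ^ (2 * (m + 1) - 1)) (r / (1 - r ^ 2)) := by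
    rw [div_eq_mul_inv]
    have e : (fun m : ℕ => r ^ (2 * (m + 1) - 1)) = fun m : ℕ => r * (r ^ 2) ^ m := by
      funext m
      rw [← pow_mul, show 2 * (m + 1) - 1 = 2 * m + 1 by omega]
      ring
    rw [e]
    exact h
  simpa using h3.zero_add (f := fun m : ℕ => r ^ (2 * m - 1))

lemma hasSum_pos (r : K) (hr : ‖r‖ < 1) :
    HasSum (fun m : ℕ => r ^ (m + 1)) (r / (1 - r)) := by
  have h := ((hasSum_geometric_of_norm_lt_one hr).mul_left r)
  rw [div_eq_mul_inv]
  have e : (fun m : ℕ => r ^ (m + 1)) = fun m : ℕ => r * r ^ m := by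
    funext m
    ring
  rw [e]
  exact h

lemma hasSum_B (q : K) (hq : ‖q‖ < 1) (N : ℕ) :
    HasSum (fun b : BL N => q ^ b.1.sum)
      (∏ k ∈ Finset.Icc 1 N, (1 + q ^ k / (1 - q ^ (2 * k)))) ∧
    Summable (fun b : BL N => ‖q ^ b.1.sum‖) := by
  induction N with
  | zero =>
    have : Unique (BL 0) :=
      { default := ⟨[], by simp⟩
        uniq := fun a => Subtype.ext (List.length_eq_zero_iff.1 a.2.1) }
    have hd : (default : BL 0).1 = [] := List.length_eq_zero_iff.1 (default : BL 0).2.1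
    constructor
    · have := hasSum_unique (fun b : BL 0 => q ^ b.1.sum)
      simpa [hd] using this
    · exact (hasSum_unique _).summable
  | succ N ih =>
    obtain ⟨ih1, ih2⟩ := ih
    have hr := norm_pow_lt q hq N
    have h1 := hasSum_odd _ hr
    have h1n : Summable (fun m : ℕ => ‖(q ^ (N + 1)) ^ (2 * m - 1)‖) := by
      have := (hasSum_odd (K := ℝ) ‖q ^ (N + 1)‖ (by simpa using hr)).summable
      simpa only [norm_pow] using this
    have hs := summable_mul_of_summable_norm h1n ih2
    have hsn : Summable (fun x : ℕ × BL N =>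
        ‖(q ^ (N + 1)) ^ (2 * x.1 - 1) * q ^ x.2.1.sum‖) := by
      simp only [norm_mul]
      exact h1n.mul_of_nonneg ih2 (fun _ => norm_nonneg _) (fun _ => norm_nonneg _)
    have hm := h1.mul ih1 hs
    have he : ∀ x : ℕ × BL N, (q ^ (N + 1)) ^ (2 * x.1 - 1) * q ^ x.2.1.sum =
        q ^ (extB N x).1.sum := by
      intro x
      rw [extB, sum_shift, x.2.2.1, pow_add q (_ * _), pow_mul]
    simp only [he] at hm hsn
    rw [Finset.prod_Icc_succ_top (by omega), mul_comm, mul_comm 2 (N + 1), pow_mul q (N + 1) 2]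
    exact ⟨((Equiv.ofBijective _ (extB_bij N)).hasSum_iff
        (f := fun b : BL (N + 1) => q ^ b.1.sum)).1 hm,
      ((Equiv.ofBijective _ (extB_bij N)).summable_iff
        (f := fun b : BL (N + 1) => ‖q ^ b.1.sum‖)).1 hsn⟩

lemma hasSum_A_aux (r : K) (hr : ‖r‖ < 1) {ι : Type*} (g : ι → K) (G : K)
    (h : HasSum g G) (hn : Summable (fun i => ‖g i‖)) :
    HasSum (fun x : ℕ × ι => r ^ (x.1 + 1) * g x.2) (r / (1 - r) * G) := by
  have h1 := hasSum_pos r hr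
  have h1n : Summable (fun m : ℕ => ‖r ^ (m + 1)‖) := by
    have h2 := (hasSum_pos (K := ℝ) ‖r‖ (by rwa [norm_norm])).summable
    have e : (fun m : ℕ => ‖r ^ (m + 1)‖) = fun m : ℕ => ‖r‖ ^ (m + 1) := by
      funext m
      exact norm_pow _ _
    rw [e]
    exact h2
  exact h1.mul h (summable_mul_of_summable_norm (f := fun m : ℕ => r ^ (m + 1)) h1n hn)

lemma hasSum_A (q : K) (hq : ‖q‖ < 1) (N : ℕ) :
    HasSum (fun s : {s : SL // s.1.length - 1 = N} => q ^ s.1.1.sum)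
      (q ^ (N + 1) / (1 - q ^ (N + 1)) *
        ∏ k ∈ Finset.Icc 1 N, (1 + q ^ k / (1 - q ^ (2 * k)))) := by
  have hm := hasSum_A_aux (q ^ (N + 1)) (norm_pow_lt q hq N) _ _
    (hasSum_B q hq N).1 (hasSum_B q hq N).2
  have he : ∀ x : ℕ × BL N, (q ^ (N + 1)) ^ (x.1 + 1) * q ^ x.2.1.sum =
      q ^ (extA N x).1.1.sum := by
    intro x
    rw [extA, sum_shift, x.2.2.1, pow_add q (_ * _), pow_mul]
  simp only [he] at hm
  exact ((Equiv.ofBijective _ (extA_bij N)).hasSum_iff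
        (f := fun s : {s : SL // s.1.length - 1 = N} => q ^ s.1.1.sum)).1 hm

end GF

lemma summable_G (x : ℝ) (h0 : 0 ≤ x) (h1 : x < 1) :
    Summable (fun N : ℕ => x ^ (N + 1) / (1 - x ^ (N + 1)) *
        ∏ k ∈ Finset.Icc 1 N, (1 + x ^ k / (1 - x ^ (2 * k)))) := by
  have hpow : ∀ k : ℕ, 1 ≤ k → x ^ k ≤ x := fun k hk =>
    pow_le_of_le_one h0 h1.le (by omega)
  have hterm : ∀ j k : ℕ, 1 ≤ j → x ^ k / (1 - x ^ j) ≤ x ^ k / (1 - x) := by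
    intro j k hj
    have := hpow j hj
    have hk := pow_nonneg h0 k
    exact div_le_div_of_nonneg_left hk (by linarith) (by linarith)
  have hnn : ∀ j k : ℕ, 1 ≤ j → 0 ≤ x ^ k / (1 - x ^ j) := by
    intro j k hj
    have := hpow j hj
    exact div_nonneg (pow_nonneg h0 k) (by linarith)
  have hgeo : Summable (fun k : ℕ => x ^ k / (1 - x)) :=
    (summable_geometric_of_lt_one h0 h1).div_const _
  have hbound : ∀ N : ℕ, ∏ k ∈ Finset.Icc 1 N, (1 + x ^ k / (1 - x ^ (2 * k))) ≤
      Real.exp (∑' k : ℕ, x ^ k / (1 - x)) := by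
    intro N
    have hn : ∀ k : ℕ, 0 ≤ x ^ k / (1 - x) := fun k =>
      div_nonneg (pow_nonneg h0 k) (by linarith)
    calc _ ≤ ∏ k ∈ Finset.Icc 1 N, (1 + x ^ k / (1 - x)) := by
            apply Finset.prod_le_prod
            · intro k hk
              have := hnn (2 * k) k (by have := (Finset.mem_Icc.1 hk).1; omega)
              linarith
            · intro k hk
              have := hterm (2 * k) k (by have := (Finset.mem_Icc.1 hk).1; omega)
              linarith
      _ ≤ Real.exp (∑ k ∈ Finset.Icc 1 N, x ^ k / (1 - x)) :=
            Real.prod_one_add_le_exp_sum _ (fun k => hn k)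
      _ ≤ _ := Real.exp_le_exp.2 (hgeo.sum_le_tsum _ (fun k _ => hn k))
  have hprod : ∀ N : ℕ, 0 ≤ ∏ k ∈ Finset.Icc 1 N, (1 + x ^ k / (1 - x ^ (2 * k))) := by
    intro N
    apply Finset.prod_nonneg
    intro k hk
    have := hnn (2 * k) k (by have := (Finset.mem_Icc.1 hk).1; omega)
    linarith
  refine Summable.of_nonneg_of_le (fun N => mul_nonneg (hnn _ _ (by omega)) (hprod N))
    (fun N => ?_) (((summable_nat_add_iff 1).2 hgeo).mul_right
      (Real.exp (∑' k : ℕ, x ^ k / (1 - x))))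
  exact mul_le_mul (hterm _ _ (by omega)) (hbound N) (hprod N)
    (div_nonneg (pow_nonneg h0 _) (by linarith))

lemma summable_S (q : ℂ) (hq : ‖q‖ < 1) : Summable (fun s : SL => q ^ s.1.sum) := by
  apply Summable.of_norm
  simp only [norm_pow]
  have hq' : ‖(‖q‖ : ℝ)‖ < 1 := by simpa using hq
  rw [← (Equiv.sigmaFiberEquiv (fun s : SL => s.1.length - 1)).summable_iff,
    summable_sigma_of_nonneg (fun _ => by simp only [Function.comp]; positivity)]
  refine ⟨fun N => (hasSum_A (K := ℝ) ‖q‖ hq' N).summable, ?_⟩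
  convert summable_G ‖q‖ (norm_nonneg _) hq using 2 with N
  exact (hasSum_A (K := ℝ) ‖q‖ hq' N).tsum_eq

lemma chain_iff {l : List ℕ} (hl : l.Pairwise (· ≤ ·)) : List.IsChain PAStep l ↔
    ∀ a ∈ l, ∀ b ∈ l, a < b → (∀ c ∈ l, ¬(a < c ∧ c < b)) → (Odd a ↔ Even b) := by
  induction l with
  | nil => simp
  | cons x t ih =>
    cases t with
    | nil => simp
    | cons y t =>
      have hx := (List.pairwise_cons.1 hl).1
      have ht := (List.pairwise_cons.1 hl).2
      have hy : ∀ a ∈ y :: t, y ≤ a := by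
        intro a ha
        rcases List.mem_cons.1 ha with rfl | ha
        · exact le_rfl
        · exact (List.pairwise_cons.1 ht).1 a ha
      have hxy := hx y (by simp)
      rw [List.isChain_cons_cons, ih ht]
      constructor
      · rintro ⟨⟨m, hm⟩, h⟩ a ha b hb hab hn
        have hn' : ∀ c ∈ y :: t, ¬(a < c ∧ c < b) := fun c hc => hn c (List.mem_cons_of_mem _ hc)
        rcases List.mem_cons.1 hb with rfl | hb'
        · rcases List.mem_cons.1 ha with rfl | ha
          · omega
          · have := hx a ha
            omega
        · rcases List.mem_cons.1 ha with rfl | ha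
          · rcases hxy.eq_or_lt with he | hlt
            · exact h a (by simp [he]) b hb' hab hn'
            · have h1 := hn' y (by simp)
              have h2 := hy b hb'
              have : b = y := by omega
              subst this
              rw [Nat.odd_iff, Nat.even_iff]
              omega
          · exact h a ha b hb' hab hn'
      · intro h
        constructor
        · rcases hxy.eq_or_lt with he | hlt
          · exact ⟨0, by omega⟩
          · have := h x (by simp) y (by simp) hlt (by
              intro c hc
              rcases List.mem_cons.1 hc with rfl | hc
              · omega
              · have := hy c hc
                omega)
            rw [Nat.odd_iff, Nat.even_iff] at this
            exact ⟨(y - x + 1) / 2, by omega⟩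
        · intro a ha b hb hab hn
          refine h a (List.mem_cons_of_mem _ ha) b (List.mem_cons_of_mem _ hb) hab ?_
          intro c hc
          rcases List.mem_cons.1 hc with rfl | hc
          · have := hx a ha
            omega
          · exact hn c hc

/-- The partition attached to a list. -/
def toPart (n : ℕ) (s : {s : SL // s.1.sum - 1 = n}) :
    {p : (n + 1).Partition // ParityAlternating p} :=
  ⟨⟨(s.1.1 : Multiset ℕ), fun {i} hi => s.1.2.2.2 i (by simpa using hi), by
    have h1 := s.2
    have h2 : 0 < s.1.1.sum := List.sum_pos _ s.1.2.2.2 s.1.2.1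
    rw [Multiset.sum_coe]
    omega⟩, by
      have := (chain_iff (chain_le s.1.2.2.1)).1 s.1.2.2.1
      simpa only [ParityAlternating, Multiset.mem_coe] using this⟩

lemma toPart_bij (n : ℕ) : Function.Bijective (toPart n) := by
  constructor
  · rintro ⟨⟨l, h1, h2, h3⟩, h4⟩ ⟨⟨l', h1', h2', h3'⟩, h4'⟩ h
    simp only [toPart, Subtype.mk.injEq, Nat.Partition.mk.injEq, Multiset.coe_eq_coe] at h
    have := List.Perm.eq_of_pairwise (fun a b _ _ h h' => le_antisymm h h')
      (chain_le h2) (chain_le h2') h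
    subst this
    rfl
  · rintro ⟨⟨m, hpos, hsum⟩, hp⟩
    have hs : ((m.sort (· ≤ ·) : List ℕ) : Multiset ℕ) = m := Multiset.sort_eq _ _
    have hsum' : (m.sort (· ≤ ·)).sum = n + 1 := by rw [← Multiset.sum_coe, hs, hsum]
    refine ⟨⟨⟨m.sort (· ≤ ·), ?_, ?_, ?_⟩, ?_⟩, ?_⟩
    · intro h
      rw [h] at hsum'
      simp at hsum'
    · rw [chain_iff (Multiset.pairwise_sort _ _)]
      simpa only [Multiset.mem_sort, ParityAlternating] using hp
    · intro x hx
      exact hpos ((Multiset.mem_sort _).1 hx)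
    · simp only [hsum']
      omega
    · simp only [toPart, hs]

lemma tsum_fiber {α : Type*} (f : α → ℂ) (g : α → ℕ) (hf : Summable f) :
    ∑' a, f a = ∑' n : ℕ, ∑' x : {a // g a = n}, f x.1 := by
  have h1 := (Equiv.sigmaFiberEquiv g).summable_iff.2 hf
  have h2 := (Equiv.sigmaFiberEquiv g).tsum_eq f
  rw [← h2]
  exact h1.tsum_sigma

theorem pa_generating_function (q : ℂ) (hq : ‖q‖ < 1) :
    ∑' n : ℕ, (pa (n + 1) : ℂ) * q ^ (n + 1) =
      ∑' n : ℕ, q ^ (n + 1) / (1 - q ^ (n + 1)) *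
        ∏ k ∈ Finset.Icc 1 n, (1 + q ^ k / (1 - q ^ (2 * k))) := by
  have hS := summable_S q hq
  have hL := tsum_fiber _ (fun s : SL => s.1.length - 1) hS
  have hR := tsum_fiber _ (fun s : SL => s.1.sum - 1) hS
  have hL' := tsum_congr (L := .unconditional _) fun N => (hasSum_A q hq N).tsum_eq
  refine Eq.trans ?_ (hR.symm.trans (hL.trans hL'))
  refine tsum_congr fun n => ?_
  have hc : ∀ s : {s : SL // s.1.sum - 1 = n}, q ^ s.1.1.sum = q ^ (n + 1) := by
    intro s
    have h1 := s.2
    have h2 : 0 < s.1.1.sum := List.sum_pos _ s.1.2.2.2 s.1.2.1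
    have h3 : s.1.1.sum = n + 1 := by omega
    rw [h3]
  have hd := tsum_congr (L := .unconditional _) hc
  rw [tsum_const, Nat.card_eq_of_bijective _ (toPart_bij n), nsmul_eq_mul] at hd
  exact hd.symm
end

section
/- As ε → 0^+, the infinite product ∏_{k≥1} (1 + e^{−kε} − e^{−2kε}) is asymptotically equal to e^{(2/ε)(log((1+√5)/2))²}; that is, the ratio of the two sides tends to 1 as ε → 0^+. -/
open Filter Topology

noncomputable def auF (x : ℝ) : ℝ := Real.log (1 + Real.exp (-x) - Real.exp (-x) ^ 2)
noncomputable def auF1 (x : ℝ) : ℝ :=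
  -(Real.exp (-x) - 2 * Real.exp (-x) ^ 2) / (1 + Real.exp (-x) - Real.exp (-x) ^ 2)
noncomputable def auF2 (x : ℝ) : ℝ :=
  Real.exp (-x) * (1 - 4 * Real.exp (-x) - Real.exp (-x) ^ 2) /
    (1 + Real.exp (-x) - Real.exp (-x) ^ 2) ^ 2

lemma au_exp_le {x : ℝ} (hx : 0 ≤ x) : Real.exp (-x) ≤ 1 := by
  rw [Real.exp_le_one_iff]; linarith

lemma au_one_le {x : ℝ} (hx : 0 ≤ x) : 1 ≤ 1 + Real.exp (-x) - Real.exp (-x) ^ 2 := by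
  have h1 := au_exp_le hx
  have h2 := Real.exp_pos (-x)
  nlinarith

lemma auF_nonneg {x : ℝ} (hx : 0 ≤ x) : 0 ≤ auF x := Real.log_nonneg (au_one_le hx)

lemma auF_le {x : ℝ} (hx : 0 ≤ x) : auF x ≤ Real.exp (-x) := by
  have h := Real.log_le_sub_one_of_pos (lt_of_lt_of_le one_pos (au_one_le hx))
  unfold auF
  nlinarith [sq_nonneg (Real.exp (-x))]

lemma au_hasDerivAt_exp (x : ℝ) : HasDerivAt (fun x : ℝ => Real.exp (-x)) (-Real.exp (-x)) x := by
  simpa using (hasDerivAt_neg x).exp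

lemma auF_hasDerivAt {x : ℝ} (hx : 0 ≤ x) : HasDerivAt auF (auF1 x) x := by
  have h0 := au_one_le hx
  have he := au_hasDerivAt_exp x
  have h := ((he.const_add 1).sub (he.pow 2)).log (by simp; linarith)
  refine h.congr_deriv ?_
  simp [auF1]
  ring

lemma auF1_hasDerivAt {x : ℝ} (hx : 0 ≤ x) : HasDerivAt auF1 (auF2 x) x := by
  have h0 := au_one_le hx
  have he := au_hasDerivAt_exp x
  have h := ((he.sub ((he.pow 2).const_mul 2)).neg).div ((he.const_add 1).sub (he.pow 2))
    (by simp; linarith)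
  refine h.congr_deriv ?_
  simp [auF2]
  congr 1
  ring

lemma auF2_bound {x : ℝ} (hx : 0 ≤ x) : |auF2 x| ≤ 4 * Real.exp (-x) := by
  have h0 := au_one_le hx
  have h1 := au_exp_le hx
  have h2 := Real.exp_pos (-x)
  unfold auF2
  rw [abs_div, abs_mul, abs_of_pos h2]
  have h3 : 1 ≤ |(1 + Real.exp (-x) - Real.exp (-x) ^ 2) ^ 2| := by
    rw [abs_of_nonneg (sq_nonneg _)]; nlinarith
  have h4 : |1 - 4 * Real.exp (-x) - Real.exp (-x) ^ 2| ≤ 4 := by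
    rw [abs_le]; constructor <;> nlinarith
  rw [div_le_iff₀ (by linarith)]
  have : 4 * Real.exp (-x) * 1 ≤ 4 * Real.exp (-x) * |(1 + Real.exp (-x) - Real.exp (-x) ^ 2) ^ 2| := by
    gcongr
  nlinarith

lemma auF2_continuousOn : ContinuousOn auF2 (Set.Ici 0) := by
  unfold auF2
  refine ContinuousOn.div (by fun_prop) (by fun_prop) ?_
  intro x hx
  have := au_one_le hx
  positivity

lemma auF_continuousOn : ContinuousOn auF (Set.Ici 0) :=
  fun _ hx => (auF_hasDerivAt hx).continuousAt.continuousWithinAt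

lemma auF_intervalIntegrable {a b : ℝ} (ha : 0 ≤ a) (hab : a ≤ b) :
    IntervalIntegrable auF MeasureTheory.volume a b := by
  refine ContinuousOn.intervalIntegrable_of_Icc hab (auF_continuousOn.mono ?_)
  exact fun x hx => ha.trans hx.1

lemma au_trap {a h : ℝ} (ha : 0 ≤ a) (hh : 0 < h) :
    |h / 2 * (auF a + auF (a + h)) - ∫ x in a..(a + h), auF x| ≤ h ^ 3 * Real.exp (-a) := by
  set w : ℝ → ℝ := fun x => (x - a) * (a + h - x) / 2 with hw
  have hwd : ∀ x, HasDerivAt w (a + h / 2 - x) x := by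
    intro x
    have := (((hasDerivAt_id x).sub_const a).mul ((hasDerivAt_id x).const_sub (a + h))).div_const 2
    refine this.congr_deriv ?_
    simp; ring
  have hab : a ≤ a + h := by linarith
  have hsub : Set.Icc a (a + h) ⊆ Set.Ici 0 := fun x hx => ha.trans hx.1
  have hint2 : IntervalIntegrable (fun x => auF2 x * w x) MeasureTheory.volume a (a + h) := by
    refine ContinuousOn.intervalIntegrable_of_Icc hab ((auF2_continuousOn.mono hsub).mul ?_)
    rw [hw]; fun_prop
  have hFTC : ∫ x in a..(a + h), (auF2 x * w x + auF x) =
      (auF1 (a + h) * w (a + h) - auF (a + h) * (a + h / 2 - (a + h)))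
        - (auF1 a * w a - auF a * (a + h / 2 - a)) := by
    refine intervalIntegral.integral_eq_sub_of_hasDerivAt
      (f := fun x => auF1 x * w x - auF x * (a + h / 2 - x)) ?_ (hint2.add (auF_intervalIntegrable ha hab))
    intro x hx
    rw [Set.uIcc_of_le hab] at hx
    have hx0 := hsub hx
    have := ((auF1_hasDerivAt hx0).mul (hwd x)).sub
      ((auF_hasDerivAt hx0).mul ((hasDerivAt_id x).const_sub (a + h / 2)))
    refine this.congr_deriv ?_
    simp; ring
  rw [intervalIntegral.integral_add hint2 (auF_intervalIntegrable ha hab)] at hFTC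
  have e : h / 2 * (auF a + auF (a + h)) - ∫ x in a..(a + h), auF x =
      ∫ x in a..(a + h), auF2 x * w x := by
    have w1 : w a = 0 := by simp [hw]
    have w2 : w (a + h) = 0 := by simp [hw]
    rw [w1, w2] at hFTC
    linarith
  rw [e]
  have := intervalIntegral.norm_integral_le_of_norm_le_const (a := a) (b := a + h)
    (f := fun x => auF2 x * w x) (C := h ^ 2 * Real.exp (-a)) ?_
  · rw [Real.norm_eq_abs] at this
    refine this.trans_eq ?_
    rw [add_sub_cancel_left, abs_of_pos hh]; ring
  · intro x hx
    rw [Set.uIoc_of_le hab] at hx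
    have hx0 : 0 ≤ x := ha.trans hx.1.le
    have b1 := auF2_bound hx0
    have b2 : Real.exp (-x) ≤ Real.exp (-a) := Real.exp_le_exp.2 (by linarith [hx.1])
    have b3 : |w x| ≤ h ^ 2 / 8 := by
      rw [hw, abs_le]
      have : 0 ≤ (x - a) * (a + h - x) := mul_nonneg (by linarith [hx.1]) (by linarith [hx.2])
      constructor
      · nlinarith
      · simp only
        nlinarith [sq_nonneg (x - a - h / 2)]
    rw [Real.norm_eq_abs, abs_mul]
    have hp := Real.exp_pos (-a)
    calc |auF2 x| * |w x| ≤ (4 * Real.exp (-a)) * (h ^ 2 / 8) := by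
          gcongr; linarith
      _ ≤ _ := by nlinarith [mul_pos hp (pow_pos hh 2)]

lemma auF_zero : auF 0 = 0 := by simp [auF]

lemma au_sum_trap {h : ℝ} (hh : 0 < h) (N : ℕ) :
    |h * (∑ k ∈ Finset.range N, auF ((k + 1 : ℕ) * h)) - h / 2 * auF (N * h)
      - ∫ x in (0:ℝ)..(N * h), auF x| ≤ h ^ 3 * ∑ k ∈ Finset.range N, Real.exp (-h) ^ k := by
  induction N with
  | zero => simp [auF_zero]
  | succ n ih =>
    have hn : 0 ≤ (n : ℝ) * h := by positivity
    have ht := au_trap hn hh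
    rw [Finset.sum_range_succ, Finset.sum_range_succ]
    have e1 : ((n + 1 : ℕ) : ℝ) * h = n * h + h := by push_cast; ring
    rw [e1]
    rw [← intervalIntegral.integral_add_adjacent_intervals (auF_intervalIntegrable le_rfl hn)
      (auF_intervalIntegrable hn (by linarith))]
    have e2 : Real.exp (-(n * h)) = Real.exp (-h) ^ n := by
      rw [← Real.exp_nat_mul]; congr 1; ring
    rw [e2] at ht
    rw [mul_add (h ^ 3)]
    refine le_trans (le_of_eq_of_le ?_ (abs_add_le _ _)) (add_le_add ih ht)
    congr 1
    ring

lemma auF_summable {h : ℝ} (hh : 0 < h) : Summable fun k : ℕ => auF ((k + 1 : ℕ) * h) := by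
  have hlt : Real.exp (-h) < 1 := by rw [Real.exp_lt_one_iff]; linarith
  refine Summable.of_nonneg_of_le (fun k => auF_nonneg (by positivity))
    (fun k => auF_le (by positivity)) ?_
  have := (summable_geometric_of_lt_one (Real.exp_pos (-h)).le hlt).comp_injective
    (add_left_injective 1)
  refine this.congr ?_
  intro k
  simp only [Function.comp]
  rw [← Real.exp_nat_mul]; congr 1; ring

lemma auF_integrable : MeasureTheory.IntegrableOn auF (Set.Ioi 0) := by
  refine MeasureTheory.Integrable.mono' (integrableOn_exp_neg_Ioi 0) ?_ ?_
  · exact (auF_continuousOn.mono Set.Ioi_subset_Ici_self).aestronglyMeasurable measurableSet_Ioi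
  · refine (MeasureTheory.ae_restrict_mem measurableSet_Ioi).mono ?_
    intro x hx
    have hx : (0:ℝ) ≤ x := le_of_lt hx
    rw [Real.norm_eq_abs, abs_of_nonneg (auF_nonneg hx)]
    exact auF_le hx

lemma au_main_bound {h : ℝ} (hh : 0 < h) :
    |(∑' k : ℕ, auF ((k + 1 : ℕ) * h)) - (∫ x in Set.Ioi 0, auF x) / h| ≤ h * (1 + h) := by
  have hlt : Real.exp (-h) < 1 := by rw [Real.exp_lt_one_iff]; linarith
  have hN : Tendsto (fun N : ℕ => (N : ℝ) * h) atTop atTop :=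
    tendsto_natCast_atTop_atTop.atTop_mul_const hh
  have t1 := (auF_summable hh).hasSum.tendsto_sum_nat
  have t2 := MeasureTheory.intervalIntegral_tendsto_integral_Ioi 0 auF_integrable hN
  have t3 : Tendsto (fun N : ℕ => auF (N * h)) atTop (𝓝 0) := by
    refine squeeze_zero (fun N => auF_nonneg (by positivity)) (fun N => auF_le (by positivity)) ?_
    exact Real.tendsto_exp_atBot.comp (tendsto_neg_atTop_atBot.comp hN)
  have t4 := (((t1.const_mul h).sub (t3.const_mul (h / 2))).sub t2).abs
  have t5 := ((hasSum_geometric_of_lt_one (Real.exp_pos (-h)).le hlt).tendsto_sum_nat).const_mul (h ^ 3)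
  have hle := le_of_tendsto_of_tendsto' t4 t5 (fun N => au_sum_trap hh N)
  have hexp : h / (1 + h) ≤ 1 - Real.exp (-h) := by
    have := Real.add_one_le_exp h
    rw [Real.exp_neg, div_le_iff₀ (by linarith)]
    have h2 : (Real.exp h)⁻¹ * (1 + h) ≤ 1 := by
      rw [inv_mul_le_iff₀ (Real.exp_pos h)]; linarith
    nlinarith
  have hinv : (1 - Real.exp (-h))⁻¹ ≤ (1 + h) / h := by
    rw [← inv_div]
    exact inv_anti₀ (by positivity) hexp
  have e : (∑' k : ℕ, auF ((k + 1 : ℕ) * h)) - (∫ x in Set.Ioi 0, auF x) / h =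
    (h * (∑' k : ℕ, auF ((k + 1 : ℕ) * h)) - h / 2 * 0 - ∫ x in Set.Ioi 0, auF x) / h := by
    field_simp
    ring
  rw [e, abs_div, abs_of_pos hh, div_le_iff₀ hh]
  refine hle.trans ?_
  calc h ^ 3 * (1 - Real.exp (-h))⁻¹ ≤ h ^ 3 * ((1 + h) / h) := by gcongr
    _ = h * (1 + h) * h := by field_simp

noncomputable def auG (s x : ℝ) : ℝ :=
  1 + 4 * Real.sinh s ^ 2 * (Real.exp (-x) * (1 - Real.exp (-x)))

noncomputable def auG' (s x : ℝ) : ℝ :=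
  8 * Real.sinh s * Real.cosh s * (Real.exp (-x) * (1 - Real.exp (-x))) / auG s x

lemma auG_one_le (s : ℝ) {x : ℝ} (hx : 0 ≤ x) : 1 ≤ auG s x := by
  have h1 := au_exp_le hx
  have h2 := Real.exp_pos (-x)
  have : 0 ≤ Real.exp (-x) * (1 - Real.exp (-x)) := mul_nonneg h2.le (by linarith)
  unfold auG
  have := mul_nonneg (mul_nonneg zero_le_four (sq_nonneg (Real.sinh s))) this
  linarith

lemma auG_factor (s x : ℝ) : auG s x =
    (Real.cosh s - Real.sinh s * (2 * Real.exp (-x) - 1)) *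
    (Real.cosh s + Real.sinh s * (2 * Real.exp (-x) - 1)) := by
  have := Real.cosh_sq s
  unfold auG
  linear_combination -this

lemma auG_factor_pos (s : ℝ) {x : ℝ} (hx : 0 ≤ x) :
    0 < Real.cosh s - Real.sinh s * (2 * Real.exp (-x) - 1) ∧
    0 < Real.cosh s + Real.sinh s * (2 * Real.exp (-x) - 1) := by
  have h1 := au_exp_le hx
  have h2 := Real.exp_pos (-x)
  have a1 : Real.cosh s + Real.sinh s = Real.exp s := Real.cosh_add_sinh s
  have a2 : Real.cosh s - Real.sinh s = Real.exp (-s) := Real.cosh_sub_sinh s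
  have e1 := Real.exp_pos s
  have e2 := Real.exp_pos (-s)
  set t := Real.exp (-x)
  have c : Real.cosh s = (Real.exp s + Real.exp (-s)) / 2 := Real.cosh_eq s
  have d : Real.sinh s = (Real.exp s - Real.exp (-s)) / 2 := Real.sinh_eq s
  rw [c, d]
  constructor
  · have : 0 ≤ (1 - t) * Real.exp s := mul_nonneg (by linarith) e1.le
    nlinarith [mul_pos h2 e2]
  · have : 0 ≤ (1 - t) * Real.exp (-s) := mul_nonneg (by linarith) e2.le
    nlinarith [mul_pos h2 e1]

lemma auG_logDeriv (s : ℝ) {x : ℝ} (hx : 0 ≤ x) :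
    HasDerivAt (fun s => Real.log (auG s x)) (auG' s x) s := by
  have h0 := auG_one_le s hx
  have h := (((((Real.hasDerivAt_sinh s).pow 2).const_mul 4).mul_const
    (Real.exp (-x) * (1 - Real.exp (-x)))).const_add 1).log (by
      have : auG s x ≠ 0 := by linarith
      simpa [auG] using this)
  refine h.congr_deriv ?_
  simp [auG', auG]
  ring

lemma auG_cont (s : ℝ) : ContinuousOn (fun x => Real.log (auG s x)) (Set.Ioi 0) := by
  refine ContinuousOn.log (by unfold auG; fun_prop) ?_
  intro x hx
  have := auG_one_le s (le_of_lt hx)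
  linarith

lemma auG'_cont (s : ℝ) : ContinuousOn (auG' s) (Set.Ioi 0) := by
  unfold auG'
  refine ContinuousOn.div (by fun_prop) (by unfold auG; fun_prop) ?_
  intro x hx
  have := auG_one_le s (le_of_lt hx)
  linarith

lemma auG'_bound (s : ℝ) {x : ℝ} (hx : 0 ≤ x) :
    ‖auG' s x‖ ≤ 8 * Real.cosh s ^ 2 * Real.exp (-x) := by
  have h0 := auG_one_le s hx
  have h1 := au_exp_le hx
  have h2 := Real.exp_pos (-x)
  have hc := Real.cosh_pos s
  have hs : |Real.sinh s| ≤ Real.cosh s := by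
    rw [abs_le]
    have := Real.cosh_add_sinh s
    have := Real.cosh_sub_sinh s
    constructor <;> linarith [Real.exp_pos s, Real.exp_pos (-s)]
  unfold auG'
  rw [Real.norm_eq_abs, abs_div, abs_of_nonneg (by linarith : 0 ≤ auG s x)]
  refine (div_le_self (abs_nonneg _) h0).trans ?_
  rw [abs_mul, abs_mul, abs_mul, abs_of_pos hc, abs_of_nonneg (by norm_num : (0:ℝ) ≤ 8),
    abs_of_nonneg (mul_nonneg h2.le (by linarith : 0 ≤ 1 - Real.exp (-x)))]
  calc 8 * |Real.sinh s| * Real.cosh s * (Real.exp (-x) * (1 - Real.exp (-x)))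
      ≤ 8 * Real.cosh s * Real.cosh s * (Real.exp (-x) * 1) := by
        gcongr
        linarith
    _ = _ := by ring

lemma auG_integrable (s : ℝ) :
    MeasureTheory.IntegrableOn (fun x => Real.log (auG s x)) (Set.Ioi 0) := by
  refine MeasureTheory.Integrable.mono' ((integrableOn_exp_neg_Ioi 0).const_mul (4 * Real.sinh s ^ 2)) ?_ ?_
  · exact (auG_cont s).aestronglyMeasurable measurableSet_Ioi
  · refine (MeasureTheory.ae_restrict_mem measurableSet_Ioi).mono ?_
    intro x hx
    have hx : (0:ℝ) ≤ x := le_of_lt hx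
    have h0 := auG_one_le s hx
    rw [Real.norm_eq_abs, abs_of_nonneg (Real.log_nonneg h0)]
    refine (Real.log_le_sub_one_of_pos (by linarith)).trans ?_
    unfold auG
    have : 0 ≤ 4 * Real.sinh s ^ 2 * Real.exp (-x) ^ 2 := by positivity
    linarith

lemma auJ_deriv (s : ℝ) : MeasureTheory.IntegrableOn (auG' s) (Set.Ioi 0) ∧
    HasDerivAt (fun s => ∫ x in Set.Ioi (0:ℝ), Real.log (auG s x))
      (∫ x in Set.Ioi (0:ℝ), auG' s x) s := by
  have hnhd : {r : ℝ | Real.cosh r < Real.cosh s + 1} ∈ 𝓝 s :=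
    (isOpen_lt Real.continuous_cosh continuous_const).mem_nhds (by simp)
  refine hasDerivAt_integral_of_dominated_loc_of_deriv_le
    (F := fun r x => Real.log (auG r x)) (F' := auG')
    (μ := MeasureTheory.volume.restrict (Set.Ioi (0:ℝ)))
    (bound := fun x => 8 * (Real.cosh s + 1) ^ 2 * Real.exp (-x)) hnhd ?_ (auG_integrable s) ?_ ?_ ?_ ?_
  · exact Eventually.of_forall fun r => (auG_cont r).aestronglyMeasurable measurableSet_Ioi
  · exact (auG'_cont s).aestronglyMeasurable measurableSet_Ioi
  · refine (MeasureTheory.ae_restrict_mem measurableSet_Ioi).mono ?_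
    intro x hx r hr
    refine (auG'_bound r (le_of_lt hx)).trans ?_
    have := Real.cosh_pos r
    have hr : Real.cosh r < Real.cosh s + 1 := hr
    gcongr
  · exact (integrableOn_exp_neg_Ioi 0).const_mul _
  · refine (MeasureTheory.ae_restrict_mem measurableSet_Ioi).mono ?_
    intro x hx r _
    exact auG_logDeriv r (le_of_lt hx)

lemma auG'_integral (s : ℝ) : ∫ x in Set.Ioi (0:ℝ), auG' s x = 4 * s := by
  by_cases hs : s = 0
  · subst hs; simp [auG']
  have hs' : Real.sinh s ≠ 0 := by rwa [Ne, Real.sinh_eq_zero]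
  set P : ℝ → ℝ := fun x =>
    -(Real.exp (-s) / Real.sinh s * Real.log (Real.cosh s - Real.sinh s * (2 * Real.exp (-x) - 1))
    + Real.exp s / Real.sinh s * Real.log (Real.cosh s + Real.sinh s * (2 * Real.exp (-x) - 1))) with hP
  have hd : ∀ x ∈ Set.Ici (0:ℝ), HasDerivAt P (auG' s x) x := by
    intro x hx
    obtain ⟨p1, p2⟩ := auG_factor_pos s hx
    have he := (((au_hasDerivAt_exp x).const_mul 2).sub_const 1).const_mul (Real.sinh s)
    have h1 := ((he.const_sub (Real.cosh s)).log p1.ne').const_mul (Real.exp (-s) / Real.sinh s)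
    have h2 := ((he.const_add (Real.cosh s)).log p2.ne').const_mul (Real.exp s / Real.sinh s)
    refine (h1.add h2).neg.congr_deriv ?_
    unfold auG'
    rw [auG_factor, ← Real.cosh_add_sinh s, ← Real.cosh_sub_sinh s]
    have q1 := p1.ne'
    have q2 := p2.ne'
    field_simp
    ring
  have hlim : Tendsto P atTop (𝓝 (-(Real.exp (-s) / Real.sinh s * s + Real.exp s / Real.sinh s * (-s)))) := by
    have he : Tendsto (fun x : ℝ => Real.exp (-x)) atTop (𝓝 0) := Real.tendsto_exp_neg_atTop_nhds_zero
    have hv := ((he.const_mul 2).sub_const 1).const_mul (Real.sinh s)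
    have l1 : Tendsto (fun x => Real.log (Real.cosh s - Real.sinh s * (2 * Real.exp (-x) - 1))) atTop (𝓝 s) := by
      have e : Real.cosh s - Real.sinh s * (2 * 0 - 1) = Real.exp s := by
        rw [← Real.cosh_add_sinh s]; ring
      have := (hv.const_sub (Real.cosh s)).log (by rw [e]; exact (Real.exp_pos _).ne')
      rwa [e, Real.log_exp] at this
    have l2 : Tendsto (fun x => Real.log (Real.cosh s + Real.sinh s * (2 * Real.exp (-x) - 1))) atTop (𝓝 (-s)) := by
      have e : Real.cosh s + Real.sinh s * (2 * 0 - 1) = Real.exp (-s) := by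
        rw [← Real.cosh_sub_sinh s]; ring
      have := (hv.const_add (Real.cosh s)).log (by rw [e]; exact (Real.exp_pos _).ne')
      rwa [e, Real.log_exp] at this
    exact ((l1.const_mul _).add (l2.const_mul _)).neg
  rw [MeasureTheory.integral_Ioi_of_hasDerivAt_of_tendsto' hd (auJ_deriv s).1 hlim]
  have e1 : Real.cosh s - Real.sinh s * (2 * 1 - 1) = Real.exp (-s) := by
    rw [← Real.cosh_sub_sinh s]; ring
  have e2 : Real.cosh s + Real.sinh s * (2 * 1 - 1) = Real.exp s := by
    rw [← Real.cosh_add_sinh s]; ring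
  simp only [hP, neg_zero, Real.exp_zero]
  rw [e1, e2, Real.log_exp, Real.log_exp, ← Real.cosh_add_sinh s, ← Real.cosh_sub_sinh s]
  field_simp
  ring

lemma auJ_eq (s : ℝ) : ∫ x in Set.Ioi (0:ℝ), Real.log (auG s x) = 2 * s ^ 2 := by
  have h : ∀ s : ℝ, HasDerivAt
      (fun s => (∫ x in Set.Ioi (0:ℝ), Real.log (auG s x)) - 2 * s ^ 2) 0 s := by
    intro s
    refine ((auJ_deriv s).2.sub ((hasDerivAt_pow 2 s).const_mul 2)).congr_deriv ?_
    rw [auG'_integral]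
    norm_num
    ring
  have := is_const_of_deriv_eq_zero (fun s => (h s).differentiableAt) (fun s => (h s).deriv) s 0
  simp [auG] at this
  simp only [auG]
  linarith

lemma auF_integral : ∫ x in Set.Ioi (0:ℝ), auF x = 2 * Real.log ((1 + Real.sqrt 5) / 2) ^ 2 := by
  rw [← auJ_eq]
  have h5 : Real.sqrt 5 ^ 2 = 5 := Real.sq_sqrt (by norm_num)
  have h0 : 0 < Real.sqrt 5 := by positivity
  have hs : Real.sinh (Real.log ((1 + Real.sqrt 5) / 2)) = 1 / 2 := by
    rw [Real.sinh_log (by positivity)]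
    field_simp
    nlinarith
  simp only [auG, auF, hs]
  congr 1
  ext x
  congr 1
  ring

theorem auluck_product_asymptotic :
    Tendsto (fun ε : ℝ =>
        (∏' k : ℕ, (1 + Real.exp (-(k + 1 : ℕ) * ε) - Real.exp (-(2 * (k + 1 : ℕ)) * ε))) /
          Real.exp (2 / ε * Real.log ((1 + Real.sqrt 5) / 2) ^ 2))
      (𝓝[>] 0) (𝓝 1) := by
  have hlim : Tendsto (fun ε : ℝ => (∑' k : ℕ, auF ((k + 1 : ℕ) * ε))
      - (∫ x in Set.Ioi 0, auF x) / ε) (𝓝[>] 0) (𝓝 0) := by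
    refine squeeze_zero_norm' (a := fun ε : ℝ => ε * (1 + ε)) ?_ ?_
    · filter_upwards [self_mem_nhdsWithin] with ε hε
      exact au_main_bound hε
    · have : Tendsto (fun ε : ℝ => ε * (1 + ε)) (𝓝 0) (𝓝 (0 * (1 + 0))) :=
        Continuous.tendsto (by fun_prop) 0
      rw [zero_mul] at this
      exact this.mono_left nhdsWithin_le_nhds
  have h := (Real.continuous_exp.tendsto 0).comp hlim
  rw [Real.exp_zero] at h
  refine h.congr' ?_
  filter_upwards [self_mem_nhdsWithin] with ε hε
  have hε : 0 < ε := hε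
  have e : ∀ k : ℕ, 1 + Real.exp (-(k + 1 : ℕ) * ε) - Real.exp (-(2 * (k + 1 : ℕ)) * ε) =
      1 + Real.exp (-((k + 1 : ℕ) * ε)) - Real.exp (-((k + 1 : ℕ) * ε)) ^ 2 := by
    intro k
    rw [← Real.exp_nat_mul]
    congr 2
    · congr 1; ring
    · push_cast; ring
  simp only [Function.comp]
  rw [tprod_congr e, ← Real.rexp_tsum_eq_tprod
    (fun k => lt_of_lt_of_le one_pos (au_one_le (by positivity))) (auF_summable hε), Real.exp_sub,
    auF_integral]
  congr 2
  ring
end
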